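/- arXiv:1807.07446 — 4 statements merged into one kernel-verified Lean document; each statement's English description precedes it below -/
import Mathlib

section
/- Let p be a prime and let ρ : C_p → GL_n(ℤ) be a faithful representation of the cyclic group C_p of order p, making ℤⁿ into a ℤC_p-module. Then rk_{C_p}(ℤⁿ) ≤ n − p + a, where a = 2 if p ≤ 19 and a = 3 otherwise. -/
/-- The minimal number of generators of `ℤⁿ` as a `ℤG`-module, where the
`G`-action on `ℤⁿ` is given by the integral representation `ρ : G → GL_n(ℤ)`. -/
noncomputable def moduleRank (n : ℕ) {G : Type*} [Group G]
    (ρ : G →* Matrix.GeneralLinearGroup (Fin n) ℤ) : ℕ :=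
  sInf {k | ∃ S : Finset (Fin n → ℤ), S.card = k ∧
    Submodule.span ℤ
      {x | ∃ g : G, ∃ s ∈ S, x = ((ρ g : Matrix (Fin n) (Fin n) ℤ)).mulVec s} = ⊤}

/-- The first `k` ternary digits of `n`. -/
def ternaryDigits : ℕ → ℕ → List ℕ
  | 0, _ => []
  | k + 1, n => n % 3 :: ternaryDigits k (n / 3)

/-- Horner evaluation of the polynomial with the given list of coefficients. -/
def evalList {R : Type*} [CommSemiring R] (x : R) : List ℕ → R
  | [] => 0
  | a :: c => a + x * evalList x c

/-- Horner evaluation on natural numbers, in a form which the kernel evaluates quickly. -/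
def evalListNat (x : ℕ) : List ℕ → ℕ
  | [] => 0
  | a :: c => a + x * evalListNat x c

/-- The sum of the squares of the entries of a list. -/
def sumSq : List ℕ → ℕ
  | [] => 0
  | a :: c => a * a + sumSq c

/-- For a list `c` of length `p` and a primitive `p`-th root of unity `ζ`, this is the sum of the
squared absolute values of the conjugates of `∑ cᵢ ζⁱ`. -/
def traceForm (p : ℕ) (c : List ℕ) : ℕ :=
  p * sumSq c - evalListNat 1 c * evalListNat 1 c

/-- The test, through the inequality of arithmetic and geometric means, that `∑ cᵢ ζⁱ` is nonzero
of norm less than `m ^ 2`. -/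
def isShort (p m : ℕ) (c : List ℕ) : Bool :=
  Nat.blt 0 (traceForm p c) &&
    Nat.blt (traceForm p c ^ (p - 1)) ((m ^ 2) ^ 2 * (p - 1) ^ (p - 1))

/-- A test which only composite numbers fail, apart from `0` and `1`. -/
def failsFermat (m : ℕ) : Bool :=
  Nat.blt m 2 || (Nat.blt 7 m && m % 7 == 0) ||
    (Nat.blt 3 m && (2 ^ (m - 1) % m != 1 || 3 ^ (m - 1) % m != 1))

/-- `∑ cᵢ xⁱ` is short, and vanishes at a nontrivial `p`-th root of unity modulo `m = p * j + 1`. -/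
def isShortAtRoot (p j m : ℕ) (c : List ℕ) : Bool :=
  isShort p m c && [2, 3, 5].any fun b ↦
    (b ^ j % m != 1 && (b ^ j % m) ^ p % m == 1) && evalListNat (b ^ j % m) c % m == 0

/-- The list of codes provides short elements for all primes `p * i + 1` with `1 ≤ i ≤ j`. -/
def checkSplit (p : ℕ) : ℕ → List ℕ → Bool
  | 0, _ => true
  | j + 1, t => bif failsFermat (p * (j + 1) + 1) then checkSplit p j t else
      match t with
      | [] => false
      | n :: t' => isShortAtRoot p (j + 1) (p * (j + 1) + 1) (ternaryDigits p n) &&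
          checkSplit p j t'

/-- Multiplication by `x ^ i` modulo `x ^ p - 1` on lists of length `p`. -/
def rotateBy (p i : ℕ) (b : List ℕ) : List ℕ := b.drop (p - i) ++ b.take (p - i)

/-- The product of `∑ bᵢ xⁱ` with `∑ cᵢ x^(k i)` modulo `x ^ p - 1`. -/
def mulConj (p k : ℕ) (b : List ℕ) : List ℕ → List ℕ
  | [] => List.replicate p 0
  | a :: c => List.zipWith (· + ·) (b.map (a * ·)) (rotateBy p k (mulConj p k b c))

/-- The product of the `∑ cᵢ x^(k i)` for `1 ≤ k ≤ n`, modulo `x ^ p - 1`. -/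
def conjProd (p : ℕ) (c : List ℕ) : ℕ → List ℕ
  | 0 => 1 :: List.replicate (p - 1) 0
  | n + 1 => mulConj p (n + 1) (conjProd p c n) c

/-- All entries of a list agree modulo `l`. -/
def isConstMod (l : ℕ) : List ℕ → Bool
  | [] => true
  | a :: c => c.all fun b ↦ b % l == a % l

/-- `special` provides short elements of norm divisible by `l` for every prime `l < L` with
`l ≢ 1 [MOD p]` and all residue degrees `2 ≤ f < 17` such that `l ^ f ≤ M`. -/
def checkInert (p M : ℕ) (special : List (ℕ × ℕ)) : ℕ → Bool
  | 0 => true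
  | l + 1 => checkInert p M special l &&
      (failsFermat l || l % p == 1 || (List.range 15).all fun f ↦
        l ^ (f + 2) % p != 1 || Nat.blt M (l ^ (f + 2)) || special.any fun s ↦
          s.1 == l && isShort p (l ^ (f + 2)) (ternaryDigits p s.2) &&
            isConstMod l (conjProd p (ternaryDigits p s.2) ((p + 1) / 2)))

/-- Ternary codes of short elements of the primes of norm `m ≡ 1 [MOD 17]`, by decreasing `m`. -/
def shortCodesSeventeen : List ℕ :=
  [78925524, 59807025, 66342249, 63152814, 64925111, 65101308, 59964185, 59970822, 83701919,
   59787345, 69411395, 64572504, 64631322, 69412092, 64552500, 69510510, 66105108, 62798616,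
   64766904, 64548203, 50220522, 50218962, 50218740, 66170925, 64373334, 64747152, 64569804,
   64746486, 62973477, 65278698, 64766922, 64392882, 64517339, 62976519, 64550147, 64626702,
   64626696, 62994702, 59609988, 65121273, 64589301, 64575936, 60317820, 64766909, 59787369,
   64579074, 66165210, 78916871, 59612148, 58192800, 64040799, 64517622, 69359526, 64038366,
   64038804, 59787023, 107793954, 50752368, 64503744, 69333396, 62975988, 60317826, 62798364,
   77324580, 64629942, 69353082, 64628388, 78978012, 64570152, 64550148, 50220438, 64567860,
   77324586, 78918977, 64510704, 66184080, 64038555, 64628877, 65042448, 62975747, 64550322,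
   64590485, 64569426, 62798598, 64589673, 62975781, 64629099, 64567899, 66164310, 64628399,
   64629117, 50221253, 64563507, 64038642, 64563599, 64576650, 64570002, 64569342, 64572276,
   59787102]

/-- Ternary codes of short elements of the primes of norm `m ≡ 1 [MOD 19]`, by decreasing `m`. -/
def shortCodesNineteen : List ℕ :=
  [566788356, 579553926, 536509607, 538022736, 565185402, 451990584, 581132169, 537604980,
   538556130, 451459449, 566787647, 579615162, 581137787, 451479552, 538149537, 576327438,
   538261164, 568553256, 536431361, 667205214, 582666666, 456714477, 586090685, 586386306,
   456773262, 566723583, 624098700, 710087274, 710292845, 596011104, 451931789, 624138054,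
   581109108, 451999071, 600203549, 439176935, 466337259, 596010591, 586624385, 576367524,
   579064740, 624184062, 709732152, 581110332, 581190048, 586622310, 566840055, 710250563,
   667165164, 619374780, 566768454, 624118326, 581139731, 581301600, 466516536, 710329203,
   595477446, 600262587, 447211973, 566775756, 538261404, 590696550, 703900188, 580605774,
   619394231, 622576608, 709555734, 753494670, 576348039, 581684213, 451792986, 624197223,
   581191983, 724796921, 710783388, 585382512, 639057825, 576287988, 581110002, 710723592,
   596016906, 587510286, 580975368, 619387830, 586092942, 452043027, 595539390, 538077213,
   622602720, 595482545, 567136044, 567319014, 622640063, 453584886, 580592682, 582902274,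
   579529685, 581187666, 724449215, 710447931, 584320113, 704956446, 705490116, 624334668,
   566784090, 452049648, 566722536, 581132187, 585756198, 581655588, 622641935, 453584808,
   581131224, 452056097, 566843139, 579595704, 595282812, 581682665, 566939250, 538078140,
   581131253, 709148940, 577882793, 579715740, 710445942, 580776768, 451950468, 566795673,
   576164129, 595482078, 579543696, 708737805, 571565043, 538105842, 452046672, 710979252,
   537572277, 451872443, 610007892, 581655864, 624235746, 537553209, 456773861, 542866709,
   580953564, 579720048, 566959241, 437641902, 582784085, 710448120, 576525627, 450579951,
   580973292, 447148512, 968491890, 538621769, 538064363, 619413921, 724600194, 593891793,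
   538142334, 582777504, 711685881, 584319042, 585920333, 576524172, 665623278, 623646024,
   586445154, 580593444, 622563689, 575818506, 710095212, 595475273, 447201006, 536489199,
   753396354, 580769865, 623643786, 593944605, 581609765, 581105223, 610360002, 581309352,
   582744951, 581660016, 585920207, 582659453, 580933224, 582744573, 624175338, 595492787,
   576354396, 566250306, 580597319, 624177605, 579478077, 537887151, 624689202, 628960349,
   451971101, 710270795, 581605227, 624112083, 452522700, 542807700, 579535443, 581132763,
   579475176, 579539243, 581682087, 582194367, 552413205, 538263252, 625774691, 571562592,
   579358539, 619374834, 710262389, 580619718, 581681763, 582705117, 582783131, 537553278,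
   710211105, 595506123, 576465869, 576339041, 523754795, 538102962, 581248710, 579516561,
   581136831, 585736794, 585907812, 595481123, 709719527, 595538793, 566779728, 582731586,
   581657553, 695922066, 576349686, 595420584, 580245738, 1097691372, 595656960, 538077429,
   581148315, 724620771, 581132934, 584312895, 595419885, 538084809, 581157204, 582705155,
   580592651, 581111118, 451983294, 710329853, 585911505, 456773508, 639057771, 624197405,
   581078316, 597074202, 582783615, 542873621, 582725333, 451970892, 596010834, 627346422,
   582193662, 585382182, 579477629, 576346977, 566802234, 451986113, 624184008, 580778615,
   538066512, 595676477, 585914508, 581664348, 452524439, 581110728, 580599324, 587507364,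
   709719738, 552427092, 625752102, 408943842, 585874325, 580973259, 566781725, 453643962,
   451931681, 624118637, 581327556, 595597709, 408884789, 581664305, 575875359, 581192058,
   565010273, 624158471, 711806085, 579516977, 575795909, 583255739, 710507331, 580972554,
   582725313, 625772010, 623980649, 566761482, 582725778, 538104015, 585916643, 571564035,
   450415953, 595538579, 710273328, 542335779, 566958888, 595300547, 581144580, 581328300,
   595499346, 581605551, 580933908, 451833093, 579477375, 451638450, 581123909, 581102334,
   453532403, 538031601, 579534435, 586504188, 695390550, 711865230, 579005682, 580975697,
   552439469, 579543216, 582659687, 595478178, 523734867, 542847539, 581132667, 580951649,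
   624708999, 624197862, 585933150, 595482077, 580579535, 581603370, 574753668, 538149593,
   580592079, 451991214, 566959698, 580428713, 566801496, 568356473, 466398603, 581366963,
   581130456, 582901445, 581654880, 581659740, 581307786, 538261875, 579534312, 538084089,
   580952784, 447207849, 450396006, 624170889, 538065045, 705546978, 581123529, 582665928,
   710268671, 619395216, 710277540, 581124258, 577942337, 538595777, 580973352, 581132646,
   581150250, 581287962, 582554472, 580951323, 576407046, 566959185, 586445232, 595473102,
   581131541, 580946301, 593707437, 579529521, 581104458, 585933131, 582665733, 579529899,
   638526330, 567315363, 714876707, 538081590, 580599065, 581301309, 452519826, 537913499,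
   579594969, 595656767, 710329950, 451983768, 624711078, 581192208, 628980108, 581329746,
   710507171, 466319790, 711863021, 576347526, 447207671, 581325372, 709738722, 566783939,
   585913529, 622583163, 580600044, 538083978, 609808889, 446676237, 582725675, 579477120,
   581664269, 581124161, 566722770, 624237234, 579516720, 624709143, 538086159, 580658370,
   597067398, 581072328, 624689214, 579516492, 711865206, 581190534, 580422168, 538143798,
   580600104, 581124060, 579542898, 566243832, 580579842, 579536643, 576341112, 437635098,
   582784116, 623646738, 624157764, 587507946, 595302726, 582705300, 580618254, 581073900,
   581301246, 580599204, 595479359, 582724397, 582725808, 580658427, 595303209, 542873538,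
   566250390, 538077420, 565186776, 566722704, 451990836, 581664282, 624000303, 581130479,
   581110961, 581124408, 579359259, 581654874, 581189694, 970145550, 624177426, 710268684,
   579536334, 582717768, 566250354, 581130072, 581137365, 593885556, 576524880, 581190102,
   579516636, 566250473, 595479665, 582665274, 580592736, 538084104, 537906834, 580579632,
   581130036, 579537129, 582666252, 580542420, 580538052, 585972725, 585972726, 566781815,
   710264310, 538083918, 581150196, 538081818, 581189670, 566782062, 581137043, 710093724,
   624177360, 538025208, 581668728, 581071917, 581301315, 538083983, 582731646, 538083275,
   580540236, 538081817, 579536157, 451459206, 581187587, 581307791, 581131487, 579556091,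
   451990649, 581307876, 710271623, 624118403, 581307888, 624177456, 538083765, 579536382,
   581137296, 581132922, 581130000]

section TraceForm

theorem evalList_eq_sum {R : Type*} [CommSemiring R] (x : R) (c : List ℕ) :
    evalList x c = ∑ i : Fin c.length, (c.get i : R) * x ^ (i : ℕ) := by
  induction c with
  | nil => simp [evalList]
  | cons a c ih =>
    refine Eq.trans ?_ (Fin.sum_univ_succ (n := c.length) _).symm
    simp only [evalList, ih, Finset.mul_sum]
    simp [pow_succ, mul_assoc, mul_comm]

theorem evalListNat_eq_evalList (x : ℕ) (c : List ℕ) : evalListNat x c = evalList x c := by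
  induction c with
  | nil => rfl
  | cons a c ih => simp [evalList, evalListNat, ih]

theorem sumSq_eq_sum (c : List ℕ) : sumSq c = ∑ i : Fin c.length, c.get i ^ 2 := by
  induction c with
  | nil => rfl
  | cons a c ih =>
    refine Eq.trans ?_ (Fin.sum_univ_succ (n := c.length) _).symm
    simp [sumSq, ih, sq]

theorem map_evalList {R S F : Type*} [CommSemiring R] [CommSemiring S] [FunLike F R S]
    [RingHomClass F R S] (f : F) (x : R) (c : List ℕ) :
    f (evalList x c) = evalList (f x) c := by
  simp [evalList_eq_sum]

open ComplexConjugate in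
/-- Parseval's identity on the `p`-th roots of unity. -/
theorem sum_normSq_evalList {ω : ℂ} {c : List ℕ} (hω : IsPrimitiveRoot ω c.length)
    (hc : c.length ≠ 0) :
    ∑ j ∈ Finset.range c.length, Complex.normSq (evalList (ω ^ j) c) =
      c.length * (sumSq c : ℝ) := by
  have hnorm : ω * conj ω = 1 := by
    rw [Complex.mul_conj, Complex.normSq_eq_norm_sq, hω.norm'_eq_one hc]; simp
  have hgeom (i k : Fin c.length) : ∑ j ∈ Finset.range c.length,
      (ω ^ j) ^ (i : ℕ) * conj ((ω ^ j) ^ (k : ℕ)) = if i = k then (c.length : ℂ) else 0 := by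
    have h : ∀ j, (ω ^ j) ^ (i : ℕ) * conj ((ω ^ j) ^ (k : ℕ)) =
        (ω ^ (i : ℕ) * conj ω ^ (k : ℕ)) ^ j := fun j ↦ by
      simp only [map_pow]; ring
    simp only [h]
    split_ifs with hik
    · subst hik
      simp [← mul_pow, hnorm]
    · have hne : ω ^ (i : ℕ) * conj ω ^ (k : ℕ) ≠ 1 := fun h1 ↦ hik <| Fin.ext <|
        hω.pow_inj i.2 k.2 <| by
          calc ω ^ (i : ℕ) = ω ^ (i : ℕ) * (ω * conj ω) ^ (k : ℕ) := by simp [hnorm]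
            _ = ω ^ (i : ℕ) * conj ω ^ (k : ℕ) * ω ^ (k : ℕ) := by ring
            _ = ω ^ (k : ℕ) := by rw [h1, one_mul]
      have hpow : (ω ^ (i : ℕ) * conj ω ^ (k : ℕ)) ^ c.length = 1 := by
        rw [mul_pow, pow_right_comm, pow_right_comm _ (k : ℕ), ← map_pow, hω.pow_eq_one]
        simp
      have := geom_sum_mul (ω ^ (i : ℕ) * conj ω ^ (k : ℕ)) c.length
      rw [hpow, sub_self] at this
      exact (mul_eq_zero.mp this).resolve_right (sub_ne_zero.mpr hne)
  have key : ∀ j, ((Complex.normSq (evalList (ω ^ j) c) : ℝ) : ℂ) =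
      ∑ i : Fin c.length, ∑ k : Fin c.length, (c.get i : ℂ) * c.get k *
        ((ω ^ j) ^ (i : ℕ) * conj ((ω ^ j) ^ (k : ℕ))) := fun j ↦ by
    rw [← Complex.mul_conj, evalList_eq_sum, map_sum, Finset.sum_mul_sum]
    refine Finset.sum_congr rfl fun i _ ↦ Finset.sum_congr rfl fun k _ ↦ ?_
    rw [map_mul, Complex.conj_natCast]; ring
  rw [← Complex.ofReal_inj]
  push_cast
  simp only [key]
  rw [Finset.sum_comm]
  simp_rw [Finset.sum_comm (s := Finset.range c.length), ← Finset.mul_sum, hgeom]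
  simp only [mul_ite, mul_zero, Finset.sum_ite_eq, Finset.mem_univ, if_true, sumSq_eq_sum]
  push_cast
  rw [Finset.mul_sum]
  exact Finset.sum_congr rfl fun i _ ↦ by ring

theorem sum_primitiveRoots_normSq_evalList {c : List ℕ} (hc : c.length.Prime) :
    ∑ z ∈ primitiveRoots c.length ℂ, Complex.normSq (evalList z c) =
      c.length * (sumSq c : ℝ) - (evalList 1 c : ℕ) ^ 2 := by
  have : NeZero c.length := ⟨hc.ne_zero⟩
  have hω := Complex.isPrimitiveRoot_exp c.length hc.ne_zero
  set ω := Complex.exp (2 * Real.pi * Complex.I / c.length)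
  have himage : primitiveRoots c.length ℂ = ((Finset.range c.length).erase 0).image (ω ^ ·) := by
    ext z
    simp only [Finset.mem_image, Finset.mem_erase, Finset.mem_range,
      mem_primitiveRoots hc.pos, hω.isPrimitiveRoot_iff]
    constructor
    · rintro ⟨i, hi, hco, rfl⟩
      refine ⟨i, ⟨?_, hi⟩, rfl⟩
      rintro rfl
      exact hc.one_lt.ne' (by simpa using hco)
    · rintro ⟨i, ⟨h0, hi⟩, rfl⟩
      exact ⟨i, hi, (hc.coprime_iff_not_dvd.mpr
        (Nat.not_dvd_of_pos_of_lt (Nat.pos_of_ne_zero h0) hi)).symm, rfl⟩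
  rw [himage, Finset.sum_image, ← sum_normSq_evalList hω hc.ne_zero,
    ← Finset.sum_erase_add _ _ (Finset.mem_range.mpr hc.pos)]
  · have : evalList (1 : ℂ) c = ((evalList 1 c : ℕ) : ℂ) := by
      simpa using (map_evalList (Nat.castRingHom ℂ) 1 c).symm
    rw [pow_zero, this, Complex.normSq_natCast]
    ring
  · intro i hi j hj h
    simp only [Finset.coe_erase, Finset.coe_range, Set.mem_sdiff, Set.mem_Iio] at hi hj
    exact hω.pow_inj hi.1 hj.1 h

end TraceForm

/-- The inequality of arithmetic and geometric means, without roots. -/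
theorem prod_le_sum_div_card_pow {ι : Type*} (s : Finset ι) (z : ι → ℝ) (hz : ∀ i ∈ s, 0 ≤ z i)
    (hs : s.Nonempty) : ∏ i ∈ s, z i ≤ ((∑ i ∈ s, z i) / s.card) ^ s.card := by
  have hpos : (0 : ℝ) < s.card := by exact_mod_cast hs.card_pos
  have := Real.geom_mean_le_arith_mean s (fun _ ↦ 1) z (by simp) (by simpa using hpos) hz
  simp only [Real.rpow_one, Finset.sum_const, nsmul_eq_mul, mul_one, one_mul] at this
  calc ∏ i ∈ s, z i = ((∏ i ∈ s, z i) ^ (s.card : ℝ)⁻¹) ^ s.card :=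
        (Real.rpow_inv_natCast_pow (Finset.prod_nonneg hz) hs.card_pos.ne').symm
    _ ≤ _ := pow_le_pow_left₀ (Real.rpow_nonneg (Finset.prod_nonneg hz) _) this _

section CyclotomicNorm

open NumberField Polynomial

variable {K : Type*} [Field K] [NumberField K] {p : ℕ} [hp : Fact p.Prime]
  [IsCyclotomicExtension {p} ℚ K]

theorem sum_embeddings_normSq_evalList {ζ : K} (hζ : IsPrimitiveRoot ζ p) {c : List ℕ}
    (hc : c.length = p) :
    ∑ σ : K →ₐ[ℚ] ℂ, Complex.normSq (σ (evalList ζ c)) =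
      p * (sumSq c : ℝ) - (evalList 1 c : ℕ) ^ 2 := by
  subst hc
  rw [← sum_primitiveRoots_normSq_evalList hp.out, ← Finset.sum_coe_sort (primitiveRoots _ ℂ)]
  refine Fintype.sum_equiv (hζ.embeddingsEquivPrimitiveRoots ℂ
    (cyclotomic.irreducible_rat hp.out.pos)) _ _ fun σ ↦ ?_
  simp [map_evalList]

theorem norm_sq_le_of_evalList {ζ : K} (hζ : IsPrimitiveRoot ζ p) {c : List ℕ}
    (hc : c.length = p) :
    ((Algebra.norm ℚ (evalList ζ c) : ℚ) : ℝ) ^ 2 ≤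
      ((p * (sumSq c : ℝ) - (evalList 1 c : ℕ) ^ 2) / (p - 1 : ℕ)) ^ (p - 1) := by
  have hcard : (Finset.univ : Finset (K →ₐ[ℚ] ℂ)).card = p - 1 := by
    rw [Finset.card_univ, AlgHom.card, IsCyclotomicExtension.finrank (n := p) K
      (cyclotomic.irreducible_rat hp.out.pos), Nat.totient_prime hp.out]
  have hprod : ((Algebra.norm ℚ (evalList ζ c) : ℚ) : ℝ) ^ 2 =
      ∏ σ : K →ₐ[ℚ] ℂ, Complex.normSq (σ (evalList ζ c)) := by
    rw [← map_prod, ← Algebra.norm_eq_prod_embeddings]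
    simp [Complex.normSq_apply, sq]
  rw [hprod, ← sum_embeddings_normSq_evalList hζ hc, ← hcard]
  refine prod_le_sum_div_card_pow _ _ (fun _ _ ↦ Complex.normSq_nonneg _) ?_
  rw [← Finset.card_pos, hcard]
  exact Nat.sub_pos_of_lt hp.out.one_lt

theorem norm_lt_of_isShort {ζ : 𝓞 K} (hζ : IsPrimitiveRoot ζ p) {c : List ℕ}
    (hc : c.length = p) {m : ℕ} (h : isShort p m c = true) :
    evalList ζ c ≠ 0 ∧ (Algebra.norm ℤ (evalList ζ c)).natAbs < m ^ 2 := by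
  have hζ' : IsPrimitiveRoot (algebraMap (𝓞 K) K ζ) p :=
    hζ.map_of_injective (FaithfulSMul.algebraMap_injective _ _)
  simp only [isShort, Bool.and_eq_true, Nat.blt_eq] at h
  obtain ⟨hpos, hlt⟩ := h
  have htrace : (traceForm p c : ℝ) = p * (sumSq c : ℝ) - (evalList 1 c : ℕ) ^ 2 := by
    rw [traceForm, evalListNat_eq_evalList] at hpos ⊢
    rw [Nat.cast_sub (by omega)]
    push_cast; ring
  constructor
  · intro h0
    have := sum_embeddings_normSq_evalList hζ' hc
    rw [← map_evalList, h0, ← htrace] at this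
    have h1 : (0 : ℝ) < traceForm p c := by exact_mod_cast hpos
    simp at this
    linarith
  · have hle := norm_sq_le_of_evalList hζ' hc
    rw [← map_evalList, ← htrace, ← Algebra.coe_norm_int, div_pow, le_div_iff₀] at hle
    · have hle' : (Algebra.norm ℤ (evalList ζ c)).natAbs ^ 2 * (p - 1) ^ (p - 1) ≤
          traceForm p c ^ (p - 1) := by
        zify
        rw [sq_abs]
        exact_mod_cast hle
      exact lt_of_pow_lt_pow_left₀ 2 (Nat.zero_le _)
        (lt_of_mul_lt_mul_right (hle'.trans_lt hlt) (Nat.zero_le _))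
    · have := Nat.sub_pos_of_lt hp.out.one_lt
      positivity

end CyclotomicNorm

section Soundness

theorem length_ternaryDigits (k n : ℕ) : (ternaryDigits k n).length = k := by
  induction k generalizing n with
  | zero => rfl
  | succ k ih => simp [ternaryDigits, ih]

theorem failsFermat_eq_false {m : ℕ} (hm : m.Prime) : failsFermat m = false := by
  have hfermat (b : ℕ) (hb : ¬ m ∣ b) : b ^ (m - 1) % m = 1 := by
    have := Nat.ModEq.pow_totient (((hm.coprime_iff_not_dvd).mpr hb).symm)
    rw [Nat.totient_prime hm] at this
    rw [this, Nat.mod_eq_of_lt hm.one_lt]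
  have h7 : 7 < m → m % 7 ≠ 0 := fun h h0 ↦ by
    have := (Nat.prime_dvd_prime_iff_eq Nat.prime_seven hm).mp (Nat.dvd_of_mod_eq_zero h0)
    omega
  have h2 : 3 < m → 2 ^ (m - 1) % m = 1 := fun h ↦
    hfermat 2 fun hd ↦ by have := Nat.le_of_dvd two_pos hd; omega
  have h3 : 3 < m → 3 ^ (m - 1) % m = 1 := fun h ↦
    hfermat 3 fun hd ↦ by have := Nat.le_of_dvd three_pos hd; omega
  have := hm.two_le
  rw [← Bool.not_eq_true]
  simp only [failsFermat, Bool.or_eq_true, Bool.and_eq_true, Nat.blt_eq, beq_iff_eq, bne_iff_ne]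
  grind

theorem exists_of_isShortAtRoot {p j m : ℕ} {c : List ℕ} (h : isShortAtRoot p j m c = true) :
    isShort p m c = true ∧ ∃ r < m, r ≠ 1 ∧ r ^ p % m = 1 ∧ m ∣ evalList r c := by
  simp only [isShortAtRoot, Bool.and_eq_true, List.any_eq_true, bne_iff_ne, beq_iff_eq] at h
  obtain ⟨hs, b, -, ⟨h1, hp⟩, h0⟩ := h
  refine ⟨hs, b ^ j % m, Nat.mod_lt _ (Nat.pos_of_ne_zero ?_), h1, hp,
    evalListNat_eq_evalList _ c ▸ Nat.dvd_of_mod_eq_zero h0⟩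
  rintro rfl
  simp_all [isShort]

theorem exists_of_checkSplit {p j : ℕ} {t : List ℕ} (h : checkSplit p j t = true) {i : ℕ}
    (hi : 1 ≤ i) (hij : i ≤ j) (hprime : (p * i + 1).Prime) :
    ∃ c : List ℕ, c.length = p ∧ isShortAtRoot p i (p * i + 1) c = true := by
  induction j generalizing t with
  | zero => omega
  | succ j ih =>
    rw [checkSplit.eq_def] at h
    simp only at h
    rcases hij.lt_or_eq with hlt | rfl
    · cases hf : failsFermat (p * (j + 1) + 1) with
      | true => exact ih (by simpa [hf] using h) (by omega)
      | false =>
        cases t with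
        | nil => simp [hf] at h
        | cons n t =>
          rw [hf, cond_false, Bool.and_eq_true] at h
          exact ih h.2 (by omega)
    · rw [failsFermat_eq_false hprime, cond_false] at h
      cases t with
      | nil => simp at h
      | cons n t =>
        rw [Bool.and_eq_true] at h
        exact ⟨_, length_ternaryDigits p n, h.1⟩

theorem exists_of_checkInert {p M L : ℕ} {special : List (ℕ × ℕ)}
    (h : checkInert p M special L = true) {l f : ℕ} (hl : l.Prime) (hL : l < L)
    (hlp : l % p ≠ 1) (hf : 2 ≤ f) (hf' : f < 17) (hlf : l ^ f % p = 1) (hM : l ^ f ≤ M) :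
    ∃ c : List ℕ, c.length = p ∧ isShort p (l ^ f) c = true ∧
      isConstMod l (conjProd p c ((p + 1) / 2)) = true := by
  induction L with
  | zero => omega
  | succ L ih =>
    rw [checkInert, Bool.and_eq_true] at h
    rcases (Nat.le_of_lt_succ hL).lt_or_eq with hlt | rfl
    · exact ih h.1 hlt
    · have h2 := h.2
      simp only [failsFermat_eq_false hl, Bool.false_or, Bool.or_eq_true, beq_iff_eq, hlp, false_or,
        List.all_eq_true, List.mem_range] at h2
      have h3 := h2 (f - 2) (by omega)
      rw [Nat.sub_add_cancel hf] at h3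
      simp only [bne_iff_ne, hlf, ne_eq, not_true_eq_false, Nat.blt_eq, hM.not_gt, false_or,
        List.any_eq_true, Bool.and_eq_true, beq_iff_eq] at h3
      obtain ⟨s, -, ⟨-, hs⟩, hc⟩ := h3
      exact ⟨_, length_ternaryDigits p s.2, hs, hc⟩

variable {R : Type*} [CommSemiring R] (x : R)

theorem evalList_append (a b : List ℕ) :
    evalList x (a ++ b) = evalList x a + x ^ a.length * evalList x b := by
  induction a with
  | nil => simp [evalList]
  | cons n a ih => simp [evalList, ih, pow_succ]; ring

theorem evalList_replicate_zero (n : ℕ) : evalList x (List.replicate n 0) = 0 := by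
  induction n with
  | zero => rfl
  | succ n ih => simp [List.replicate_succ, evalList, ih]

theorem evalList_map_mul (a : ℕ) (b : List ℕ) :
    evalList x (b.map (a * ·)) = a * evalList x b := by
  induction b with
  | nil => simp [evalList]
  | cons n b ih => simp only [List.map_cons, evalList, ih]; push_cast; ring

theorem evalList_zipWith_add {a b : List ℕ} (h : a.length = b.length) :
    evalList x (List.zipWith (· + ·) a b) = evalList x a + evalList x b := by
  induction a generalizing b with
  | nil => simp_all [evalList, List.length_eq_zero_iff.mp h.symm]
  | cons n a ih =>
    cases b with
    | nil => simp at h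
    | cons m b =>
      simp only [List.zipWith_cons_cons, evalList, ih (by simpa using h)]
      push_cast; ring

theorem length_rotateBy {p i : ℕ} {b : List ℕ} (hb : b.length = p) :
    (rotateBy p i b).length = p := by
  simp [rotateBy, hb]

variable {x}

theorem evalList_rotateBy {p i : ℕ} {b : List ℕ} (hx : x ^ p = 1) (hb : b.length = p)
    (hi : i ≤ p) : evalList x (rotateBy p i b) = x ^ i * evalList x b := by
  conv_rhs => rw [← List.take_append_drop (p - i) b]
  rw [rotateBy, evalList_append, evalList_append, List.length_drop, List.length_take, hb,
    min_eq_left (Nat.sub_le p i), Nat.sub_sub_self hi, mul_add, ← mul_assoc, ← pow_add,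
    Nat.add_sub_cancel' hi, hx]
  ring

theorem length_mulConj {p k : ℕ} {b : List ℕ} (hb : b.length = p) (c : List ℕ) :
    (mulConj p k b c).length = p := by
  induction c with
  | nil => simp [mulConj]
  | cons a c ih => simp [mulConj, hb, length_rotateBy ih]

theorem evalList_mulConj {p k : ℕ} {b : List ℕ} (hx : x ^ p = 1) (hb : b.length = p)
    (hk : k ≤ p) (c : List ℕ) :
    evalList x (mulConj p k b c) = evalList x b * evalList (x ^ k) c := by
  induction c with
  | nil => simp [mulConj, evalList, evalList_replicate_zero]
  | cons a c ih =>
    have hlen := length_mulConj (k := k) hb c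
    rw [mulConj, evalList_zipWith_add x (by rw [List.length_map, length_rotateBy hlen, hb]),
      evalList_map_mul, evalList_rotateBy hx hlen hk, ih, evalList]
    ring

theorem length_conjProd {p : ℕ} (hp : p ≠ 0) (c : List ℕ) (n : ℕ) :
    (conjProd p c n).length = p := by
  induction n with
  | zero => simp [conjProd]; omega
  | succ n ih => exact length_mulConj ih c

theorem evalList_conjProd {p : ℕ} (hp : p ≠ 0) (hx : x ^ p = 1) (c : List ℕ) {n : ℕ}
    (hn : n ≤ p) :
    evalList x (conjProd p c n) = ∏ k ∈ Finset.range n, evalList (x ^ (k + 1)) c := by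
  induction n with
  | zero => simp [conjProd, evalList, evalList_replicate_zero]
  | succ n ih =>
    rw [conjProd, evalList_mulConj hx (length_conjProd hp c n) hn, ih (by omega),
      Finset.prod_range_succ]

theorem evalList_eq_zero_of_isConstMod {S : Type*} [CommRing S] {y : S} {l : ℕ} [CharP S l]
    {c : List ℕ} (hc : isConstMod l c = true)
    (hy : ∑ i ∈ Finset.range c.length, y ^ i = 0) : evalList y c = 0 := by
  cases c with
  | nil => rfl
  | cons a c =>
    simp only [isConstMod, List.all_eq_true, beq_iff_eq] at hc
    have hconst (i : Fin (a :: c).length) : (((a :: c).get i : ℕ) : S) = a := by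
      rw [CharP.natCast_eq_natCast S l]
      rcases List.mem_cons.mp ((a :: c).get_mem i) with h | h
      · rw [h]
      · exact hc _ h
    rw [evalList_eq_sum]
    simp only [hconst]
    rw [← Finset.mul_sum, Fin.sum_univ_eq_sum_range (y ^ ·), hy, mul_zero]

end Soundness

section Descent

open NumberField Ideal

variable {K : Type*} [Field K] [NumberField K]

/-- Let every prime ideal `P` of norm at most `B` contain a nonzero element of norm less than the
square of the norm of `P`. Then all nonzero ideals of norm at most `B` are principal. -/
theorem isPrincipal_of_absNorm_le {B : ℕ}
    (h : ∀ P : Ideal (𝓞 K), P.IsPrime → P ≠ ⊥ → absNorm P ≤ B →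
      ∃ α ∈ P, α ≠ 0 ∧ (Algebra.norm ℤ α).natAbs < absNorm P ^ 2)
    (I : Ideal (𝓞 K)) (hI : I ≠ ⊥) (hB : absNorm I ≤ B) : I.IsPrincipal := by
  induction hN : absNorm I using Nat.strong_induction_on generalizing I with
  | _ N ih =>
  subst hN
  rcases eq_or_ne I ⊤ with rfl | htop
  · exact top_isPrincipal
  obtain ⟨P, hP, hIP⟩ := I.exists_le_maximal htop
  have hP0 : P ≠ ⊥ := fun h0 ↦ hI (le_bot_iff.mp (h0 ▸ hIP))
  have hP1 : 1 < absNorm P := by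
    have h0 : absNorm P ≠ 0 := absNorm_ne_zero_iff_mem_nonZeroDivisors.mpr
      (mem_nonZeroDivisors_of_ne_zero hP0)
    have h1 : absNorm P ≠ 1 := absNorm_eq_one_iff.not.mpr hP.ne_top
    omega
  obtain ⟨J, rfl⟩ := dvd_iff_le.mpr hIP
  have hJ0 : J ≠ ⊥ := by rintro rfl; simp at hI
  have hJpos : 0 < absNorm J := Nat.pos_of_ne_zero (absNorm_ne_zero_iff_mem_nonZeroDivisors.mpr
    (mem_nonZeroDivisors_of_ne_zero hJ0))
  rw [map_mul] at hB ih
  rcases eq_or_ne J ⊤ with rfl | hJ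
  · rw [absNorm_top, mul_one] at hB ih
    rw [mul_top]
    obtain ⟨α, hα, hα0, hlt⟩ := h P hP.isPrime hP0 hB
    obtain ⟨J, hPJ⟩ := dvd_span_singleton.mpr hα
    have hα1 : span {α} ≠ ⊥ := by simpa using hα0
    have hJ0 : J ≠ ⊥ := by rintro rfl; simp_all
    have hJlt : absNorm J < absNorm P := by
      rw [← absNorm_span_singleton, hPJ, map_mul, sq] at hlt
      exact lt_of_mul_lt_mul_left hlt (Nat.zero_le _)
    obtain ⟨β, rfl⟩ := (ih _ hJlt J hJ0 (hJlt.le.trans hB) rfl).principal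
    have hαmem : α ∈ span {β} * P := by
      rw [mul_comm]
      exact hPJ ▸ mem_span_singleton_self α
    obtain ⟨γ, -, rfl⟩ := mem_span_singleton_mul.mp hαmem
    refine ⟨γ, mul_left_cancel₀ hJ0 ?_⟩
    simpa [mul_comm, ← span_singleton_mul_span_singleton] using hPJ.symm
  · have hJ1 : absNorm J ≠ 1 := absNorm_eq_one_iff.not.mpr hJ
    have hPlt : absNorm P < absNorm P * absNorm J := lt_mul_of_one_lt_right (by omega) (by omega)
    have hJlt : absNorm J < absNorm P * absNorm J := lt_mul_of_one_lt_left (by omega) (by omega)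
    obtain ⟨β, rfl⟩ := (ih _ hPlt P hP0 (hPlt.le.trans hB) rfl).principal
    obtain ⟨γ, rfl⟩ := (ih _ hJlt J hJ0 (hJlt.le.trans hB) rfl).principal
    exact ⟨β * γ, span_singleton_mul_span_singleton β γ⟩

end Descent

section PrimeIdeals

open NumberField Ideal

variable {K : Type*} [Field K] [NumberField K] {p : ℕ} [hp : Fact p.Prime]
  [IsCyclotomicExtension {p} ℚ K]

theorem natAbs_norm_zeta_sub_one (hp2 : p ≠ 2) {ζ : 𝓞 K} (hζ : IsPrimitiveRoot ζ p) :
    (Algebra.norm ℤ (ζ - 1)).natAbs = p := by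
  have hζ' : IsPrimitiveRoot (algebraMap (𝓞 K) K ζ) p :=
    hζ.map_of_injective (FaithfulSMul.algebraMap_injective _ _)
  have := hζ'.norm_toInteger_sub_one_of_prime_ne_two' hp2
  rw [show hζ'.toInteger = ζ from RingOfIntegers.ext rfl] at this
  simp [this]

theorem exists_mem_norm_lt {M L : ℕ} {codes : List ℕ} {special : List (ℕ × ℕ)} (hp2 : p ≠ 2)
    (hM : M < 2 ^ 17) (hL : M < L ^ 2) (hsplit : checkSplit p (M / p) codes = true)
    (hinert : checkInert p M special L = true) (P : Ideal (𝓞 K)) [hP : P.IsPrime] (hP0 : P ≠ ⊥)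
    (hPM : absNorm P ≤ M) : ∃ α ∈ P, α ≠ 0 ∧ (Algebra.norm ℤ α).natAbs < absNorm P ^ 2 := by
  obtain ⟨ζ, hζ⟩ : ∃ ζ : 𝓞 K, IsPrimitiveRoot ζ p :=
    ⟨_, (IsCyclotomicExtension.zeta_spec p ℚ K).toInteger_isPrimitiveRoot⟩
  have hmax : P.IsMaximal := hP.isMaximal hP0
  let F := 𝓞 K ⧸ P
  let _ : Field F := Ideal.Quotient.field P
  have : Finite F := P.finiteQuotientOfFreeOfNeBot hP0
  have : Fintype F := Fintype.ofFinite F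
  obtain ⟨l, hchar⟩ := CharP.exists F
  obtain ⟨f, hl, hcard⟩ := FiniteField.card F l
  have hnorm : absNorm P = l ^ (f : ℕ) := by
    rw [← hcard, absNorm_apply, Submodule.cardQuot_apply, Nat.card_eq_fintype_card]
  rw [hnorm] at hPM ⊢
  have hllf : l ≤ l ^ (f : ℕ) := Nat.le_self_pow f.ne_zero l
  have hgeom : ∑ i ∈ Finset.range p, (Ideal.Quotient.mk P ζ) ^ i = 0 := by
    have := congrArg (Ideal.Quotient.mk P) (hζ.geom_sum_eq_zero hp.out.one_lt)
    simpa using this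
  have hmem (α : 𝓞 K) : α ∈ P ↔ Ideal.Quotient.mk P α = 0 := Ideal.Quotient.eq_zero_iff_mem.symm
  have hzp : (Ideal.Quotient.mk P ζ) ^ p = 1 := by rw [← map_pow, hζ.pow_eq_one, map_one]
  by_cases hz1 : Ideal.Quotient.mk P ζ = 1
  · refine ⟨ζ - 1, by rw [hmem, map_sub, hz1, map_one, sub_self],
      sub_ne_zero.mpr (hζ.ne_one hp.out.one_lt), ?_⟩
    rw [natAbs_norm_zeta_sub_one hp2 hζ]
    have hpF : (p : F) = 0 := by simpa [hz1] using hgeom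
    rw [← (Nat.prime_dvd_prime_iff_eq hl hp.out).mp ((CharP.cast_eq_zero_iff F l p).mp hpF)]
    nlinarith [hl.two_le]
  have horder : orderOf (Ideal.Quotient.mk P ζ : F) = p := orderOf_eq_prime hzp hz1
  have hzprim : IsPrimitiveRoot (Ideal.Quotient.mk P ζ : F) p := horder ▸ IsPrimitiveRoot.orderOf _
  have hcop {k : ℕ} (hk0 : k ≠ 0) (hk : k < p) : k.Coprime p :=
    (hp.out.coprime_iff_not_dvd.mpr (Nat.not_dvd_of_pos_of_lt (Nat.pos_of_ne_zero hk0) hk)).symm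
  have hlf : l ^ (f : ℕ) % p = 1 := by
    have h1 : p ∣ l ^ (f : ℕ) - 1 := by
      rw [← horder, ← hcard]
      refine orderOf_dvd_of_pow_eq_one (FiniteField.pow_card_sub_one_eq_one _ fun h0 ↦ ?_)
      rw [h0, zero_pow hp.out.ne_zero] at hzp
      exact zero_ne_one hzp
    obtain ⟨k, hk⟩ := h1
    have : l ^ (f : ℕ) = 1 + p * k := by have := hl.pos; omega
    rw [this, Nat.add_mul_mod_self_left, Nat.mod_eq_of_lt hp.out.one_lt]
  by_cases hlp : l % p = 1
  · set i := l / p with hi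
    have hli : l = p * i + 1 := by rw [hi, ← hlp]; exact (Nat.div_add_mod l p).symm
    have hi1 : 1 ≤ i := Nat.one_le_iff_ne_zero.mpr fun h0 ↦ by
      rw [h0] at hli; exact hl.one_lt.ne' (by simpa using hli)
    obtain ⟨c, hc, hshort⟩ := exists_of_checkSplit hsplit hi1
      (Nat.div_le_div_right (hllf.trans hPM)) (hli ▸ hl)
    rw [← hli] at hshort
    obtain ⟨hshort, r, hrl, hr1, hrp, hrc⟩ := exists_of_isShortAtRoot hshort
    have hrF : (r : F) ^ p = 1 := by
      rw [← Nat.cast_pow, ← Nat.cast_one, CharP.natCast_eq_natCast F l, Nat.ModEq, hrp,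
        Nat.mod_eq_of_lt hl.one_lt]
    have hrF1 : (r : F) ≠ 1 := fun h1 ↦ hr1 <| by
      rw [← Nat.cast_one, CharP.natCast_eq_natCast F l] at h1
      exact Nat.ModEq.eq_of_lt_of_lt h1 hrl hl.one_lt
    obtain ⟨k, hk, hkr⟩ := hzprim.eq_pow_of_pow_eq_one hrF
    have hk0 : k ≠ 0 := by rintro rfl; exact hrF1 (by simpa using hkr.symm)
    obtain ⟨h0, hlt⟩ := norm_lt_of_isShort (hζ.pow_of_coprime k (hcop hk0 hk)) hc hshort
    refine ⟨_, ?_, h0, hlt.trans_le (Nat.pow_le_pow_left hllf 2)⟩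
    rw [hmem, map_evalList, map_pow, hkr]
    change evalList (Nat.castRingHom F r) c = 0
    rw [← map_evalList, eq_natCast, CharP.cast_eq_zero_iff F l]
    exact hrc
  · have hf : 2 ≤ (f : ℕ) := by
      have h1 := f.pos
      have h2 : (f : ℕ) ≠ 1 := fun h ↦ hlp (by rwa [h, pow_one] at hlf)
      omega
    have hf' : (f : ℕ) < 17 := (Nat.pow_lt_pow_iff_right one_lt_two).mp
      (((Nat.pow_le_pow_left hl.two_le _).trans hPM).trans_lt hM)
    have hlL : l < L := lt_of_pow_lt_pow_left₀ 2 (Nat.zero_le _)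
      (((Nat.pow_le_pow_right hl.pos hf).trans hPM).trans_lt hL)
    obtain ⟨c, hc, hshort, hconst⟩ := exists_of_checkInert hinert hl hlL hlp hf hf' hlf hPM
    have hprod : ∏ k ∈ Finset.range ((p + 1) / 2),
        evalList ((Ideal.Quotient.mk P ζ : F) ^ (k + 1)) c = 0 := by
      rw [← evalList_conjProd hp.out.ne_zero hzp c (by have := hp.out.two_le; omega)]
      refine evalList_eq_zero_of_isConstMod (l := l) hconst ?_
      rw [length_conjProd hp.out.ne_zero]
      exact hgeom
    obtain ⟨k, hk, hk0⟩ := Finset.prod_eq_zero_iff.mp hprod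
    rw [Finset.mem_range] at hk
    obtain ⟨h0, hlt⟩ := norm_lt_of_isShort (hζ.pow_of_coprime (k + 1)
      (hcop k.succ_ne_zero (by have := hp.out.two_le; omega))) hc hshort
    exact ⟨_, by rw [hmem, map_evalList, map_pow]; exact hk0, h0, hlt⟩

end PrimeIdeals

section PrincipalIdealRing

open NumberField Ideal

variable {K : Type*} [Field K] [NumberField K]

open Real in
theorem isPrincipalIdealRing_of_checks (p : ℕ) [hp : Fact p.Prime] [IsCyclotomicExtension {p} ℚ K]
    {M L : ℕ} {codes : List ℕ} {special : List (ℕ × ℕ)} (hp2 : p ≠ 2)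
    (hmink : 400 ^ (p - 1) * (p - 1).factorial ^ 2 * p ^ (p - 2) <
      (M + 1) ^ 2 * 314 ^ (p - 1) * ((p - 1) ^ (p - 1)) ^ 2)
    (hM : M < 2 ^ 17) (hL : M < L ^ 2) (hsplit : checkSplit p (M / p) codes = true)
    (hinert : checkInert p M special L = true) : IsPrincipalIdealRing (𝓞 K) := by
  refine RingOfIntegers.isPrincipalIdealRing_of_isPrincipal_of_norm_le fun I hI ↦ ?_
  refine isPrincipal_of_absNorm_le (B := M) (fun P hP hP0 hPM ↦ exists_mem_norm_lt hp2 hM hL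
    hsplit hinert P hP0 hPM) _ (nonZeroDivisors.coe_ne_zero I) ?_
  refine Nat.le_of_lt_succ (Nat.cast_lt (α := ℝ).mp (hI.trans_lt ?_))
  have heven : 2 * ((p - 1) / 2) = p - 1 := by
    have := hp.out.eq_two_or_odd
    omega
  have hp1 : 0 < p - 1 := Nat.sub_pos_of_lt hp.out.one_lt
  rw [IsCyclotomicExtension.Rat.discr_prime p K, IsCyclotomicExtension.finrank (n := p) K
    (Polynomial.cyclotomic.irreducible_rat hp.out.pos),
    IsCyclotomicExtension.Rat.nrComplexPlaces_eq_totient_div_two p, Nat.totient_prime hp.out]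
  have habs : |(((-1) ^ ((p - 1) / 2) * (p : ℤ) ^ (p - 2) : ℤ) : ℝ)| = (p : ℝ) ^ (p - 2) := by
    simp [abs_mul, abs_pow]
  rw [habs]
  refine lt_of_pow_lt_pow_left₀ 2 (Nat.cast_nonneg _) ?_
  rw [mul_pow, mul_pow, sq_sqrt (by positivity), ← pow_mul, mul_comm _ 2, heven, div_pow _ _ 2]
  have hpi : (4 / π) ^ (p - 1) ≤ (400 ^ (p - 1) / 314 ^ (p - 1) : ℝ) := by
    rw [← div_pow]
    refine pow_le_pow_left₀ (by positivity) ?_ _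
    rw [div_le_div_iff₀ pi_pos (by norm_num)]
    linarith [pi_gt_d2]
  refine (mul_le_mul_of_nonneg_right hpi (by positivity)).trans_lt ?_
  have hp1' : (0 : ℝ) < (p - 1 : ℕ) := by exact_mod_cast hp1
  rw [div_mul_eq_mul_div _ _ (_ ^ (p - 2)), div_mul_div_comm, div_lt_iff₀ (by positivity)]
  have := (Nat.cast_lt (α := ℝ)).mpr hmink
  push_cast at this ⊢
  linarith

theorem isPrincipalIdealRing_of_isCyclotomicExtension_two [IsCyclotomicExtension {2} ℚ K] :
    IsPrincipalIdealRing (𝓞 K) := by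
  apply RingOfIntegers.isPrincipalIdealRing_of_abs_discr_lt
  rw [IsCyclotomicExtension.Rat.discr_prime 2 K, IsCyclotomicExtension.finrank (n := 2) K
    (Polynomial.cyclotomic.irreducible_rat two_pos),
    IsCyclotomicExtension.Rat.nrComplexPlaces_eq_totient_div_two 2, Nat.totient_two]
  norm_num

set_option maxRecDepth 10000 in
theorem isPrincipalIdealRing_of_le_nineteen (p : ℕ) [hp : Fact p.Prime]
    [IsCyclotomicExtension {p} ℚ K] (hp19 : p ≤ 19) : IsPrincipalIdealRing (𝓞 K) := by
  have hmem : p = 2 ∨ p = 3 ∨ p = 5 ∨ p = 7 ∨ p = 11 ∨ p = 13 ∨ p = 17 ∨ p = 19 := by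
    have := hp.out
    interval_cases p <;> first | (simp; done) | (exfalso; revert this; norm_num)
  obtain rfl | rfl | rfl | rfl | rfl | rfl | rfl | rfl := hmem
  · exact isPrincipalIdealRing_of_isCyclotomicExtension_two
  · exact isPrincipalIdealRing_of_checks 3 (M := 1) (L := 2) (codes := []) (special := [])
      (by decide) (by decide +kernel) (by decide) (by decide) (by decide +kernel)
      (by decide +kernel)
  · exact isPrincipalIdealRing_of_checks 5 (M := 1) (L := 2) (codes := []) (special := [])
      (by decide) (by decide +kernel) (by decide) (by decide) (by decide +kernel)
      (by decide +kernel)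
  · exact isPrincipalIdealRing_of_checks 7 (M := 4) (L := 3) (codes := []) (special := [])
      (by decide) (by decide +kernel) (by decide) (by decide) (by decide +kernel)
      (by decide +kernel)
  · exact isPrincipalIdealRing_of_checks 11 (M := 59) (L := 8) (codes := [88542]) (special := [])
      (by decide) (by decide +kernel) (by decide) (by decide) (by decide +kernel)
      (by decide +kernel)
  · exact isPrincipalIdealRing_of_checks 13 (M := 307) (L := 18)
      (codes := [738081, 797412, 797238, 777474]) (special := [(3, 797246)])
      (by decide) (by decide +kernel) (by decide) (by decide) (by decide +kernel)
      (by decide +kernel)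
  · exact isPrincipalIdealRing_of_checks 17 (M := 13307) (L := 116) (codes := shortCodesSeventeen)
      (special := [(2, 69353306), (67, 64511048), (101, 64570184)])
      (by decide) (by decide +kernel) (by decide) (by decide) (by decide +kernel)
      (by decide +kernel)
  · exact isPrincipalIdealRing_of_checks 19 (M := 106417) (L := 327) (codes := shortCodesNineteen)
      (special := [(7, 581137298), (11, 581137325), (37, 566781572), (113, 581130776),
        (151, 710270621), (227, 581119787)])
      (by decide) (by decide +kernel) (by decide) (by decide) (by decide +kernel)
      (by decide +kernel)

end PrincipalIdealRing

/-- The module `M` is generated by at most `m` elements. -/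
def GeneratedBy (A M : Type*) [Semiring A] [AddCommMonoid M] [Module A M] (m : ℕ) : Prop :=
  ∃ S : Finset M, S.card ≤ m ∧ Submodule.span A (S : Set M) = ⊤

section Generators

open Polynomial

theorem GeneratedBy.mono {A M : Type*} [Semiring A] [AddCommMonoid M] [Module A M] {m n : ℕ}
    (h : GeneratedBy A M m) (hmn : m ≤ n) : GeneratedBy A M n :=
  let ⟨S, hS, hspan⟩ := h
  ⟨S, hS.trans hmn, hspan⟩

theorem GeneratedBy.of_range_of_ker {A M M' : Type*} [Ring A] [AddCommGroup M] [Module A M]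
    [AddCommGroup M'] [Module A M'] {a b : ℕ} (f : M →ₗ[A] M')
    (ha : GeneratedBy A (LinearMap.range f) a) (hb : GeneratedBy A (LinearMap.ker f) b) :
    GeneratedBy A M (a + b) := by
  classical
  obtain ⟨S, hS, hSspan⟩ := ha
  obtain ⟨T, hT, hTspan⟩ := hb
  choose g hg using f.surjective_rangeRestrict
  refine ⟨S.image g ∪ T.image Subtype.val, (Finset.card_union_le _ _).trans
    (add_le_add (Finset.card_image_le.trans hS) (Finset.card_image_le.trans hT)), ?_⟩
  rw [Finset.coe_union, Submodule.span_union, Finset.coe_image, Finset.coe_image, eq_top_iff]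
  intro x _
  have hx : f.rangeRestrict x ∈ (Submodule.span A (g '' S)).map f.rangeRestrict := by
    rw [Submodule.map_span, Set.image_image]
    simp [hg, hSspan]
  obtain ⟨y, hy, hyx⟩ := hx
  have hxy : x - y ∈ LinearMap.ker f := by
    rw [LinearMap.mem_ker, map_sub, sub_eq_zero]
    exact congrArg Subtype.val hyx.symm
  have hT' : x - y ∈ (Submodule.span A (T : Set (LinearMap.ker f))).map
      (LinearMap.ker f).subtype := by
    rw [hTspan]
    exact ⟨⟨x - y, hxy⟩, trivial, rfl⟩
  rw [Submodule.map_span] at hT'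
  exact Submodule.mem_sup.mpr ⟨y, hy, x - y, hT', by abel⟩

theorem GeneratedBy.of_finrank (A M : Type*) [Ring A] [AddCommGroup M] [Module A M]
    [Module.Free ℤ M] [Module.Finite ℤ M] : GeneratedBy A M (Module.finrank ℤ M) := by
  classical
  let b := Module.finBasis ℤ M
  refine ⟨Finset.univ.image b, Finset.card_image_le.trans (by simp), eq_top_iff.mpr fun x _ ↦ ?_⟩
  rw [← b.sum_repr x]
  exact Submodule.sum_mem _ fun i _ ↦ zsmul_mem (Submodule.subset_span (by simp)) _

variable {V R : Type*} [AddCommGroup V] [Module ℤ[X] V] [CommRing R] [Algebra ℤ[X] R]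

instance freeInt_submodule [Module.Free ℤ V] [Module.Finite ℤ V] (N : Submodule ℤ[X] V) :
    Module.Free ℤ N :=
  inferInstanceAs (Module.Free ℤ (N.restrictScalars ℤ))

instance finiteInt_submodule [Module.Free ℤ V] [Module.Finite ℤ V] (N : Submodule ℤ[X] V) :
    Module.Finite ℤ N :=
  inferInstanceAs (Module.Finite ℤ (N.restrictScalars ℤ))

theorem finrank_range_add_finrank_ker_int {W : Type*} [AddCommGroup W] [Module ℤ[X] W]
    [Module.Finite ℤ V] (f : V →ₗ[ℤ[X]] W) :
    Module.finrank ℤ (LinearMap.range f) + Module.finrank ℤ (LinearMap.ker f) =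
      Module.finrank ℤ V := by
  have hrange : Module.finrank ℤ (LinearMap.range f.toAddMonoidHom.toIntLinearMap) =
      Module.finrank ℤ (LinearMap.range f) :=
    LinearEquiv.finrank_eq (AddEquiv.toIntLinearEquiv
      ⟨⟨fun x ↦ ⟨x.1, x.2⟩, fun x ↦ ⟨x.1, x.2⟩, fun _ ↦ rfl, fun _ ↦ rfl⟩, fun _ _ ↦ rfl⟩)
  have hker : Module.finrank ℤ (LinearMap.ker f.toAddMonoidHom.toIntLinearMap) =
      Module.finrank ℤ (LinearMap.ker f) :=
    LinearEquiv.finrank_eq (AddEquiv.toIntLinearEquiv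
      ⟨⟨fun x ↦ ⟨x.1, x.2⟩, fun x ↦ ⟨x.1, x.2⟩, fun _ ↦ rfl, fun _ ↦ rfl⟩, fun _ _ ↦ rfl⟩)
  rw [← hrange, ← hker, ← (LinearMap.quotKerEquivRange _).finrank_eq]
  exact Submodule.finrank_quotient_add_finrank _

/-- An additive map which commutes with `X` is `ℤ[X]`-linear. -/
def AddMonoidHom.toPolynomialLinearMap {W : Type*} [AddCommGroup W] [Module ℤ[X] W] (f : V →+ W)
    (hf : ∀ x, f ((X : ℤ[X]) • x) = (X : ℤ[X]) • f x) : V →ₗ[ℤ[X]] W where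
  __ := f
  map_smul' a x := by
    induction a using Polynomial.induction_on with
    | C a => simp [Int.cast_smul_eq_zsmul]
    | add a b ha hb => simp_all [add_smul]
    | monomial n a h =>
      rw [pow_succ', mul_left_comm, mul_smul]
      exact (hf _).trans ((congrArg _ h).trans (mul_smul _ _ _).symm)

/-- The `ℤ[X]`-linear map to a `ℤ[X]`-algebra in which `X * ξ = 1`, attached to an additive
functional. -/
noncomputable def functionalLift (p : ℕ) (hX : ∀ x : V, (X ^ p : ℤ[X]) • x = x) {ξ : R}
    (hξ : algebraMap ℤ[X] R X * ξ = 1) (hξp : ξ ^ p = 1) (f : V →+ ℤ) : V →ₗ[ℤ[X]] R :=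
  AddMonoidHom.toPolynomialLinearMap
    { toFun := fun x ↦ ∑ j ∈ Finset.range p, (f ((X ^ j : ℤ[X]) • x) : R) * ξ ^ j
      map_zero' := by simp
      map_add' := fun x y ↦ by simp [add_mul, Finset.sum_add_distrib] }
    fun x ↦ by
      have h := (Finset.sum_range_succ' (fun j ↦ (f ((X ^ j : ℤ[X]) • x) : R) * ξ ^ j) p).symm.trans
        (Finset.sum_range_succ _ p)
      rw [hX, hξp, pow_zero, pow_zero, one_smul, add_left_inj] at h
      simp only [AddMonoidHom.coe_mk, ZeroHom.coe_mk, Algebra.smul_def, ← h, Finset.mul_sum]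
      refine Finset.sum_congr rfl fun j _ ↦ ?_
      rw [← mul_smul, ← pow_succ, pow_succ ξ]
      linear_combination (-(f ((X ^ (j + 1) : ℤ[X]) • x) : R) * ξ ^ j) * hξ

theorem functionalLift_ne_zero {p : ℕ} (hp : p ≠ 0) (hX : ∀ x : V, (X ^ p : ℤ[X]) • x = x) {ξ : R}
    (hξ : algebraMap ℤ[X] R X * ξ = 1) (hξp : ξ ^ p = 1)
    (hind : ∀ a : ℕ → ℤ, ∑ j ∈ Finset.range p, (a j : R) * ξ ^ j = 0 → ∀ j < p, a j = a 0)
    (f : V →+ ℤ) {x : V} (hx : (∑ j ∈ Finset.range p, X ^ j : ℤ[X]) • x = 0) (hfx : f x ≠ 0) :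
    functionalLift p hX hξ hξp f x ≠ 0 := by
  intro h
  have h1 := hind (fun j ↦ f ((X ^ j : ℤ[X]) • x)) h
  have h2 := congrArg f hx
  rw [Finset.sum_smul, map_sum, map_zero, Finset.sum_congr rfl fun j hj ↦
    h1 j (Finset.mem_range.mp hj)] at h2
  simp_all

/-- The structure of lattices over `ℤ[X]` killed by `1 + X + ⋯ + X ^ (p - 1)`, when every
submodule of the cyclotomic ring `R` is generated by `k` elements. -/
theorem exists_generatedBy_of_geom_sum_smul {p k : ℕ} (hp : 1 < p) {ξ : R}
    (hξ : algebraMap ℤ[X] R X * ξ = 1) (hξp : ξ ^ p = 1)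
    (hind : ∀ a : ℕ → ℤ, ∑ j ∈ Finset.range p, (a j : R) * ξ ^ j = 0 → ∀ j < p, a j = a 0)
    (hrank : ∀ I : Submodule ℤ[X] R, I ≠ ⊥ → Module.finrank ℤ I = p - 1)
    (hgen : ∀ I : Submodule ℤ[X] R, GeneratedBy ℤ[X] I k)
    [Module.Free ℤ V] [Module.Finite ℤ V]
    (hV : ∀ x : V, (∑ j ∈ Finset.range p, X ^ j : ℤ[X]) • x = 0) :
    ∃ b, Module.finrank ℤ V = b * (p - 1) ∧ GeneratedBy ℤ[X] V (b * k) := by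
  induction hn : Module.finrank ℤ V using Nat.strong_induction_on generalizing V with
  | _ n ih =>
  subst hn
  rcases Nat.eq_zero_or_pos (Module.finrank ℤ V) with h0 | hpos
  · exact ⟨0, by rw [h0, zero_mul], (GeneratedBy.of_finrank ℤ[X] V).mono (by rw [h0]; simp)⟩
  have hX (x : V) : (X ^ p : ℤ[X]) • x = x := by
    rw [← sub_eq_zero, ← one_smul ℤ[X] x, ← mul_smul, mul_one, ← sub_smul, ← geom_sum_mul,
      mul_comm, mul_smul, hV, smul_zero]
  let e := Module.finBasis ℤ V
  let i : Fin (Module.finrank ℤ V) := ⟨0, hpos⟩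
  let φ := functionalLift p hX hξ hξp (e.coord i).toAddMonoidHom
  have hφ : φ (e i) ≠ 0 := functionalLift_ne_zero (by omega) hX hξ hξp hind _ (hV _) (by simp)
  have hrange := hrank (LinearMap.range φ) fun h ↦ hφ (LinearMap.congr_fun
    (LinearMap.range_eq_bot.mp h) _)
  have hsum := finrank_range_add_finrank_ker_int φ
  rw [hrange] at hsum
  obtain ⟨b, hb, hbgen⟩ := ih (Module.finrank ℤ (LinearMap.ker φ)) (by omega)
    (V := LinearMap.ker φ) (fun x ↦ Subtype.ext (hV x)) rfl
  refine ⟨b + 1, by rw [← hsum, hb]; ring, ?_⟩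
  rw [add_one_mul, add_comm]
  exact (hgen _).of_range_of_ker φ hbgen

theorem exists_generatedBy_of_pow_smul {p k : ℕ} (hp : 1 < p) {ξ : R}
    (hξ : algebraMap ℤ[X] R X * ξ = 1) (hξp : ξ ^ p = 1)
    (hind : ∀ a : ℕ → ℤ, ∑ j ∈ Finset.range p, (a j : R) * ξ ^ j = 0 → ∀ j < p, a j = a 0)
    (hrank : ∀ I : Submodule ℤ[X] R, I ≠ ⊥ → Module.finrank ℤ I = p - 1)
    (hgen : ∀ I : Submodule ℤ[X] R, GeneratedBy ℤ[X] I k) (hk : k ≤ p - 1)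
    [Module.Free ℤ V] [Module.Finite ℤ V] (hX : ∀ x : V, (X ^ p : ℤ[X]) • x = x)
    (hV : ∃ x : V, (X : ℤ[X]) • x ≠ x) :
    p - 1 ≤ Module.finrank ℤ V ∧
      GeneratedBy ℤ[X] V (Module.finrank ℤ V - (p - 1) + k) := by
  let Φ := LinearMap.lsmul ℤ[X] V (∑ j ∈ Finset.range p, X ^ j)
  obtain ⟨b, hb, hbgen⟩ := exists_generatedBy_of_geom_sum_smul hp hξ hξp hind hrank hgen
    (V := LinearMap.ker Φ) fun x ↦ Subtype.ext (LinearMap.mem_ker.mp x.2)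
  have hsum := finrank_range_add_finrank_ker_int Φ
  have hb0 : b ≠ 0 := by
    rintro rfl
    obtain ⟨x, hx⟩ := hV
    have hmem : (X - 1 : ℤ[X]) • x ∈ LinearMap.ker Φ := by
      rw [LinearMap.mem_ker, LinearMap.lsmul_apply, ← mul_smul, geom_sum_mul, sub_smul, hX,
          one_smul, sub_self]
    have := Module.finrank_zero_iff.mp (hb.trans (zero_mul _))
    have := congrArg Subtype.val (Subsingleton.elim (⟨_, hmem⟩ : LinearMap.ker Φ) 0)
    simp [sub_smul, sub_eq_zero, hx] at this
  have hgenV := (GeneratedBy.of_finrank ℤ[X] (LinearMap.range Φ)).of_range_of_ker Φ hbgen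
  obtain ⟨c, rfl⟩ := Nat.exists_eq_succ_of_ne_zero hb0
  rw [Nat.succ_mul] at hb hgenV
  have hck : c * k ≤ c * (p - 1) := Nat.mul_le_mul_left c hk
  exact ⟨by omega, hgenV.mono (by omega)⟩

end Generators

section Cyclotomic

open Polynomial NumberField

/-- A `ℤ`-linear relation among the `p`-th roots of unity has constant coefficients. -/
theorem IsPrimitiveRoot.coeff_eq_of_sum_eq_zero {K : Type*} [Field K] [CharZero K]
    {p : ℕ} (hp : p.Prime) {ξ : K} (hξ : IsPrimitiveRoot ξ p) (a : ℕ → ℤ)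
    (h : ∑ j ∈ Finset.range p, (a j : K) * ξ ^ j = 0) (j : ℕ) (hj : j < p) : a j = a 0 := by
  set P : ℤ[X] := ∑ j ∈ Finset.range p, C (a j) * X ^ j with hP
  have hcoeff (i : ℕ) (hi : i < p) : P.coeff i = a i := by
    simp [hP, coeff_X_pow, hi]
  have hdvd : cyclotomic p ℤ ∣ P := by
    rw [cyclotomic_eq_minpoly hξ hp.pos]
    refine minpoly.isIntegrallyClosed_dvd (hξ.isIntegral hp.pos) ?_
    simpa [hP] using h
  obtain ⟨Q, hQ⟩ := hdvd
  have hQ0 : Q.natDegree = 0 := by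
    rcases eq_or_ne Q 0 with rfl | h0
    · simp
    have hdeg : P.natDegree ≤ p - 1 := natDegree_sum_le_of_forall_le _ _ fun i hi ↦
      (natDegree_C_mul_X_pow_le _ _).trans (Nat.le_sub_one_of_lt (Finset.mem_range.mp hi))
    rw [hQ, (cyclotomic.monic p ℤ).natDegree_mul' h0, natDegree_cyclotomic,
      Nat.totient_prime hp] at hdeg
    omega
  have : Fact p.Prime := ⟨hp⟩
  have hconst (i : ℕ) (hi : i < p) : a i = Q.coeff 0 := by
    rw [← hcoeff i hi, hQ, eq_C_of_natDegree_eq_zero hQ0, cyclotomic_prime]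
    simp [coeff_X_pow, hi]
  rw [hconst j hj, hconst 0 hp.pos]

theorem GeneratedBy.of_span_eq {A M : Type*} [Ring A] [AddCommGroup M] [Module A M]
    {N : Submodule A M} (S : Finset M) (hS : Submodule.span A (S : Set M) = N) :
    GeneratedBy A N S.card := by
  classical
  subst hS
  refine ⟨S.attach.image fun s ↦ ⟨s.1, Submodule.subset_span s.2⟩,
    Finset.card_image_le.trans (by simp), ?_⟩
  refine Submodule.map_injective_of_injective (Submodule.injective_subtype _) ?_
  rw [Submodule.map_span, Submodule.map_subtype_top, Finset.coe_image, ← Set.image_comp]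
  simp [Function.comp_def]

variable {R : Type*} [CommRing R] [Algebra ℤ[X] R]

/-- An additive subgroup of `R` stable under `ℤ[X]` is an ideal if `ℤ[X]` maps onto `R`. -/
def idealOfSubmodule (hsurj : Function.Surjective (algebraMap ℤ[X] R)) (I : Submodule ℤ[X] R) :
    Ideal R where
  __ := I
  smul_mem' r x hx := by
    obtain ⟨a, rfl⟩ := hsurj r
    rw [smul_eq_mul, ← Algebra.smul_def]
    exact I.smul_mem a hx

theorem span_eq_of_idealOfSubmodule_eq (hsurj : Function.Surjective (algebraMap ℤ[X] R))
    {I : Submodule ℤ[X] R} {S : Set R} (h : idealOfSubmodule hsurj I = Ideal.span S) :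
    Submodule.span ℤ[X] S = I := by
  have hmem (x : R) : x ∈ I ↔ x ∈ Ideal.span S := by
    rw [← h]; rfl
  refine le_antisymm (Submodule.span_le.mpr fun x hx ↦ (hmem x).mpr (Ideal.subset_span hx)) ?_
  intro x hx
  refine Submodule.span_induction (p := fun x _ ↦ x ∈ Submodule.span ℤ[X] S)
    (fun x hx ↦ Submodule.subset_span hx) (zero_mem _) (fun _ _ _ _ ↦ add_mem) ?_ ((hmem x).mp hx)
  intro r x _ hx
  obtain ⟨a, rfl⟩ := hsurj r
  rw [smul_eq_mul, ← Algebra.smul_def]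
  exact Submodule.smul_mem _ a hx

theorem generatedBy_one [IsPrincipalIdealRing R]
    (hsurj : Function.Surjective (algebraMap ℤ[X] R)) (I : Submodule ℤ[X] R) :
    GeneratedBy ℤ[X] I 1 := by
  obtain ⟨x, hx⟩ := IsPrincipalIdealRing.principal (idealOfSubmodule hsurj I)
  exact GeneratedBy.of_span_eq {x} (span_eq_of_idealOfSubmodule_eq hsurj (by simpa using hx))

theorem generatedBy_two [IsDedekindDomain R]
    (hsurj : Function.Surjective (algebraMap ℤ[X] R)) (I : Submodule ℤ[X] R) :
    GeneratedBy ℤ[X] I 2 := by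
  classical
  rcases eq_or_ne I ⊥ with rfl | hI
  · exact (GeneratedBy.of_span_eq (A := ℤ[X]) (∅ : Finset R) (by simp)).mono (by simp)
  obtain ⟨x, hxI, hx⟩ := I.ne_bot_iff.mp hI
  obtain ⟨y, hy⟩ := IsDedekindDomain.exists_eq_span_pair
    (show x ∈ idealOfSubmodule hsurj I from hxI) hx
  exact (GeneratedBy.of_span_eq {x, y} (span_eq_of_idealOfSubmodule_eq hsurj
    (by simpa using hy))).mono Finset.card_le_two

theorem finrank_submodule_ringOfIntegers {K : Type*} [Field K] [NumberField K]
    [Algebra ℤ[X] (𝓞 K)] (hsurj : Function.Surjective (algebraMap ℤ[X] (𝓞 K)))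
    (I : Submodule ℤ[X] (𝓞 K)) (hI : I ≠ ⊥) : Module.finrank ℤ I = Module.finrank ℚ K := by
  have hJ : idealOfSubmodule hsurj I ≠ ⊥ := by
    obtain ⟨x, hxI, hx⟩ := I.ne_bot_iff.mp hI
    exact (Submodule.ne_bot_iff _).mpr ⟨x, hxI, hx⟩
  have e : I ≃+ idealOfSubmodule hsurj I :=
    ⟨⟨fun x ↦ ⟨x.1, x.2⟩, fun x ↦ ⟨x.1, x.2⟩, fun _ ↦ rfl, fun _ ↦ rfl⟩, fun _ _ ↦ rfl⟩
  rw [e.toIntLinearEquiv.finrank_eq, ← RingOfIntegers.rank K]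
  exact Ideal.finrank_eq_finrank (RingOfIntegers.basis K) _ hJ

/-- Powers of a primitive `p`-th root of unity span the ring of integers. -/
theorem aeval_surjective_of_isPrimitiveRoot {K : Type*} [Field K] [NumberField K] {p : ℕ}
    [hp : Fact p.Prime] [IsCyclotomicExtension {p} ℚ K] {ζ : K} (hζ : IsPrimitiveRoot ζ p) :
    Function.Surjective (aeval (R := ℤ) hζ.toInteger) := by
  rw [← AlgHom.range_eq_top, ← Algebra.adjoin_singleton_eq_range_aeval]
  simpa using hζ.integralPowerBasis.adjoin_gen_eq_top

/-- The case of a lattice over the group ring `ℤ[X] / (X ^ p - 1)`. -/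
theorem generatedBy_of_pow_smul {p k : ℕ} (hp : p.Prime) (hk : k ≤ p - 1)
    (hgen : ∀ [Algebra ℤ[X] (𝓞 (CyclotomicField p ℚ))],
      Function.Surjective (algebraMap ℤ[X] (𝓞 (CyclotomicField p ℚ))) →
      ∀ I : Submodule ℤ[X] (𝓞 (CyclotomicField p ℚ)), GeneratedBy ℤ[X] I k)
    {V : Type*} [AddCommGroup V] [Module ℤ[X] V] [Module.Free ℤ V] [Module.Finite ℤ V]
    (hX : ∀ x : V, (X ^ p : ℤ[X]) • x = x) (hV : ∃ x : V, (X : ℤ[X]) • x ≠ x) :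
    p - 1 ≤ Module.finrank ℤ V ∧
      GeneratedBy ℤ[X] V (Module.finrank ℤ V - (p - 1) + k) := by
  have : Fact p.Prime := ⟨hp⟩
  have : NeZero p := ⟨hp.ne_zero⟩
  have : IsCyclotomicExtension {p} ℚ (CyclotomicField p ℚ) :=
    CyclotomicField.isCyclotomicExtension p ℚ
  have hζ := IsCyclotomicExtension.zeta_spec p ℚ (CyclotomicField p ℚ)
  have hζ' := hζ.toInteger_isPrimitiveRoot
  let _ : Algebra ℤ[X] (𝓞 (CyclotomicField p ℚ)) := (aeval hζ.toInteger).toRingHom.toAlgebra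
  have hsurj : Function.Surjective (algebraMap ℤ[X] (𝓞 (CyclotomicField p ℚ))) :=
    aeval_surjective_of_isPrimitiveRoot hζ
  have hXζ : algebraMap ℤ[X] (𝓞 (CyclotomicField p ℚ)) X = hζ.toInteger := aeval_X _
  have hξ : IsPrimitiveRoot (hζ.toInteger ^ (p - 1)) p := hζ'.pow_of_coprime _ <|
    (hp.coprime_iff_not_dvd.mpr (Nat.not_dvd_of_pos_of_lt (Nat.sub_pos_of_lt hp.one_lt)
      (Nat.sub_lt hp.pos one_pos))).symm
  refine exists_generatedBy_of_pow_smul (ξ := hζ.toInteger ^ (p - 1)) hp.one_lt ?_ hξ.pow_eq_one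
    (fun a ha ↦ IsPrimitiveRoot.coeff_eq_of_sum_eq_zero hp (hξ.map_of_injective
      RingOfIntegers.coe_injective) a ?_) (fun I hI ↦ ?_) (hgen hsurj) hk hX hV
  · rw [hXζ, ← pow_succ', Nat.sub_add_cancel hp.one_le, hζ'.pow_eq_one]
  · simpa using congrArg (algebraMap _ (CyclotomicField p ℚ)) ha
  · rw [finrank_submodule_ringOfIntegers hsurj I hI, IsCyclotomicExtension.finrank (n := p) _
      (cyclotomic.irreducible_rat hp.pos), Nat.totient_prime hp]

end Cyclotomic

section Main

open Polynomial

/-- Generators of `ℤⁿ` over `ℤ[X]`, with `X` acting through a generator of `G`, bound the rank. -/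
theorem moduleRank_le_of_generatedBy {n m : ℕ} {G : Type*} [Group G]
    (ρ : G →* Matrix.GeneralLinearGroup (Fin n) ℤ) [Module ℤ[X] (Fin n → ℤ)] (γ : G)
    (hX : ∀ x : Fin n → ℤ, (X : ℤ[X]) • x = (ρ γ : Matrix (Fin n) (Fin n) ℤ).mulVec x)
    (h : GeneratedBy ℤ[X] (Fin n → ℤ) m) : moduleRank n ρ ≤ m := by
  obtain ⟨S, hS, hspan⟩ := h
  rw [moduleRank]
  refine (Nat.sInf_le ?_).trans hS
  refine ⟨S, rfl, ?_⟩
  set W := Submodule.span ℤ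
    {x | ∃ g : G, ∃ s ∈ S, x = (ρ g : Matrix (Fin n) (Fin n) ℤ).mulVec s}
  have hXW (x) (hx : x ∈ W) : (X : ℤ[X]) • x ∈ W := by
    induction hx using Submodule.span_induction with
    | mem x hx =>
      obtain ⟨g, s, hs, rfl⟩ := hx
      refine Submodule.subset_span ⟨γ * g, s, hs, ?_⟩
      rw [hX, Matrix.mulVec_mulVec, map_mul, Units.val_mul]
    | zero => simp
    | add x y _ _ hx hy => simpa only [smul_add] using add_mem hx hy
    | smul a x _ hx =>
      rw [smul_comm]
      exact W.smul_mem a hx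
  let W' : Submodule ℤ[X] (Fin n → ℤ) :=
    { W with
      smul_mem' := fun a x hx ↦ by
        induction a using Polynomial.induction_on with
        | C a => simpa [Int.cast_smul_eq_zsmul] using W.smul_mem a hx
        | add a b ha hb => rw [add_smul]; exact W.add_mem ha hb
        | monomial n a h =>
          rw [pow_succ', mul_left_comm, mul_smul]
          exact hXW _ h }
  have hW' : W' = ⊤ := by
    rw [← top_le_iff, ← hspan, Submodule.span_le]
    exact fun s hs ↦ Submodule.subset_span ⟨1, s, hs, by simp⟩
  exact eq_top_iff.mpr fun x _ ↦ (hW' ▸ trivial : x ∈ W')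

theorem generatedBy_cyclotomic {p : ℕ} (hp : p.Prime)
    [Algebra ℤ[X] (NumberField.RingOfIntegers (CyclotomicField p ℚ))]
    (hsurj : Function.Surjective
      (algebraMap ℤ[X] (NumberField.RingOfIntegers (CyclotomicField p ℚ))))
    (I : Submodule ℤ[X] (NumberField.RingOfIntegers (CyclotomicField p ℚ))) :
    GeneratedBy ℤ[X] I (if p ≤ 19 then 1 else 2) := by
  have : Fact p.Prime := ⟨hp⟩
  have : NeZero p := ⟨hp.ne_zero⟩
  have : IsCyclotomicExtension {p} ℚ (CyclotomicField p ℚ) :=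
    CyclotomicField.isCyclotomicExtension p ℚ
  split_ifs with hp19
  · have := isPrincipalIdealRing_of_le_nineteen (K := CyclotomicField p ℚ) p hp19
    exact generatedBy_one hsurj I
  · exact generatedBy_two hsurj I

end Main

/-- Let `p` be a prime and `ρ : C_p → GL_n(ℤ)` a faithful representation of the cyclic
group of order `p`, making `ℤⁿ` into a `ℤC_p`-module. Then
`rk_{C_p}(ℤⁿ) ≤ n - p + a`, where `a = 2` if `p ≤ 19` and `a = 3` otherwise. -/
theorem rank_le_of_faithful_cyclic_prime_rep (n p : ℕ) (hp : p.Prime)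
    (ρ : Multiplicative (ZMod p) →* Matrix.GeneralLinearGroup (Fin n) ℤ)
    (hρ : Function.Injective ρ) :
    (moduleRank n ρ : ℤ) ≤ (n : ℤ) - (p : ℤ) + (if p ≤ 19 then 2 else 3) := by
  have : Fact p.Prime := ⟨hp⟩
  let γ : Multiplicative (ZMod p) := Multiplicative.ofAdd 1
  let T : Module.End ℤ (Fin n → ℤ) := (ρ γ : Matrix (Fin n) (Fin n) ℤ).mulVecLin
  let _ : Module (Polynomial ℤ) (Fin n → ℤ) :=
    Module.compHom _ (Polynomial.aeval T).toRingHom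
  have hsmul (a : Polynomial ℤ) (x : Fin n → ℤ) : a • x = Polynomial.aeval T a x := rfl
  have hX (x : Fin n → ℤ) : (Polynomial.X : Polynomial ℤ) • x =
      (ρ γ : Matrix (Fin n) (Fin n) ℤ).mulVec x := by
    rw [hsmul, Polynomial.aeval_X, Matrix.mulVecLin_apply]
  have hγ : γ ^ p = 1 := by
    rw [← ofAdd_nsmul, nsmul_one, ZMod.natCast_self, ofAdd_zero]
  have hpow (k : ℕ) (x : Fin n → ℤ) : (Polynomial.X ^ k : Polynomial ℤ) • x =
      (ρ (γ ^ k) : Matrix (Fin n) (Fin n) ℤ).mulVec x := by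
    induction k with
    | zero => simp
    | succ k ih =>
      rw [pow_succ', mul_smul, ih, hX, Matrix.mulVec_mulVec, pow_succ', map_mul, Units.val_mul]
  obtain ⟨hle, hgen⟩ := generatedBy_of_pow_smul (V := Fin n → ℤ) hp (k := if p ≤ 19 then 1 else 2)
    (by have := hp.two_le; split_ifs <;> omega) (generatedBy_cyclotomic hp)
    (fun x ↦ by rw [hpow, hγ]; simp) (by
      by_contra! h
      have h1 : ρ γ = ρ 1 := by
        rw [map_one]
        refine Units.ext (Matrix.toLin'.injective (LinearMap.ext fun x ↦ ?_))
        rw [Matrix.toLin'_apply, ← hX, h]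
        simp
      exact one_ne_zero (Multiplicative.ofAdd.injective (hρ h1)))
  have hrank := moduleRank_le_of_generatedBy ρ γ hX hgen
  rw [Module.finrank_fin_fun] at hle hrank
  have := hp.two_le
  split_ifs at hrank ⊢ <;> omega
end

section
/- Let Γ be an n-dimensional crystallographic group whose holonomy group is the cyclic group C_m of order m, where m ≥ 3 and m is divisible by some prime larger than 3. Then d(Γ) ≤ n − 2. -/
/-- `minGenerators G` is the minimal number of generators of the group `G`. -/
noncomputable def minGenerators (G : Type*) [Group G] : ℕ :=
  sInf {k | ∃ S : Finset G, S.card = k ∧ Subgroup.closure (S : Set G) = ⊤}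

section Cyclotomic

open Polynomial NumberField

/-- A matrix of prime order `p` over a field containing the `p`-th roots of unity has a left
eigenvector whose eigenvalue is a primitive `p`-th root of unity. -/
theorem Matrix.exists_vecMul_eq_smul_of_pow_prime_eq_one {ι K : Type*} [Fintype ι] [DecidableEq ι]
    [Field K] {p : ℕ} [hp : Fact p.Prime] [NeZero (p : K)]
    (hK : ∃ μ : K, IsPrimitiveRoot μ p)
    {N : Matrix ι ι K} (hN : N ^ p = 1) (hN1 : N ≠ 1) :
    ∃ ζ : K, IsPrimitiveRoot ζ p ∧ ∃ v : ι → K, v ≠ 0 ∧ Matrix.vecMul v N = ζ • v := by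
  obtain ⟨μ, hμ⟩ := hK
  have hprod : aeval N (cyclotomic p K) * (N - 1) = 0 := by
    have := congrArg (aeval N) (cyclotomic_prime_mul_X_sub_one K p)
    simpa [hN] using this
  have hnu : ¬ IsUnit (aeval N (cyclotomic p K)) := fun hu ↦
    hN1 (sub_eq_zero.mp (hu.mul_right_eq_zero.mp hprod))
  have hsplit : (cyclotomic p K).Splits := by
    rw [cyclotomic_eq_prod_X_sub_primitiveRoots hμ]
    exact Splits.prod fun i _ ↦ Splits.X_sub_C i
  rw [hsplit.eq_prod_roots, (cyclotomic.monic p K).leadingCoeff, C_1, one_mul] at hnu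
  obtain ⟨ζ, hζ, hroot⟩ := spectrum.exists_mem_of_not_isUnit_aeval_prod hnu
  refine ⟨ζ, isRoot_cyclotomic_iff.mp hroot, ?_⟩
  rw [spectrum.mem_iff, Matrix.isUnit_iff_isUnit_det, isUnit_iff_ne_zero, not_not,
    ← Matrix.exists_vecMul_eq_zero_iff] at hζ
  obtain ⟨v, hv, h⟩ := hζ
  refine ⟨v, hv, ?_⟩
  rw [Matrix.vecMul_sub, sub_eq_zero, Algebra.algebraMap_eq_smul_one, Matrix.vecMul_smul,
    Matrix.vecMul_one] at h
  exact h.symm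

/-- An endomorphism of prime order `p` of `ℤⁿ` has a nonzero equivariant map to the ring of
integers of the `p`-th cyclotomic field, on which it acts by a primitive root of unity. -/
theorem exists_linearMap_ringOfIntegers_of_pow_prime_eq_one {n p : ℕ} [hp : Fact p.Prime]
    (K : Type*) [Field K] [NumberField K] [IsCyclotomicExtension {p} ℚ K]
    {B : Module.End ℤ (Fin n → ℤ)} (hB : B ^ p = 1) (hB1 : B ≠ 1) :
    ∃ (ζ : K) (hζ : IsPrimitiveRoot ζ p) (f : (Fin n → ℤ) →ₗ[ℤ] 𝓞 K), f ≠ 0 ∧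
      ∀ x, f (B x) = hζ.toInteger * f x := by
  set M : Matrix (Fin n) (Fin n) ℤ := LinearMap.toMatrixAlgEquiv' B with hM
  have hMp : M ^ p = 1 := by rw [hM, ← map_pow, hB, map_one]
  have hM1 : M ≠ 1 := fun h ↦
    hB1 (LinearMap.toMatrixAlgEquiv'.injective (h.trans (map_one _).symm))
  have hBM (x) : B x = M.mulVec x := by
    rw [hM, ← Matrix.toLinAlgEquiv'_apply, Matrix.toLinAlgEquiv'_toMatrixAlgEquiv']
  let φ : Matrix (Fin n) (Fin n) ℤ →+* Matrix (Fin n) (Fin n) K := (algebraMap ℤ K).mapMatrix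
  have hφ : Function.Injective φ := Matrix.map_injective (algebraMap ℤ K).injective_int
  obtain ⟨ζ, hζ, v, hv, hvM⟩ := Matrix.exists_vecMul_eq_smul_of_pow_prime_eq_one (p := p) (N := φ M)
    ⟨_, IsCyclotomicExtension.zeta_spec p ℚ K⟩ (by rw [← map_pow, hMp, map_one])
    (fun h ↦ hM1 (hφ (by rw [h, map_one])))
  obtain ⟨b, hb⟩ := IsLocalization.exist_integer_multiples_of_finite (nonZeroDivisors (𝓞 K)) v
  choose w hw using hb
  have hbne : (algebraMap (𝓞 K) K b) ≠ 0 :=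
    IsLocalization.map_units K b |>.ne_zero
  have hwv : (fun i ↦ algebraMap (𝓞 K) K (w i)) = algebraMap (𝓞 K) K b • v := by
    ext i
    rw [hw, Pi.smul_apply, Algebra.smul_def, smul_eq_mul]
  have hf (x : Fin n → ℤ) : algebraMap (𝓞 K) K (Fintype.linearCombination ℤ w x) =
      (algebraMap (𝓞 K) K b • v) ⬝ᵥ (algebraMap ℤ K ∘ x) := by
    rw [← hwv, Fintype.linearCombination_apply, map_sum]
    refine Finset.sum_congr rfl fun i _ ↦ ?_
    simp [mul_comm]
  refine ⟨ζ, hζ, Fintype.linearCombination ℤ w, fun h0 ↦ hv ?_, fun x ↦ ?_⟩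
  · ext i
    have := hf (Pi.single i 1)
    rw [h0, LinearMap.zero_apply, map_zero] at this
    have h1 : (algebraMap ℤ K ∘ (Pi.single i 1 : Fin n → ℤ)) = Pi.single i 1 := by
      ext j
      simp [Pi.single_apply]
    rw [h1, dotProduct_single_one, Pi.smul_apply, smul_eq_mul] at this
    exact (mul_eq_zero.mp this.symm).resolve_left hbne
  · apply FaithfulSMul.algebraMap_injective (𝓞 K) K
    have h1 : algebraMap ℤ K ∘ B x = (φ M).mulVec (algebraMap ℤ K ∘ x) := by
      ext i
      rw [hBM, Function.comp_apply, RingHom.map_mulVec]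
      rfl
    rw [map_mul, hf, hf, h1, Matrix.dotProduct_mulVec, Matrix.smul_vecMul, hvM,
      smul_comm, smul_dotProduct, smul_eq_mul]
    rfl

/-- A nonzero ideal of the ring of integers of the `p`-th cyclotomic field, `p ≥ 5` a prime, is
spanned by at most `p - 4` elements. -/
theorem exists_finset_span_eq_of_isCyclotomicExtension {p : ℕ} (hp : p.Prime) (hp3 : 3 < p)
    (K : Type*) [Field K] [NumberField K] [IsCyclotomicExtension {p} ℚ K] (I : Ideal (𝓞 K)) :
    ∃ T : Finset (𝓞 K), T.card + 4 ≤ p ∧ Ideal.span (T : Set (𝓞 K)) = I := by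
  classical
  by_cases hI : I = ⊥
  · exact ⟨∅, by simpa using Nat.succ_le_of_lt hp3, by simp [hI]⟩
  rcases (show p = 4 ∨ p = 5 ∨ 6 ≤ p by omega) with rfl | rfl | h6
  · norm_num at hp
  · have := IsCyclotomicExtension.Rat.five_pid K
    obtain ⟨x, hx⟩ := (IsPrincipalIdealRing.principal I).principal
    exact ⟨{x}, by simp, by simpa using hx.symm⟩
  · obtain ⟨x, hxI, hx⟩ := Submodule.exists_mem_ne_zero_of_ne_bot hI
    obtain ⟨y, hy⟩ := IsDedekindDomain.exists_eq_span_pair hxI hx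
    exact ⟨{x, y}, by have := Finset.card_le_two (a := x) (b := y); omega, by simpa using hy.symm⟩

/-- If multiplication by a primitive `p`-th root of unity preserves an additive subgroup of the
ring of integers of the `p`-th cyclotomic field, then so does multiplication by any integer. -/
theorem AddSubgroup.mul_mem_of_toInteger_mul_mem {p : ℕ} [NeZero p] {K : Type*} [Field K]
    [NumberField K] [IsCyclotomicExtension {p} ℚ K] {ζ : K} (hζ : IsPrimitiveRoot ζ p)
    {P : AddSubgroup (𝓞 K)} (hP : ∀ x ∈ P, hζ.toInteger * x ∈ P) (r : 𝓞 K) {x : 𝓞 K}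
    (hx : x ∈ P) : r * x ∈ P := by
  have hr : r ∈ Algebra.adjoin ℤ {hζ.toInteger} := by
    rw [IsCyclotomicExtension.Rat.adjoin_singleton_eq_top hζ]
    trivial
  induction hr using Algebra.adjoin_induction generalizing x with
  | mem y hy => rw [Set.mem_singleton_iff.mp hy]; exact hP x hx
  | algebraMap k => rw [← Algebra.smul_def]; exact P.zsmul_mem hx k
  | add y z _ _ hy hz => rw [add_mul]; exact P.add_mem (hy hx) (hz hx)
  | mul y z _ _ hy hz => rw [mul_assoc]; exact hy (hz hx)

/-- For an endomorphism of prime order `p ≥ 5` of `ℤⁿ`, at most `n - 3` elements generate `ℤⁿ` as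
a module over the polynomials in this endomorphism. -/
theorem exists_finset_generating_of_pow_prime_eq_one {n p : ℕ} (hp : p.Prime) (hp3 : 3 < p)
    {B : Module.End ℤ (Fin n → ℤ)} (hB : B ^ p = 1) (hB1 : B ≠ 1) :
    ∃ S : Finset (Fin n → ℤ), S.card + 3 ≤ n ∧ ∀ P : AddSubgroup (Fin n → ℤ),
      (S : Set (Fin n → ℤ)) ⊆ P → (∀ x ∈ P, B x ∈ P) → P = ⊤ := by
  classical
  have : Fact p.Prime := ⟨hp⟩
  let K := CyclotomicField p ℚ
  have : NeZero ((p : ℕ) : ℚ) := ⟨Nat.cast_ne_zero.mpr hp.ne_zero⟩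
  have : IsCyclotomicExtension {p} ℚ K := CyclotomicField.isCyclotomicExtension p ℚ
  obtain ⟨ζ, hζ, f, hf0, hf⟩ := exists_linearMap_ringOfIntegers_of_pow_prime_eq_one K hB hB1
  let I : Ideal (𝓞 K) :=
    { f.range.toAddSubgroup with
      smul_mem' := fun r x hx ↦
        AddSubgroup.mul_mem_of_toInteger_mul_mem (P := f.range.toAddSubgroup) hζ
          (by rintro _ ⟨y, rfl⟩; exact ⟨B y, hf y⟩) r hx }
  have hIf : Submodule.restrictScalars ℤ I = f.range := rfl
  have hI : I ≠ ⊥ := by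
    intro h
    apply hf0
    rw [← LinearMap.range_eq_bot, ← hIf, h]
    rfl
  have hrank : Module.finrank ℤ f.range = p - 1 := by
    rw [← hIf, Ideal.finrank_eq_finrank (RingOfIntegers.basis K) I hI, RingOfIntegers.rank,
      IsCyclotomicExtension.Rat.finrank p K, Nat.totient_prime hp]
  have hker : Module.finrank ℤ f.ker + p = n + 1 := by
    have h := Submodule.finrank_quotient_add_finrank f.ker
    rw [f.quotKerEquivRange.finrank_eq, hrank, Module.finrank_fin_fun] at h
    have := hp.one_lt
    omega
  obtain ⟨T, hTcard, hT⟩ := exists_finset_span_eq_of_isCyclotomicExtension hp hp3 K I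
  have hTf : ∀ t ∈ T, ∃ x, f x = t := fun t ht ↦ by
    have : t ∈ I := hT ▸ Ideal.subset_span ht
    exact this
  choose! g hg using hTf
  let c := Module.finBasis ℤ f.ker
  refine ⟨T.image g ∪ Finset.univ.image fun i ↦ (c i : Fin n → ℤ), ?_, fun P hSP hPB ↦ ?_⟩
  · have h1 := Finset.card_union_le (T.image g) (Finset.univ.image fun i ↦ (c i : Fin n → ℤ))
    have h2 := Finset.card_image_le (s := T) (f := g)
    have h3 := Finset.card_image_le (s := Finset.univ) (f := fun i ↦ (c i : Fin n → ℤ))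
    rw [Finset.card_univ, Fintype.card_fin] at h3
    omega
  · have hkerP : ∀ x ∈ f.ker, x ∈ P := by
      have hle : Submodule.span ℤ (Set.range c) ≤
          (AddSubgroup.toIntSubmodule P).comap f.ker.subtype := by
        rw [Submodule.span_le]
        rintro _ ⟨i, rfl⟩
        exact hSP (by simp)
      rw [c.span_eq] at hle
      exact fun x hx ↦ hle (x := ⟨x, hx⟩) trivial
    have hIP : ∀ y ∈ I, y ∈ P.map f.toAddMonoidHom := by
      rw [← hT]
      have hmul : ∀ r : 𝓞 K, ∀ y ∈ P.map f.toAddMonoidHom, r * y ∈ P.map f.toAddMonoidHom :=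
        fun r y hy ↦ AddSubgroup.mul_mem_of_toInteger_mul_mem hζ
          (by rintro _ ⟨z, hz, rfl⟩; exact ⟨B z, hPB z hz, hf z⟩) r hy
      intro y hy
      induction hy using Submodule.span_induction with
      | mem t ht =>
        exact ⟨g t, hSP (Finset.mem_coe.mpr (Finset.mem_union_left _
          (Finset.mem_image_of_mem g ht))), hg t ht⟩
      | zero => exact zero_mem _
      | add a b _ _ ha hb => exact add_mem ha hb
      | smul r a _ ha => exact hmul r a ha
    rw [eq_top_iff]
    intro x _
    obtain ⟨z, hz, hzx⟩ := hIP (f x) ⟨x, rfl⟩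
    have hxz : x - z ∈ P := hkerP _ (by
      rw [LinearMap.mem_ker, map_sub, sub_eq_zero]
      exact hzx.symm)
    simpa using P.add_mem hxz hz

end Cyclotomic

/-- The conjugation action of a group on a normal subgroup isomorphic to `ℤⁿ`. -/
theorem exists_conj_representation {n : ℕ} {Γ : Type*} [Group Γ]
    {ι : Multiplicative (Fin n → ℤ) →* Γ} (hι : Function.Injective ι) (hn : ι.range.Normal) :
    ∃ ρ : Γ →* Module.End ℤ (Fin n → ℤ), ∀ g x,
      ι (Multiplicative.ofAdd (ρ g x)) = g * ι (Multiplicative.ofAdd x) * g⁻¹ := by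
  have h (g : Γ) (x : Fin n → ℤ) :
      ∃ y : Fin n → ℤ, ι (Multiplicative.ofAdd y) = g * ι (Multiplicative.ofAdd x) * g⁻¹ :=
    hn.conj_mem _ ⟨_, rfl⟩ g
  choose r hr using h
  have hinj {x y : Fin n → ℤ}
      (hxy : ι (Multiplicative.ofAdd x) = ι (Multiplicative.ofAdd y)) : x = y := hι hxy
  let R (g : Γ) : (Fin n → ℤ) →+ (Fin n → ℤ) :=
    AddMonoidHom.mk' (r g) fun x y ↦ hinj (by
      rw [ofAdd_add, map_mul, hr, hr, hr, ofAdd_add, map_mul]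
      group)
  exact ⟨{
    toFun g := (R g).toIntLinearMap
    map_one' := LinearMap.ext fun x ↦ hinj (by
      change ι (Multiplicative.ofAdd (r 1 x)) = _
      rw [hr]
      simp)
    map_mul' g h := LinearMap.ext fun x ↦ hinj (by
      change ι (Multiplicative.ofAdd (r (g * h) x)) = ι (Multiplicative.ofAdd (r g (r h x)))
      rw [hr, hr, hr]
      group) }, hr⟩

theorem minGenerators_le_card {G : Type*} [Group G] {S : Finset G}
    (hS : Subgroup.closure (S : Set G) = ⊤) : minGenerators G ≤ S.card :=
  Nat.sInf_le ⟨S, rfl, hS⟩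

/-- Let `Γ` be an `n`-dimensional crystallographic group whose holonomy group is the cyclic
group `C_m` of order `m`, where `m ≥ 3` and `m` is divisible by some prime larger than `3`.
Then `d(Γ) ≤ n - 2`.

The crystallographic structure is encoded by a short exact sequence
`0 → ℤⁿ →ι Γ →π C_m → 1` (with `ι` injective, `π` surjective and `ker π = range ι`),
such that the induced conjugation representation `ρ : C_m → GL_n(ℤ)` is faithful;
faithfulness is equivalent to the requirement that every element of `Γ` that centralizes
the translation lattice `ι(ℤⁿ)` already lies in `ι(ℤⁿ)`. -/
theorem minGenerators_le_of_crystallographic_cyclic_holonomy_large_prime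
    (n m : ℕ) (hm : 3 ≤ m) (Γ : Type*) [Group Γ]
    (ι : Multiplicative (Fin n → ℤ) →* Γ) (hι : Function.Injective ι)
    (π : Γ →* Multiplicative (ZMod m)) (hπ : Function.Surjective π)
    (hexact : ∀ γ : Γ, π γ = 1 ↔ γ ∈ ι.range)
    (hfaithful : ∀ γ : Γ, (∀ x, γ * ι x * γ⁻¹ = ι x) → γ ∈ ι.range)
    (hdvd : ∃ p : ℕ, p.Prime ∧ 3 < p ∧ p ∣ m) :
    (minGenerators Γ : ℤ) ≤ (n : ℤ) - 2 := by
  classical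
  obtain ⟨p, hp, hp3, q, rfl⟩ := hdvd
  have hker : ι.range = π.ker := by
    ext g
    exact (hexact g).symm
  obtain ⟨ρ, hρ⟩ := exists_conj_representation hι (hker ▸ inferInstance)
  obtain ⟨γ, hγ⟩ := hπ (Multiplicative.ofAdd 1)
  have hπγ (k : ℕ) : π (γ ^ k) = 1 ↔ p * q ∣ k := by
    rw [map_pow, hγ, ← ofAdd_nsmul, ofAdd_eq_one, nsmul_one, ZMod.natCast_eq_zero_iff]
  have hq : 0 < q := by
    rcases Nat.eq_zero_or_pos q with rfl | h
    · omega
    · exact h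
  have hB : ρ (γ ^ q) ^ p = 1 := by
    rw [← map_pow, ← pow_mul]
    obtain ⟨y, hy⟩ := (hexact (γ ^ (q * p))).mp ((hπγ _).mpr (mul_comm p q).dvd)
    refine LinearMap.ext fun x ↦ hι ?_
    change ι (Multiplicative.ofAdd (ρ (γ ^ (q * p)) x)) = ι (Multiplicative.ofAdd x)
    rw [hρ, ← hy, ← map_mul, mul_comm, map_mul, mul_inv_cancel_right]
  have hB1 : ρ (γ ^ q) ≠ 1 := by
    intro h
    have hmem := hfaithful (γ ^ q) fun x ↦ by
      have := hρ (γ ^ q) (Multiplicative.toAdd x)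
      rw [h] at this
      exact this.symm
    have hle := Nat.le_of_dvd hq ((hπγ q).mp ((hexact _).mpr hmem))
    nlinarith
  obtain ⟨S, hScard, hS⟩ := exists_finset_generating_of_pow_prime_eq_one hp hp3 hB hB1
  let T : Finset Γ := insert γ (S.image fun x ↦ ι (Multiplicative.ofAdd x))
  have hγT : γ ∈ Subgroup.closure (T : Set Γ) :=
    Subgroup.subset_closure (Finset.mem_coe.mpr (Finset.mem_insert_self _ _))
  have hrange : ι.range ≤ Subgroup.closure (T : Set Γ) := by
    have htop := hS (Subgroup.toAddSubgroup' ((Subgroup.closure (T : Set Γ)).comap ι))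
      (fun x hx ↦ Subgroup.subset_closure (Finset.mem_coe.mpr (Finset.mem_insert_of_mem
        (Finset.mem_image_of_mem (fun x ↦ ι (Multiplicative.ofAdd x)) hx))))
      (fun x hx ↦ by
        change ι (Multiplicative.ofAdd (ρ (γ ^ q) x)) ∈ Subgroup.closure (T : Set Γ)
        rw [hρ]
        exact mul_mem (mul_mem (pow_mem hγT q) hx) (inv_mem (pow_mem hγT q)))
    rintro _ ⟨x, rfl⟩
    have : Multiplicative.toAdd x ∈
        Subgroup.toAddSubgroup' ((Subgroup.closure (T : Set Γ)).comap ι) := htop ▸ trivial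
    exact this
  have hclosure : Subgroup.closure (T : Set Γ) = ⊤ := by
    rw [eq_top_iff]
    intro g _
    have : NeZero (p * q) := ⟨by omega⟩
    have hg : π g = π (γ ^ (Multiplicative.toAdd (π g)).val) := by
      rw [map_pow, hγ, ← ofAdd_nsmul, nsmul_one, ZMod.natCast_zmod_val, ofAdd_toAdd]
    have hmem := hrange ((hexact (g * (γ ^ (Multiplicative.toAdd (π g)).val)⁻¹)).mp (by
      rw [map_mul, map_inv, ← hg, mul_inv_cancel]))
    simpa using mul_mem hmem (pow_mem hγT (Multiplicative.toAdd (π g)).val)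
  have h1 := minGenerators_le_card hclosure
  have h2 : T.card ≤ S.card + 1 :=
    (Finset.card_insert_le _ _).trans (Nat.succ_le_succ Finset.card_image_le)
  omega
end

section
/- Let Γ be an n-dimensional Bieberbach group whose holonomy group is the cyclic group C_m of order m, where m ≥ 3 and m is not divisible by any prime larger than 3. Then d(Γ) ≤ n − 1. -/
theorem free_quotient_of_pure {M : Type*} [AddCommGroup M] [Module.Finite ℤ M]
    (S : Submodule ℤ M) (hS : ∀ (d : ℤ) (y : M), d ≠ 0 → d • y ∈ S → y ∈ S) :
    Module.Free ℤ (M ⧸ S) := by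
  have : Module.IsTorsionFree ℤ (M ⧸ S) := by
    refine Module.IsTorsionFree.of_smul_eq_zero fun d y h ↦ ?_
    induction y using Submodule.Quotient.induction_on with
    | _ y =>
      rw [← Submodule.Quotient.mk_smul, Submodule.Quotient.mk_eq_zero] at h
      rw [Submodule.Quotient.mk_eq_zero]
      exact or_iff_not_imp_left.2 fun hd ↦ hS d y hd h
  exact Module.free_of_finite_type_torsion_free'

/-- A torsion-free quotient `M ⧸ S` lets one complete `S` by few elements. -/
theorem exists_finset_complement_of_pure {M : Type*} [AddCommGroup M] [Module.Finite ℤ M]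
    (S : Submodule ℤ M) (hS : ∀ (d : ℤ) (y : M), d ≠ 0 → d • y ∈ S → y ∈ S) :
    ∃ s : Finset M, s.card + Module.finrank ℤ S ≤ Module.finrank ℤ M ∧
      ∀ T : Submodule ℤ M, S ≤ T → (s : Set M) ⊆ T → T = ⊤ := by
  classical
  have : Module.Free ℤ (M ⧸ S) := free_quotient_of_pure S hS
  let b := Module.finBasis ℤ (M ⧸ S)
  choose g hg using fun i ↦ S.mkQ_surjective (b i)
  refine ⟨Finset.univ.image g, ?_, fun T hST hT ↦ ?_⟩
  · have h1 := Submodule.finrank_quotient_add_finrank S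
    have h2 : (Finset.univ.image g).card ≤ _ := Finset.card_image_le
    simp only [Finset.card_univ, Fintype.card_fin] at h2
    omega
  · have hmap : T.map S.mkQ = ⊤ := by
      rw [eq_top_iff, ← b.span_eq, Submodule.span_le]
      rintro _ ⟨i, rfl⟩
      exact ⟨g i, hT (by simp), hg i⟩
    rw [← Submodule.comap_map_eq_self (f := S.mkQ) (p := T) (by simpa using hST), hmap,
      Submodule.comap_top]

theorem exists_two_mul_abs_sub_mul_le (a d : ℤ) (hd : 0 < d) : ∃ c : ℤ, |2 * (a - d * c)| ≤ d := by
  refine ⟨(2 * a + d) / (2 * d), ?_⟩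
  have h1 := Int.mul_ediv_add_emod (2 * a + d) (2 * d)
  have h2 := Int.emod_nonneg (2 * a + d) (b := 2 * d) (by omega)
  have h3 := Int.emod_lt_of_pos (2 * a + d) (b := 2 * d) (by omega)
  rw [abs_le]
  constructor <;> linarith

/-- If `B` satisfies `B² = tB - 1` on some nonzero vector, with `t ∈ {0, -1}`, then some `x`
satisfies the same equation, and `x`, `B x` span a pure sublattice of rank two. -/
theorem exists_pure_span_pair {M : Type*} [AddCommGroup M] [Module.Finite ℤ M] [Module.Free ℤ M]
    (B : M →ₗ[ℤ] M) (t : ℤ) (ht : t = 0 ∨ t = -1) (z : M) (hz : z ≠ 0)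
    (hBz : B (B z) = t • B z - z) :
    ∃ x : M, LinearIndependent ℤ ![x, B x] ∧
      ∀ (d : ℤ) (y : M), d ≠ 0 → d • y ∈ Submodule.span ℤ {x, B x} →
        y ∈ Submodule.span ℤ {x, B x} := by
  classical
  let f := (Module.finBasis ℤ M).equivFun
  let q : M → ℤ := fun x ↦ ∑ i, (f x i ^ 2 + f (B x) i ^ 2 - t * (f x i * f (B x) i))
  have hterm (X Y : ℤ) : 0 ≤ X ^ 2 + Y ^ 2 - t * (X * Y) := by
    rcases ht with rfl | rfl <;> nlinarith [sq_nonneg X, sq_nonneg Y, sq_nonneg (X + Y)]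
  have hterm0 (X Y : ℤ) (h : X ^ 2 + Y ^ 2 - t * (X * Y) = 0) : X = 0 := by
    have : X ^ 2 ≤ 0 := by
      rcases ht with rfl | rfl <;> nlinarith [sq_nonneg X, sq_nonneg Y, sq_nonneg (X + Y)]
    exact pow_eq_zero_iff (two_ne_zero) |>.1 (le_antisymm this (sq_nonneg X))
  have hq0 (x : M) : 0 ≤ q x := Finset.sum_nonneg fun i _ ↦ hterm _ _
  have hqpos (x : M) (hx : x ≠ 0) : 0 < q x := by
    refine lt_of_le_of_ne (hq0 x) fun h ↦ hx ?_
    have h' := (Finset.sum_eq_zero_iff_of_nonneg fun i _ ↦ hterm _ _).1 h.symm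
    apply f.injective
    ext i
    simpa using hterm0 _ _ (h' i (Finset.mem_univ i))
  have hqlin (x : M) (hx : B (B x) = t • B x - x) (a b : ℤ) :
      q (a • x + b • B x) = (a ^ 2 + t * (a * b) + b ^ 2) * q x := by
    simp only [q, Finset.mul_sum, map_add, map_smul, hx, map_sub, Pi.add_apply, Pi.sub_apply,
      Pi.smul_apply, smul_eq_mul]
    refine Finset.sum_congr rfl fun i _ ↦ ?_
    ring
  have hqsmul (d : ℤ) (x : M) : q (d • x) = d ^ 2 * q x := by
    simp only [q, Finset.mul_sum, map_smul, Pi.smul_apply, smul_eq_mul]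
    refine Finset.sum_congr rfl fun i _ ↦ ?_
    ring
  obtain ⟨x, ⟨hx0, hBx⟩, hmin⟩ : ∃ x : M, (x ≠ 0 ∧ B (B x) = t • B x - x) ∧
      ∀ y : M, y ≠ 0 → B (B y) = t • B y - y → q x ≤ q y := by
    let W : Set M := {y | y ≠ 0 ∧ B (B y) = t • B y - y}
    have hW : W.Nonempty := ⟨z, hz, hBz⟩
    refine ⟨Function.argminOn (fun y ↦ (q y).toNat) W hW, Function.argminOn_mem _ W hW, ?_⟩
    intro y hy hBy
    have := Function.argminOn_le (fun y ↦ (q y).toNat) W (a := y) ⟨hy, hBy⟩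
    have h1 := hq0 y
    have h2 := hq0 (Function.argminOn (fun y ↦ (q y).toNat) W hW)
    omega
  have hqx := hqpos x hx0
  refine ⟨x, ?_, ?_⟩
  · rw [LinearIndependent.pair_iff]
    intro a b hab
    have h1 := hqlin x hBx a b
    rw [hab] at h1
    have h2 : q 0 = 0 := by simp [q]
    rw [h2] at h1
    have h3 : a ^ 2 + t * (a * b) + b ^ 2 = 0 := by
      rcases mul_eq_zero.1 h1.symm with h | h
      · exact h
      · omega
    exact ⟨hterm0 a (-b) (by linear_combination h3), hterm0 b (-a) (by linear_combination h3)⟩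
  · have key (d : ℤ) (y : M) (hd : 0 < d) (hy : d • y ∈ Submodule.span ℤ {x, B x}) :
        y ∈ Submodule.span ℤ {x, B x} := by
      obtain ⟨a, b, hab⟩ := Submodule.mem_span_pair.1 hy
      obtain ⟨a', ha'⟩ := exists_two_mul_abs_sub_mul_le a d hd
      obtain ⟨b', hb'⟩ := exists_two_mul_abs_sub_mul_le b d hd
      have hBy : B (B y) = t • B y - y := by
        apply smul_right_injective M hd.ne'
        dsimp only
        rw [smul_sub, smul_comm d t, ← map_smul, ← map_smul, ← map_smul, ← hab]
        simp only [map_add, map_smul, hBx, map_sub]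
        module
      by_cases h : y - a' • x - b' • B x = 0
      · rw [Submodule.mem_span_pair]
        refine ⟨a', b', ?_⟩
        rw [sub_sub, sub_eq_zero] at h
        exact h.symm
      · exfalso
        have h1 := hmin _ h (by simp only [map_sub, map_smul, hBy, hBx]; module)
        have h2 := hqlin x hBx (a - d * a') (b - d * b')
        have h3 : (a - d * a') • x + (b - d * b') • B x = d • (y - a' • x - b' • B x) := by
          rw [smul_sub, smul_sub, ← hab]
          module
        rw [h3, hqsmul] at h2
        set u := a - d * a'
        set v := b - d * b'
        have h4 : 4 * (u ^ 2 + t * (u * v) + v ^ 2) ≤ 3 * d ^ 2 := by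
          have hu : (2 * u) ^ 2 ≤ d ^ 2 := sq_le_sq' (abs_le.1 ha').1 (abs_le.1 ha').2
          have hv : (2 * v) ^ 2 ≤ d ^ 2 := sq_le_sq' (abs_le.1 hb').1 (abs_le.1 hb').2
          rcases ht with rfl | rfl <;> nlinarith [sq_nonneg d, sq_nonneg (u + v)]
        nlinarith [mul_le_mul_of_nonneg_right h4 hqx.le, mul_le_mul_of_nonneg_left h1 (sq_nonneg d),
          mul_pos (pow_pos hd 2) hqx]
    intro d y hd hy
    refine key (d * d) y (mul_self_pos.2 hd) ?_
    rw [mul_smul]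
    exact Submodule.smul_mem _ _ hy

/-- Generators of a lattice as a module over `ℤ[B]`: one fewer than the rank suffices. -/
theorem exists_finset_generating_of_quadratic {M : Type*} [AddCommGroup M] [Module.Finite ℤ M]
    [Module.Free ℤ M] (B : M →ₗ[ℤ] M) (t : ℤ) (ht : t = 0 ∨ t = -1) (z : M) (hz : z ≠ 0)
    (hBz : B (B z) = t • B z - z) :
    ∃ s : Finset M, s.card + 1 ≤ Module.finrank ℤ M ∧
      ∀ T : Submodule ℤ M, (∀ y ∈ T, B y ∈ T) → (s : Set M) ⊆ T → T = ⊤ := by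
  classical
  obtain ⟨x, hli, hpure⟩ := exists_pure_span_pair B t ht z hz hBz
  obtain ⟨s, hcard, hs⟩ := exists_finset_complement_of_pure _ hpure
  have hrank : Module.finrank ℤ (Submodule.span ℤ {x, B x}) = 2 := by
    have := finrank_span_eq_card hli
    rwa [Matrix.range_cons_cons_empty, Fintype.card_fin] at this
  refine ⟨insert x s, ?_, fun T hBT hT ↦ ?_⟩
  · have := Finset.card_insert_le x s
    omega
  · have hx : x ∈ T := hT (by simp)
    refine hs T ?_ fun y hy ↦ hT (by simp [Finset.mem_coe.1 hy])
    rw [Submodule.span_le]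
    rintro y (rfl | rfl)
    · exact hx
    · exact hBT x hx

theorem exists_primitive_smul_eq {n : ℕ} (v : Fin n → ℤ) (hv : v ≠ 0) :
    ∃ (c : ℤ) (e : Fin n → ℤ), v = c • e ∧ e ≠ 0 ∧
      ∀ (d : ℤ) (y : Fin n → ℤ), d ≠ 0 → d • y ∈ Submodule.span ℤ {e} →
        y ∈ Submodule.span ℤ {e} := by
  obtain ⟨i₀, hi₀⟩ := Function.ne_iff.1 hv
  obtain ⟨e, he, hgcd⟩ := Finset.extract_gcd v (s := Finset.univ) ⟨i₀, Finset.mem_univ _⟩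
  refine ⟨_, e, funext fun i ↦ he i (Finset.mem_univ i), ?_, fun d y hd hy ↦ ?_⟩
  · rintro rfl
    exact hi₀ (by simpa using he i₀ (Finset.mem_univ i₀))
  · obtain ⟨a, ha⟩ := Submodule.mem_span_singleton.1 hy
    have hda : d ∣ a := by
      have h1 : d ∣ Finset.univ.gcd fun i ↦ a * e i :=
        Finset.dvd_gcd fun i _ ↦ ⟨y i, by simpa using congrFun ha i⟩
      rw [Finset.gcd_mul_left, hgcd, mul_one] at h1
      exact h1.trans (normalize_dvd_iff.2 dvd_rfl)
    obtain ⟨a', rfl⟩ := hda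
    refine Submodule.mem_span_singleton.2 ⟨a', smul_right_injective _ hd ?_⟩
    simpa [mul_smul] using ha

/-- A version of `exists_finset_generating_of_quadratic` modulo a fixed primitive vector `e`. -/
theorem exists_finset_generating_with_fixed {n : ℕ} (e : Fin n → ℤ) (he : e ≠ 0)
    (hprim : ∀ (d : ℤ) (y : Fin n → ℤ), d ≠ 0 → d • y ∈ Submodule.span ℤ {e} →
      y ∈ Submodule.span ℤ {e})
    (B : (Fin n → ℤ) →ₗ[ℤ] (Fin n → ℤ)) (hBe : B e = e) (t : ℤ) (ht : t = 0 ∨ t = -1)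
    (z : Fin n → ℤ) (hz : z ∉ Submodule.span ℤ {e}) (hBz : B (B z) = t • B z - z) :
    ∃ s : Finset (Fin n → ℤ), s.card + 2 ≤ n ∧
      ∀ T : Submodule ℤ (Fin n → ℤ), e ∈ T → (∀ y ∈ T, B y ∈ T) →
        (s : Set (Fin n → ℤ)) ⊆ T → T = ⊤ := by
  classical
  set S := Submodule.span ℤ {e} with hS
  have : Module.Free ℤ ((Fin n → ℤ) ⧸ S) := free_quotient_of_pure S hprim
  have hBS : S ≤ S.comap B := by
    rw [hS, Submodule.span_singleton_le_iff_mem, Submodule.mem_comap, hBe]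
    exact Submodule.mem_span_singleton_self e
  obtain ⟨s, hcard, hs⟩ := exists_finset_generating_of_quadratic (S.mapQ S B hBS) t ht
    (S.mkQ z) (by simpa using hz) (by
      simp only [Submodule.mkQ_apply, Submodule.mapQ_apply, hBz, Submodule.Quotient.mk_sub,
        Submodule.Quotient.mk_smul])
  have hrank : Module.finrank ℤ ((Fin n → ℤ) ⧸ S) + 1 = n := by
    have h1 := Submodule.finrank_quotient_add_finrank S
    have h2 := finrank_span_eq_card (LinearIndependent.of_subsingleton (R := ℤ) (v := ![e]) 0 he)
    rw [Matrix.range_cons, Matrix.range_empty, Set.union_empty, Fintype.card_fin] at h2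
    rw [← hS] at h2
    rwa [h2, Module.finrank_fin_fun] at h1
  let g := Function.surjInv S.mkQ_surjective
  have hg : ∀ y, S.mkQ (g y) = y := Function.surjInv_eq S.mkQ_surjective
  refine ⟨s.image g, ?_, fun T heT hBT hT ↦ ?_⟩
  · have : (s.image g).card ≤ s.card := Finset.card_image_le
    omega
  · have hmap : T.map S.mkQ = ⊤ := by
      refine hs _ ?_ fun y hy ↦ ⟨g y, hT ?_, hg y⟩
      · rintro _ ⟨y, hy, rfl⟩
        exact ⟨B y, hBT y hy, rfl⟩
      · exact Finset.mem_coe.2 (Finset.mem_image_of_mem g (Finset.mem_coe.1 hy))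
    rw [← Submodule.comap_map_eq_self (f := S.mkQ) (p := T) (by simpa [hS] using heT), hmap,
      Submodule.comap_top]

theorem three_dvd_or_four_dvd {m : ℕ} (hm : 3 ≤ m) (hdvd : ∀ p : ℕ, p.Prime → p ∣ m → p ≤ 3) :
    3 ∣ m ∨ 4 ∣ m := by
  have h23 (p : ℕ) (hp : p.Prime) (hpm : p ∣ m) : p = 2 ∨ p = 3 := by
    have := hdvd p hp hpm
    have := hp.two_le
    omega
  obtain ⟨p, hp, hpm⟩ := Nat.exists_prime_and_dvd (show m ≠ 1 by omega)
  rcases h23 p hp hpm with rfl | rfl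
  · obtain ⟨k, rfl⟩ := hpm
    obtain ⟨p, hp, hpk⟩ := Nat.exists_prime_and_dvd (show k ≠ 1 by omega)
    rcases h23 p hp (hpk.mul_left 2) with rfl | rfl
    · exact .inr (Nat.mul_dvd_mul_left 2 hpk)
    · exact .inl (hpk.mul_left 2)
  · exact .inl hpm

open Multiplicative in
/-- The conjugation action of `Γ` on a normal lattice. -/
theorem exists_conj_action {n : ℕ} {Γ : Type*} [Group Γ]
    (ι : Multiplicative (Fin n → ℤ) →* Γ) (hι : Function.Injective ι) (hn : ι.range.Normal) :
    ∃ A : Γ → (Fin n → ℤ) →ₗ[ℤ] (Fin n → ℤ),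
      (∀ g x, g * ι (ofAdd x) * g⁻¹ = ι (ofAdd (A g x))) ∧ ∀ g h x, A (g * h) x = A g (A h x) := by
  have h (g : Γ) (x : Fin n → ℤ) : ∃ y, ι (ofAdd y) = g * ι (ofAdd x) * g⁻¹ := by
    obtain ⟨y, hy⟩ := hn.conj_mem (ι (ofAdd x)) ⟨_, rfl⟩ g
    exact ⟨toAdd y, hy⟩
  choose a ha using h
  have inj {x y : Fin n → ℤ} (h : ι (ofAdd x) = ι (ofAdd y)) : x = y := ofAdd.injective (hι h)
  refine ⟨fun g ↦ (AddMonoidHom.mk' (a g) fun x y ↦ inj ?_).toIntLinearMap,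
    fun g x ↦ (ha g x).symm, fun g h x ↦ inj ?_⟩
  · rw [ofAdd_add, map_mul, ha, ha, ha, ofAdd_add, map_mul]
    group
  · change ι (ofAdd (a (g * h) x)) = ι (ofAdd (a g (a h x)))
    rw [ha, ha, ha]
    group

open Multiplicative in
/-- If `γ` maps to a generator of the holonomy group and `γ ^ m` is a primitive translation,
then `Γ` is generated by at most `n - 1` elements. -/
theorem exists_generating_finset_of_primitive
    {n m : ℕ} (hm : 3 ≤ m) (hm34 : 3 ∣ m ∨ 4 ∣ m) {Γ : Type*} [Group Γ]
    (ι : Multiplicative (Fin n → ℤ) →* Γ) (hι : Function.Injective ι) (hn : ι.range.Normal)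
    (hfaithful : ∀ γ : Γ, (∀ x, γ * ι x * γ⁻¹ = ι x) → γ ∈ ι.range)
    (γ : Γ) (hgen : ∀ g : Γ, ∃ k : ℤ, g * γ ^ k ∈ ι.range)
    (hord : ∀ k : ℕ, γ ^ k ∈ ι.range → m ∣ k)
    (e : Fin n → ℤ) (he : e ≠ 0) (hγ : γ ^ m = ι (ofAdd e))
    (hprim : ∀ (d : ℤ) (y : Fin n → ℤ), d ≠ 0 → d • y ∈ Submodule.span ℤ {e} →
      y ∈ Submodule.span ℤ {e}) :
    ∃ S : Finset Γ, S.card + 1 ≤ n ∧ Subgroup.closure (S : Set Γ) = ⊤ := by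
  classical
  obtain ⟨A, hA, hAmul⟩ := exists_conj_action ι hι hn
  have inj {x y : Fin n → ℤ} (h : ι (ofAdd x) = ι (ofAdd y)) : x = y := ofAdd.injective (hι h)
  have hAe (k : ℕ) : A (γ ^ k) e = e := by
    apply inj
    rw [← hA, ← hγ, pow_mul_comm, mul_inv_cancel_right]
  have hAm (x : Fin n → ℤ) : A (γ ^ m) x = x := by
    apply inj
    rw [← hA, hγ, ← map_mul, mul_comm, map_mul, mul_inv_cancel_right]
  have hnontriv (p r : ℕ) (hp : 1 < p) (hpr : m = r * p) :
      ∃ z, A (γ ^ r) z - z ∉ Submodule.span ℤ {e} := by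
    by_contra! h
    have hr : m ∣ r := by
      refine hord r (hfaithful _ fun x ↦ ?_)
      obtain ⟨k, hk⟩ := Submodule.mem_span_singleton.1 (h (toAdd x))
      have hj (j : ℕ) : A ((γ ^ r) ^ (j + 1)) (toAdd x) = toAdd x + ((j + 1 : ℕ) * k : ℤ) • e := by
        induction j with
        | zero => simp [hk]
        | succ j ih =>
          rw [pow_succ', hAmul, ih, map_add, map_smul, hAe, ← sub_add_cancel (A (γ ^ r) (toAdd x))
            (toAdd x), ← hk]
          push_cast
          module
      have h1 := hj (p - 1)
      rw [Nat.sub_add_cancel hp.le, ← pow_mul, ← hpr, hAm, left_eq_add, smul_eq_zero,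
        or_iff_left he, mul_eq_zero] at h1
      have hk0 : k = 0 := h1.resolve_left (by omega)
      rw [hk0, zero_smul, eq_comm, sub_eq_zero] at hk
      have := hA (γ ^ r) (toAdd x)
      rwa [hk] at this
    have hr0 : 0 < r := by
      rcases Nat.eq_zero_or_pos r with rfl | h
      · omega
      · exact h
    have := Nat.le_of_dvd hr0 hr
    nlinarith
  obtain ⟨r, t, ht, z, hz, hBz⟩ : ∃ (r : ℕ) (t : ℤ), (t = 0 ∨ t = -1) ∧ ∃ z,
      z ∉ Submodule.span ℤ {e} ∧ A (γ ^ r) (A (γ ^ r) z) = t • A (γ ^ r) z - z := by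
    rcases hm34 with ⟨r, hr⟩ | ⟨r, hr⟩
    · obtain ⟨z, hz⟩ := hnontriv 3 r (by norm_num) (by omega)
      refine ⟨r, -1, .inr rfl, _, hz, ?_⟩
      have h3 : A (γ ^ r) (A (γ ^ r) (A (γ ^ r) z)) = z := by
        rw [← hAmul, ← hAmul, ← pow_add, ← pow_add, show r + r + r = m by omega, hAm]
      rw [map_sub, map_sub, h3]
      module
    · obtain ⟨z, hz⟩ := hnontriv 2 (r + r) (by norm_num) (by omega)
      refine ⟨r, 0, .inl rfl, _, hz, ?_⟩
      have h4 : A (γ ^ r) (A (γ ^ r) (A (γ ^ (r + r)) z)) = z := by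
        rw [← hAmul, ← hAmul, ← pow_add, ← pow_add, show r + r + (r + r) = m by omega, hAm]
      rw [map_sub, map_sub, h4, ← hAmul, ← pow_add]
      module
  obtain ⟨s, hcard, hs⟩ :=
    exists_finset_generating_with_fixed e he hprim (A (γ ^ r)) (hAe r) t ht z hz hBz
  let S : Finset Γ := insert γ (s.image fun x ↦ ι (ofAdd x))
  refine ⟨S, ?_, ?_⟩
  · have h1 := Finset.card_insert_le γ (s.image fun x ↦ ι (ofAdd x))
    have h2 : (s.image fun x ↦ ι (ofAdd x)).card ≤ s.card := Finset.card_image_le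
    change (insert γ (s.image fun x ↦ ι (ofAdd x))).card + 1 ≤ n
    omega
  · set H := Subgroup.closure (S : Set Γ)
    have hγH : γ ∈ H := Subgroup.subset_closure (by simp [S])
    let T : Submodule ℤ (Fin n → ℤ) :=
      AddSubgroup.toIntSubmodule
        { carrier := {x | ι (ofAdd x) ∈ H}
          add_mem' := fun {x y} hx hy ↦ by
            simpa only [Set.mem_ofPred_eq, ofAdd_add, map_mul] using H.mul_mem hx hy
          zero_mem' := by simp
          neg_mem' := fun {x} hx ↦ by
            simpa only [Set.mem_ofPred_eq, ofAdd_neg, map_inv] using H.inv_mem hx }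
    have hT : T = ⊤ := by
      refine hs T ?_ (fun y hy ↦ ?_) fun y hy ↦ ?_
      · change ι (ofAdd e) ∈ H
        rw [← hγ]
        exact H.pow_mem hγH m
      · change ι (ofAdd (A (γ ^ r) y)) ∈ H
        rw [← hA]
        exact H.mul_mem (H.mul_mem (H.pow_mem hγH r) hy) (H.inv_mem (H.pow_mem hγH r))
      · refine Subgroup.subset_closure ?_
        exact Finset.mem_coe.2 (Finset.mem_insert_of_mem
          (Finset.mem_image_of_mem _ (Finset.mem_coe.1 hy)))
    rw [eq_top_iff]
    intro g _
    obtain ⟨k, x, hx⟩ := hgen g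
    have hxT : toAdd x ∈ T := hT ▸ Submodule.mem_top
    rw [← H.mul_mem_cancel_right (H.zpow_mem hγH k), ← hx]
    exact hxT

open Multiplicative in
/-- In a torsion-free `Γ`, after changing the lift of a generator of the holonomy group, its
`m`-th power is a primitive translation. -/
theorem exists_lift_with_primitive_power
    {n m : ℕ} (hm : 2 ≤ m) {Γ : Type*} [Group Γ]
    (ι : Multiplicative (Fin n → ℤ) →* Γ) (hι : Function.Injective ι)
    (π : Γ →* Multiplicative (ZMod m)) (hπ : Function.Surjective π)
    (hexact : ∀ γ : Γ, π γ = 1 ↔ γ ∈ ι.range)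
    (htf : ∀ γ : Γ, γ ≠ 1 → ¬ IsOfFinOrder γ) :
    ∃ (γ : Γ) (e : Fin n → ℤ), e ≠ 0 ∧ γ ^ m = ι (ofAdd e) ∧
      (∀ (d : ℤ) (y : Fin n → ℤ), d ≠ 0 → d • y ∈ Submodule.span ℤ {e} →
        y ∈ Submodule.span ℤ {e}) ∧
      (∀ g : Γ, ∃ k : ℤ, g * γ ^ k ∈ ι.range) ∧ ∀ k : ℕ, γ ^ k ∈ ι.range → m ∣ k := by
  have htf' (g : Γ) (k : ℕ) (hk : 0 < k) (hg : g ^ k = 1) : g = 1 := by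
    by_contra h
    exact htf g h (isOfFinOrder_iff_pow_eq_one.2 ⟨k, hk, hg⟩)
  have hιπ (x) : π (ι x) = 1 := (hexact _).2 ⟨x, rfl⟩
  obtain ⟨γ, hγ⟩ := hπ (ofAdd 1)
  have hpow (k : ℕ) : γ ^ k ∈ ι.range ↔ m ∣ k := by
    rw [← hexact, map_pow, hγ, ← ofAdd_nsmul, ofAdd_eq_one, nsmul_one, ZMod.natCast_eq_zero_iff]
  obtain ⟨v', hv'⟩ := (hpow m).2 dvd_rfl
  obtain ⟨v, rfl⟩ := ofAdd.surjective v'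
  have hv : v ≠ 0 := by
    rintro rfl
    rw [ofAdd_zero, map_one] at hv'
    have := htf' γ m (by omega) hv'.symm
    have h1 := (hpow 1).1 (by rw [this, one_pow]; exact one_mem _)
    have := Nat.le_of_dvd one_pos h1
    omega
  obtain ⟨c, e, rfl, he, hprim⟩ := exists_primitive_smul_eq v hv
  have hc : c ≠ 0 := by
    rintro rfl
    simp at hv
  have hcomm : Commute γ (ι (ofAdd e)) := by
    obtain ⟨y, hy⟩ : γ * ι (ofAdd e) * γ⁻¹ ∈ ι.range := by
      rw [← hexact, map_mul, map_mul, hιπ, mul_one, map_inv, mul_inv_cancel]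
    have h1 : y ^ c = ofAdd e ^ c := by
      apply hι
      rw [map_zpow, hy, conj_zpow, ← map_zpow, ← ofAdd_zsmul, hv', (Commute.self_pow γ m).eq,
        mul_inv_cancel_right]
    have h2 : y = ofAdd e := by
      have : c • toAdd y = c • e := congrArg toAdd h1
      exact toAdd.injective (smul_right_injective _ hc this)
    rw [h2] at hy
    exact (mul_inv_eq_iff_eq_mul.1 hy.symm)
  have hcop : IsCoprime c (m : ℤ) := by
    rw [Int.isCoprime_iff_nat_coprime, Int.natAbs_natCast]
    by_contra h
    obtain ⟨p, hp, hpc, hpm⟩ := Nat.Prime.not_coprime_iff_dvd.1 h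
    obtain ⟨b, rfl⟩ := Int.natCast_dvd.2 hpc
    obtain ⟨r, rfl⟩ := hpm
    have h1 : γ ^ r = ι (ofAdd (b • e)) := by
      rw [← mul_inv_eq_one]
      refine htf' _ p hp.pos ?_
      have hcomm' : Commute (γ ^ r) (ι (ofAdd (b • e)))⁻¹ := by
        rw [ofAdd_zsmul, map_zpow]
        exact ((hcomm.zpow_right b).pow_left r).inv_right
      rw [hcomm'.mul_pow, ← pow_mul, mul_comm r, ← hv', inv_pow, ← map_pow, mul_inv_eq_one,
        ← ofAdd_nsmul, ← natCast_zsmul, ← mul_smul]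
    have h2 := (hpow r).1 (h1 ▸ ⟨_, rfl⟩)
    have hr : 0 < r := Nat.pos_of_ne_zero (by rintro rfl; omega)
    have := Nat.le_of_dvd hr h2
    have := hp.two_le
    nlinarith
  obtain ⟨j, i, hji⟩ := hcop
  have hunit : (j : ZMod m) * c = 1 := by
    have := congrArg (Int.cast : ℤ → ZMod m) hji
    simpa using this
  have hπγ' : π (γ ^ j * ι (ofAdd (i • e))) = ofAdd (j : ZMod m) := by
    rw [map_mul, hιπ, mul_one, map_zpow, hγ, ← ofAdd_zsmul, zsmul_one]
  refine ⟨γ ^ j * ι (ofAdd (i • e)), e, he, ?_, hprim, fun g ↦ ?_, fun k hk ↦ ?_⟩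
  · have hcomm' : Commute (γ ^ j) (ι (ofAdd (i • e))) := by
      rw [ofAdd_zsmul, map_zpow]
      exact hcomm.zpow_zpow j i
    rw [hcomm'.mul_pow, ← zpow_natCast, ← zpow_mul, mul_comm, zpow_mul, zpow_natCast, ← hv',
      ← map_zpow, ← map_pow, ← map_mul, ← ofAdd_zsmul, ← ofAdd_nsmul, ← ofAdd_add,
      ← natCast_zsmul, ← mul_smul, ← mul_smul, ← add_smul, mul_comm _ i, hji, one_smul]
  · obtain ⟨l, hl⟩ := ZMod.intCast_surjective (toAdd (π g))
    refine ⟨-(c * l), ?_⟩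
    rw [← hexact, map_mul, map_zpow, hπγ', ← ofAdd_zsmul, ← ofAdd_toAdd (π g), ← ofAdd_add,
      ofAdd_eq_one, ← hl, zsmul_eq_mul]
    push_cast
    linear_combination -(l : ZMod m) * hunit
  · rw [← hexact, map_pow, hπγ', ← ofAdd_nsmul, ofAdd_eq_one, nsmul_eq_mul] at hk
    rw [← ZMod.natCast_eq_zero_iff]
    linear_combination (c : ZMod m) * hk - (k : ZMod m) * hunit

/-- Let `Γ` be an `n`-dimensional Bieberbach group (a torsion-free crystallographic group)
whose holonomy group is the cyclic group `C_m` of order `m`, where `m ≥ 3` and `m` is not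
divisible by any prime larger than `3`. Then `d(Γ) ≤ n - 1`.

The crystallographic structure is encoded by a short exact sequence
`0 → ℤⁿ →ι Γ →π C_m → 1` (with `ι` injective, `π` surjective and `ker π = range ι`),
such that the induced conjugation representation `ρ : C_m → GL_n(ℤ)` is faithful;
faithfulness is equivalent to the requirement that every element of `Γ` that centralizes
the translation lattice `ι(ℤⁿ)` already lies in `ι(ℤⁿ)`. -/
theorem minGenerators_le_of_bieberbach_cyclic_holonomy_no_large_prime
    (n m : ℕ) (hm : 3 ≤ m) (Γ : Type*) [Group Γ]
    (ι : Multiplicative (Fin n → ℤ) →* Γ) (hι : Function.Injective ι)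
    (π : Γ →* Multiplicative (ZMod m)) (hπ : Function.Surjective π)
    (hexact : ∀ γ : Γ, π γ = 1 ↔ γ ∈ ι.range)
    (hfaithful : ∀ γ : Γ, (∀ x, γ * ι x * γ⁻¹ = ι x) → γ ∈ ι.range)
    (htf : ∀ γ : Γ, γ ≠ 1 → ¬ IsOfFinOrder γ)
    (hdvd : ∀ p : ℕ, p.Prime → p ∣ m → p ≤ 3) :
    (minGenerators Γ : ℤ) ≤ (n : ℤ) - 1 := by
  obtain ⟨γ, e, he, hγ, hprim, hgen, hord⟩ :=
    exists_lift_with_primitive_power (by omega) ι hι π hπ hexact htf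
  have hn : ι.range.Normal := by
    have : ι.range = π.ker := by
      ext g
      rw [← hexact, MonoidHom.mem_ker]
    rw [this]
    infer_instance
  obtain ⟨S, hcard, hS⟩ := exists_generating_finset_of_primitive hm
    (three_dvd_or_four_dvd hm hdvd) ι hι hn hfaithful γ hgen hord e he hγ hprim
  have : minGenerators Γ ≤ S.card := Nat.sInf_le ⟨S, rfl, hS⟩
  omega
end

section
/- Let Γ be an n-dimensional Bieberbach group whose holonomy group G can be generated by 2 elements. Then d(Γ) ≤ n. -/
/-! ### Primitive vectors in lattices -/

/-- An endomorphism all of whose values are even is twice an endomorphism. -/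
theorem exists_half {N : Type*} [AddCommGroup N] [Module.Free ℤ N] {φ : N →ₗ[ℤ] N} (h : ∀ x, ∃ u, φ x = (2 : ℤ) • u) :
    ∃ e : N →ₗ[ℤ] N, ∀ x, φ x = (2 : ℤ) • e x := by
  choose u hu using h
  have h2 : ∀ x y : N, (2 : ℤ) • x = (2 : ℤ) • y → x = y := fun x y hxy =>
    smul_right_injective N (two_ne_zero) hxy
  refine ⟨⟨⟨u, fun x y => h2 _ _ ?_⟩, fun m x => h2 _ _ ?_⟩, hu⟩
  · rw [smul_add, ← hu, ← hu, ← hu, map_add]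
  · simp only [RingHom.id_apply]
    rw [smul_comm, ← hu, ← hu, map_smul]

section Lattice

variable {N : Type*} [AddCommGroup N] [Module.Free ℤ N] [Module.Finite ℤ N]

/-- Every nonzero lattice vector is an integer multiple of a primitive vector. -/
theorem exists_eq_smul_primitive {y : N} (hy : y ≠ 0) :
    ∃ (c : ℤ) (w : N) (f : N →ₗ[ℤ] ℤ), c ≠ 0 ∧ y = c • w ∧ f w = 1 := by
  let b := Module.Free.chooseBasis ℤ N
  let I : Ideal ℤ := LinearMap.range (LinearMap.applyₗ (R := ℤ) (M₂ := ℤ) y)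
  obtain ⟨c, hc⟩ := (IsPrincipalIdealRing.principal I).principal
  have hcI : c ∈ I := hc ▸ Submodule.mem_span_singleton_self c
  obtain ⟨f, hf⟩ := hcI
  have hdvd : ∀ g : N →ₗ[ℤ] ℤ, c ∣ g y := fun g => by
    have : g y ∈ I := ⟨g, rfl⟩
    rw [hc] at this
    exact Ideal.mem_span_singleton.1 this
  choose k hk using fun i => hdvd (b.coord i)
  have hyw : y = c • ∑ i, k i • b i := by
    conv_lhs => rw [← b.sum_repr y]
    rw [Finset.smul_sum]
    refine Finset.sum_congr rfl fun i _ => ?_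
    rw [smul_smul, ← hk i]; rfl
  have hc0 : c ≠ 0 := by
    rintro rfl
    exact hy (by rw [hyw, zero_smul])
  refine ⟨c, _, f, hc0, hyw, ?_⟩
  have h : f y = c := hf
  rw [hyw, map_smul, smul_eq_mul] at h
  exact mul_left_cancel₀ hc0 (h.trans (mul_one c).symm)

/-- A pair of vectors spanning a pure sublattice of rank two is unimodular. -/
theorem exists_functionals_of_pure {v₁ v₂ : N}
    (h : ∀ (c x y : ℤ) (u : N), c ≠ 0 → c • u = x • v₁ + y • v₂ → c ∣ x ∧ c ∣ y) :
    ∃ f g : N →ₗ[ℤ] ℤ, f v₁ = 1 ∧ g v₁ = 0 ∧ g v₂ = 1 := by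
  have h₁ : v₁ ≠ 0 := by
    rintro rfl
    have := (h 2 1 0 0 (by norm_num) (by simp)).1
    omega
  obtain ⟨c, w, f, hc, hw, hf⟩ := exists_eq_smul_primitive h₁
  have hcu : c * c = 1 := by
    have := (h c 1 0 w hc (by simp [hw])).1
    rcases Int.isUnit_iff.1 (isUnit_of_dvd_one this) with rfl | rfl <;> norm_num
  have hf₁ : (c • f) v₁ = 1 := by simp [hw, hf, hcu]
  set f₁ := c • f with hf₁def
  have hz : v₂ - f₁ v₂ • v₁ ≠ 0 := by
    intro h0
    have := (h 2 (-f₁ v₂) 1 0 (by norm_num) (by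
      rw [smul_zero, ← h0, neg_smul, one_smul]; abel)).2
    omega
  obtain ⟨d, u, g, hd, hu, hg⟩ := exists_eq_smul_primitive hz
  have hdu : d * d = 1 := by
    have := (h d (-f₁ v₂) 1 u hd (by rw [← hu, neg_smul, one_smul]; abel)).2
    rcases Int.isUnit_iff.1 (isUnit_of_dvd_one this) with rfl | rfl <;> norm_num
  refine ⟨f₁, (d • g) ∘ₗ (LinearMap.id - f₁.smulRight v₁), hf₁, ?_, ?_⟩
  · simp [hf₁]
  · have : (LinearMap.id - f₁.smulRight v₁ : N →ₗ[ℤ] N) v₂ = d • u := by simpa using hu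
    rw [LinearMap.comp_apply, this]
    simp [hg, hdu]

/-- If `w` is primitive and `y` is independent of `w` modulo `2`, then `y` can be changed modulo
twice a rational combination of `y` and `w` so as to extend `w` to a unimodular pair. -/
theorem exists_unimodular_adjust {w y : N} {f : N →ₗ[ℤ] ℤ} (hf : f w = 1)
    (hy : ∀ (l : N) (m : ℤ), y ≠ (2 : ℤ) • l + m • w) :
    ∃ (u : N) (c p q : ℤ) (g : N →ₗ[ℤ] ℤ), c ≠ 0 ∧ c • u = p • y + q • w ∧
      g w = 0 ∧ g (y + (2 : ℤ) • u) = 1 := by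
  have hz : y - f y • w ≠ 0 := fun h0 => hy 0 (f y) (by
    rw [sub_eq_zero.1 h0]; simp [hf])
  obtain ⟨c, w', g, hc, hw', hg⟩ := exists_eq_smul_primitive hz
  have hodd : ¬ (2 : ℤ) ∣ c := by
    rintro ⟨k, rfl⟩
    refine hy (k • w') (f y) ?_
    rw [smul_smul, ← hw']; abel
  obtain ⟨m, hm⟩ : ∃ m, c + 2 * m = 1 := ⟨(1 - c) / 2, by omega⟩
  have hfw' : f w' = 0 := by
    have : f (c • w') = 0 := by rw [← hw']; simp [hf]
    simpa [hc] using this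
  refine ⟨m • w', c, m, -(m * f y), g ∘ₗ (LinearMap.id - f.smulRight w), hc, ?_, ?_, ?_⟩
  · rw [smul_comm, ← hw', smul_sub, smul_smul, neg_smul]; abel
  · simp [hf]
  · have : (LinearMap.id - f.smulRight w : N →ₗ[ℤ] N) (y + (2 : ℤ) • m • w') = (c + 2 * m) • w' := by
      have h1 : (LinearMap.id - f.smulRight w : N →ₗ[ℤ] N) y = c • w' := by simpa using hw'
      have h2 : (LinearMap.id - f.smulRight w : N →ₗ[ℤ] N) w' = w' := by simp [hfw']
      rw [map_add, h1, map_smul, map_smul, h2, add_smul, smul_smul]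
    rw [LinearMap.comp_apply, this, hm, one_smul, hg]

/-- An automorphism of finite order preserves a positive definite integral form. -/
theorem exists_invariant_form (a : Module.End ℤ N) {k : ℕ} (hk : 0 < k) (hak : a ^ k = 1) :
    ∃ B : N → N → ℤ, (∀ x y z, B (x + y) z = B x z + B y z) ∧
      (∀ (m : ℤ) x z, B (m • x) z = m * B x z) ∧ (∀ x y, B x y = B y x) ∧
      (∀ x y, B (a x) (a y) = B x y) ∧ ∀ x, x ≠ 0 → 0 < B x x := by
  let b := Module.Free.chooseBasis ℤ N
  refine ⟨fun x y => ∑ j ∈ Finset.range k, ∑ i, b.repr ((a ^ j) x) i * b.repr ((a ^ j) y) i,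
    ?_, ?_, ?_, ?_, ?_⟩
  · intro x y z
    simp only [map_add, Finsupp.add_apply, add_mul, Finset.sum_add_distrib]
  · intro m x z
    simp only [map_smul, Finsupp.smul_apply, smul_eq_mul, mul_assoc, Finset.mul_sum]
  · intro x y
    simp only [mul_comm]
  · intro x y
    obtain ⟨l, rfl⟩ : ∃ l, k = l + 1 := ⟨k - 1, by omega⟩
    have h : ∀ (j : ℕ) (z : N), (a ^ j) (a z) = (a ^ (j + 1)) z := fun j z => by
      rw [pow_succ]; rfl
    simp only [h]
    rw [Finset.sum_range_succ, Finset.sum_range_succ', hak]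
    simp
  · intro x hx
    have hnn : ∀ j, 0 ≤ ∑ i, b.repr ((a ^ j) x) i * b.repr ((a ^ j) x) i := fun j =>
      Finset.sum_nonneg fun i _ => mul_self_nonneg _
    refine lt_of_lt_of_le ?_ (Finset.single_le_sum (fun j _ => hnn j) (Finset.mem_range.2 hk))
    obtain ⟨i, hi⟩ : ∃ i, b.repr x i ≠ 0 := by
      by_contra! h
      exact hx (b.repr.map_eq_zero_iff.1 (Finsupp.ext h))
    refine lt_of_lt_of_le ?_ (Finset.single_le_sum
      (f := fun i => b.repr ((a ^ 0) x) i * b.repr ((a ^ 0) x) i)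
      (fun i _ => mul_self_nonneg _) (Finset.mem_univ i))
    simpa using mul_self_pos.2 hi

/-- If an automorphism `a` of finite order is such that `a ^ 2` fixes no nonzero vector, then a
shortest vector `v` for an invariant form yields a unimodular pair `v, a v`. -/
theorem exists_unimodular_orbit [Nontrivial N] (a : Module.End ℤ N) {k : ℕ} (hk : 0 < k)
    (hak : a ^ k = 1) (hfix : ∀ x, a (a x) = x → x = 0) :
    ∃ (v : N) (f g : N →ₗ[ℤ] ℤ), f v = 1 ∧ g v = 0 ∧ g (a v) = 1 := by
  obtain ⟨B, hadd, hsmul, hsymm, hinv, hpos⟩ := exists_invariant_form a hk hak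
  obtain ⟨x₀, hx₀⟩ := exists_ne (0 : N)
  obtain ⟨v, hv0, hmin⟩ : ∃ v : N, v ≠ 0 ∧ ∀ u : N, u ≠ 0 → B v v ≤ B u u := by
    obtain ⟨v, hv, hm⟩ := (measure fun u : N => (B u u).toNat).wf.has_min {u | u ≠ 0} ⟨x₀, hx₀⟩
    refine ⟨v, hv, fun u hu => ?_⟩
    have h1 := hm u hu
    have h1' : ¬ (B u u).toNat < (B v v).toNat := h1
    have := hpos u hu
    have := hpos v hv
    omega
  have hadd' : ∀ x y z, B x (y + z) = B x y + B x z := fun x y z => by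
    rw [hsymm, hadd, hsymm y, hsymm z]
  have hsmul' : ∀ (m : ℤ) x z, B x (m • z) = m * B x z := fun m x z => by
    rw [hsymm, hsmul, hsymm]
  have hcomb : ∀ r s : ℤ, B (r • v + s • a v) (r • v + s • a v) =
      (r ^ 2 + s ^ 2) * B v v + 2 * r * s * B v (a v) := fun r s => by
    simp only [hadd, hadd', hsmul, hsmul', hinv, hsymm (a v) v]; ring
  have hind : ∀ r : ℤ, r ^ 2 = 1 → v + r • a v ≠ 0 := by
    intro r hr h0
    have h1 : v = -(r • a v) := eq_neg_of_add_eq_zero_left h0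
    have h2 : a v = -(r • v) := by
      conv_rhs => rw [h1, smul_neg, neg_neg, smul_smul, ← pow_two, hr, one_smul]
    apply hv0
    apply hfix
    rw [h2, map_neg, map_smul]
    exact h1.symm
  have hb₁ : 0 < B v v + B v (a v) := by
    have := hpos _ (hind 1 (by norm_num))
    have h := hcomb 1 1
    simp only [one_smul] at h this
    rw [h] at this; linarith
  have hb₂ : 0 < B v v - B v (a v) := by
    have := hpos _ (hind (-1) (by norm_num))
    have h := hcomb 1 (-1)
    rw [one_smul] at h
    rw [h] at this; linarith
  refine ⟨v, exists_functionals_of_pure fun c x y u hc hu => ?_⟩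
  have hred : ∀ x : ℤ, ∃ x' r : ℤ, x = c * x' + r ∧ 4 * r ^ 2 ≤ c ^ 2 := fun x => by
    refine ⟨(x - Int.bmod x c.natAbs) / c, Int.bmod x c.natAbs, ?_, ?_⟩
    · have : c ∣ x - Int.bmod x c.natAbs := by
        rw [← Int.natAbs_dvd]
        exact Int.dvd_self_sub_bmod
      rw [Int.mul_ediv_cancel' this]; ring
    · have hn : 0 < c.natAbs := Int.natAbs_pos.2 hc
      have h1 := Int.le_bmod (x := x) hn
      have h2 := Int.bmod_le (x := x) hn
      rw [← Int.natAbs_sq c]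
      have h3 : -(c.natAbs : ℤ) ≤ 2 * Int.bmod x c.natAbs := by omega
      have h4 : 2 * Int.bmod x c.natAbs ≤ (c.natAbs : ℤ) := by omega
      nlinarith
  obtain ⟨x', r, hx, hr⟩ := hred x
  obtain ⟨y', s, hy, hs⟩ := hred y
  have hu' : c • (u - x' • v - y' • a v) = r • v + s • a v := by
    rw [smul_sub, smul_sub, hu, hx, hy]; module
  have hlt : (r ^ 2 + s ^ 2) * B v v + 2 * r * s * B v (a v) < c ^ 2 * B v v := by
    have hc2 : 0 < c ^ 2 := by positivity
    have h1 : 2 * r * s * B v (a v) ≤ (r ^ 2 + s ^ 2) * |B v (a v)| := by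
      have : 2 * r * s * B v (a v) ≤ |2 * r * s| * |B v (a v)| := by
        rw [← abs_mul]; exact le_abs_self _
      refine this.trans (mul_le_mul_of_nonneg_right ?_ (abs_nonneg _))
      rw [abs_le]; constructor <;> nlinarith [sq_nonneg (r + s), sq_nonneg (r - s)]
    have h2 : |B v (a v)| < B v v := abs_lt.2 ⟨by linarith, by linarith⟩
    have := hpos v hv0
    nlinarith [abs_nonneg (B v (a v)), mul_pos hc2 this]
  have h0 : u - x' • v - y' • a v = 0 := by
    by_contra hne
    have h1 := hmin _ hne
    have h2 := hcomb r s
    rw [← hu', hsmul, hsmul'] at h2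
    have hc2 : 0 < c ^ 2 := by positivity
    nlinarith
  rw [h0, smul_zero] at hu'
  have hz := hcomb r s
  rw [← hu'] at hz
  have hB0 : B (0 : N) 0 = 0 := by simpa using hsmul 0 0 0
  rw [hB0] at hz
  have hrs : r ^ 2 + s ^ 2 = 0 := by
    by_contra hne
    have hp : 0 < r ^ 2 + s ^ 2 := lt_of_le_of_ne (by positivity) (Ne.symm hne)
    rcases le_total 0 (r * s) with h | h <;> nlinarith [sq_nonneg (r + s), sq_nonneg (r - s)]
  have hr0 : r = 0 := by nlinarith [sq_nonneg r, sq_nonneg s]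
  have hs0 : s = 0 := by nlinarith [sq_nonneg r, sq_nonneg s]
  exact ⟨⟨x', by rw [hx, hr0, add_zero]⟩, ⟨y', by rw [hy, hs0, add_zero]⟩⟩

end Lattice

/-! ### Torsion-free extensions of a lattice -/

/-- The data of a Bieberbach group `Γ` with translation lattice `ℤⁿ`, written additively, and
holonomy group `G`, together with the conjugation action of `Γ` on the lattice. -/
structure BieberbachData (n : ℕ) (Γ G : Type*) [Group Γ] [Group G] where
  t : (Fin n → ℤ) → Γ
  π : Γ →* G
  act : Γ →* Module.End ℤ (Fin n → ℤ)
  t_add : ∀ x y, t (x + y) = t x * t y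
  t_inj : Function.Injective t
  conj : ∀ γ x, γ * t x = t (act γ x) * γ
  π_surj : Function.Surjective π
  π_eq_one_iff : ∀ γ, π γ = 1 ↔ ∃ x, t x = γ
  faithful : ∀ γ, act γ = 1 → π γ = 1
  torsionFree : ∀ (γ : Γ) (k : ℕ), 0 < k → γ ^ k = 1 → γ = 1

namespace BieberbachData

variable {n : ℕ} {Γ G : Type*} [Group Γ] [Group G] (D : BieberbachData n Γ G)

/-- The translation subgroup as a homomorphism. -/
def tHom : Multiplicative (Fin n → ℤ) →* Γ :=
  MonoidHom.mk' (fun x => D.t x.toAdd) fun x y => D.t_add x.toAdd y.toAdd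

theorem t_zero : D.t 0 = 1 := map_one D.tHom

theorem t_neg (x : Fin n → ℤ) : D.t (-x) = (D.t x)⁻¹ := map_inv D.tHom (.ofAdd x)

theorem t_zsmul (m : ℤ) (x : Fin n → ℤ) : D.t (m • x) = D.t x ^ m :=
  map_zpow D.tHom (.ofAdd x) m

theorem t_nsmul (m : ℕ) (x : Fin n → ℤ) : D.t ((m : ℤ) • x) = D.t x ^ m := by
  rw [t_zsmul, zpow_natCast]

theorem π_t (x : Fin n → ℤ) : D.π (D.t x) = 1 := (D.π_eq_one_iff _).2 ⟨x, rfl⟩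

theorem act_t (x : Fin n → ℤ) : D.act (D.t x) = 1 := by
  refine LinearMap.ext fun y => D.t_inj ?_
  have h := D.conj (D.t x) y
  rw [← D.t_add, add_comm, D.t_add] at h
  exact (mul_right_cancel h).symm

theorem act_congr {γ δ : Γ} (h : D.π γ = D.π δ) : D.act γ = D.act δ := by
  obtain ⟨x, hx⟩ := (D.π_eq_one_iff (γ * δ⁻¹)).1 (by rw [map_mul, map_inv, h, mul_inv_cancel])
  rw [← inv_mul_cancel_right γ δ, ← hx, map_mul, act_t, one_mul]

theorem act_mul_apply (γ δ : Γ) (x : Fin n → ℤ) : D.act (γ * δ) x = D.act γ (D.act δ x) := by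
  rw [map_mul]; rfl

theorem act_mul_t (γ : Γ) (x : Fin n → ℤ) : D.act (γ * D.t x) = D.act γ := by
  rw [map_mul, act_t, mul_one]

theorem π_mul_t (γ : Γ) (x : Fin n → ℤ) : D.π (γ * D.t x) = D.π γ := by
  rw [map_mul, π_t, mul_one]

theorem commute_t {γ : Γ} {x : Fin n → ℤ} (h : D.act γ x = x) : Commute γ (D.t x) := by
  have := D.conj γ x
  rwa [h] at this

theorem act_eq_of_commute {γ : Γ} {x : Fin n → ℤ} (h : Commute γ (D.t x)) : D.act γ x = x := by
  have := D.conj γ x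
  rw [h.eq] at this
  exact (D.t_inj (mul_right_cancel this)).symm

theorem mul_t_pow {γ : Γ} {x : Fin n → ℤ} (h : D.act γ x = x) (k : ℕ) :
    (γ * D.t x) ^ k = γ ^ k * D.t ((k : ℤ) • x) := by
  rw [(D.commute_t h).mul_pow, t_nsmul]

theorem act_fix_of_pow {γ : Γ} {x : Fin n → ℤ} {k : ℕ} (h : γ ^ k = D.t x) : D.act γ x = x :=
  D.act_eq_of_commute (by rw [← h]; exact Commute.self_pow γ k)

theorem act_zpow_fix {γ : Γ} {x : Fin n → ℤ} (h : D.act γ x = x) (j : ℤ) :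
    D.act (γ ^ j) x = x :=
  D.act_eq_of_commute ((D.commute_t h).zpow_left j)

/-- The power of an element of `Γ` by the order of its holonomy is a translation vector which is
divisible by no prime factor of that order. -/
theorem not_dvd_of_pow_orderOf {α : Γ} {y : Fin n → ℤ}
    (hy : α ^ orderOf (D.π α) = D.t y) (hpos : 0 < orderOf (D.π α)) {p : ℕ} (hp : p.Prime)
    (hpk : p ∣ orderOf (D.π α)) (x : Fin n → ℤ) : y ≠ (p : ℤ) • x := by
  rintro rfl
  obtain ⟨l, hl⟩ := hpk
  have hx : D.act α x = x := by
    have := D.act_fix_of_pow hy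
    rw [map_smul] at this
    exact smul_right_injective _ (Int.natCast_ne_zero.2 hp.ne_zero) this
  have hx' : D.act (α ^ l) (-x) = -x := by
    have := D.act_zpow_fix hx l
    rw [zpow_natCast] at this
    rw [map_neg, this]
  have h1 : (α ^ l * D.t (-x)) ^ p = 1 := by
    rw [D.mul_t_pow hx', ← pow_mul, mul_comm l p, ← hl, hy, smul_neg, t_neg, mul_inv_cancel]
  have h2 := D.torsionFree _ p hp.pos h1
  have h3 : D.π α ^ l = 1 := by
    rw [← map_pow, ← D.π_mul_t (α ^ l) (-x), h2, map_one]
  have h4 := orderOf_dvd_of_pow_eq_one h3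
  have hl0 : 0 < l := Nat.pos_of_ne_zero (by rintro rfl; rw [mul_zero] at hl; omega)
  have h5 := Nat.le_of_dvd hl0 h4
  have := hp.two_le
  nlinarith

/-- After replacing `α` by another element with the same cyclic holonomy group, the translation
vector `α ^ k` is primitive. -/
theorem exists_primitive_pow (α : Γ) (hpos : 0 < orderOf (D.π α)) (hα : D.π α ≠ 1) :
    ∃ (α' : Γ) (w : Fin n → ℤ) (f : (Fin n → ℤ) →ₗ[ℤ] ℤ) (c j : ℤ), D.π α' = D.π α ^ j ∧
      D.π α = D.π α' ^ c ∧ α ^ orderOf (D.π α) = D.t (c • w) ∧ c ≠ 0 ∧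
      α' ^ orderOf (D.π α) = D.t w ∧ f w = 1 := by
  set k := orderOf (D.π α) with hk
  obtain ⟨y, hy⟩ := (D.π_eq_one_iff (α ^ k)).1 (by rw [map_pow, pow_orderOf_eq_one])
  have hnd : ∀ p : ℕ, p.Prime → p ∣ k → ∀ x, y ≠ (p : ℤ) • x := fun p hp hpk x =>
    D.not_dvd_of_pow_orderOf hy.symm hpos hp hpk x
  have hy0 : y ≠ 0 := by
    rintro rfl
    have hk1 : k ≠ 1 := fun h => hα (orderOf_eq_one_iff.1 h)
    exact hnd _ (Nat.minFac_prime hk1) (Nat.minFac_dvd k) 0 (by simp)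
  obtain ⟨c, w, f, hc, rfl, hf⟩ := exists_eq_smul_primitive hy0
  have hcop : IsCoprime c (k : ℤ) := by
    rw [Int.isCoprime_iff_gcd_eq_one]
    by_contra hg
    obtain ⟨p, hp, hpd⟩ := Nat.exists_prime_and_dvd hg
    have h1 : (p : ℤ) ∣ c := (Int.natCast_dvd_natCast.2 hpd).trans (Int.gcd_dvd_left ..)
    have h2 : (p : ℤ) ∣ k := (Int.natCast_dvd_natCast.2 hpd).trans (Int.gcd_dvd_right ..)
    obtain ⟨d, rfl⟩ := h1
    exact hnd p hp (Int.natCast_dvd_natCast.1 h2) (d • w) (by rw [smul_smul])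
  obtain ⟨j, i, hji⟩ := hcop
  have hji' : j * c + i * k = 1 := hji
  have hfix : D.act α w = w := by
    have := D.act_fix_of_pow hy.symm
    rw [map_smul] at this
    exact smul_right_injective _ hc this
  have hfix' : D.act (α ^ j) (i • w) = i • w := by rw [map_smul, D.act_zpow_fix hfix]
  refine ⟨α ^ j * D.t (i • w), w, f, c, j, ?_, ?_, hy.symm, hc, ?_, hf⟩
  · rw [π_mul_t, map_zpow]
  · rw [π_mul_t, map_zpow, ← zpow_mul, eq_sub_of_add_eq hji', zpow_sub,
      zpow_one, mul_comm i, zpow_mul, zpow_natCast, pow_orderOf_eq_one, one_zpow, inv_one, mul_one]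
  · rw [D.mul_t_pow hfix', ← zpow_natCast, ← zpow_mul, mul_comm j, zpow_mul, zpow_natCast, ← hy,
      ← t_zsmul, ← t_add]
    congr 1
    rw [smul_smul, smul_smul, ← add_smul, mul_comm (k : ℤ), hji, one_smul]

/-- If `s` elements of `Γ` generate the holonomy group and the translations they generate contain
a unimodular system of `s` vectors, then `Γ` has at most `n` generators. -/
theorem minGenerators_le_of_surjective {s : ℕ} (g : Fin s → Γ)
    (hπ : (Subgroup.closure (Set.range g)).map D.π = ⊤)
    (F : (Fin n → ℤ) →ₗ[ℤ] (Fin s → ℤ))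
    (hF : ∀ z, ∃ x, D.t x ∈ Subgroup.closure (Set.range g) ∧ F x = z) :
    minGenerators Γ ≤ n := by
  classical
  have hsurj : LinearMap.range F = ⊤ := LinearMap.range_eq_top.2 fun z =>
    let ⟨x, _, hx⟩ := hF z; ⟨x, hx⟩
  have hrank : Module.finrank ℤ (LinearMap.ker F) + s = n := by
    have h1 := Submodule.finrank_quotient_add_finrank (LinearMap.ker F)
    have h2 := (F.quotKerEquivOfSurjective (LinearMap.range_eq_top.1 hsurj)).finrank_eq
    rw [Module.finrank_fin_fun] at h1 h2
    omega
  let b := Module.finBasis ℤ (LinearMap.ker F)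
  let T : Finset Γ := Finset.univ.image g ∪ Finset.univ.image fun i => D.t (b i)
  have hcard : T.card ≤ n := by
    refine (Finset.card_union_le _ _).trans ?_
    have h1 := Finset.card_image_le (s := Finset.univ) (f := g)
    have h2 := Finset.card_image_le (s := Finset.univ) (f := fun i => D.t (b i : Fin n → ℤ))
    simp only [Finset.card_univ, Fintype.card_fin] at h1 h2
    omega
  unfold minGenerators
  refine le_trans (Nat.sInf_le (m := T.card) ⟨T, rfl, ?_⟩) hcard
  rw [eq_top_iff]
  have hH : Subgroup.closure (Set.range g) ≤ Subgroup.closure (T : Set Γ) :=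
    Subgroup.closure_mono (by simp [T])
  have hker : ∀ x ∈ LinearMap.ker F, D.t x ∈ Subgroup.closure (T : Set Γ) := by
    intro x hx
    have hsum : x = ∑ i, b.repr (⟨x, hx⟩ : LinearMap.ker F) i • (b i : Fin n → ℤ) := by
      have := congrArg Subtype.val (b.sum_repr ⟨x, hx⟩)
      simp only [Submodule.coe_sum, Submodule.coe_smul] at this
      exact this.symm
    rw [hsum]
    refine Finset.sum_induction _ (fun z => D.t z ∈ Subgroup.closure (T : Set Γ)) ?_ ?_ ?_
    · intro x y hx hy
      rw [t_add]; exact mul_mem hx hy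
    · rw [t_zero]; exact one_mem _
    · intro i _
      rw [t_zsmul]
      refine zpow_mem (Subgroup.subset_closure ?_) _
      simp [T]
  intro γ _
  obtain ⟨h, hh, hhγ⟩ : D.π γ ∈ (Subgroup.closure (Set.range g)).map D.π := by rw [hπ]; trivial
  obtain ⟨x, hx⟩ := (D.π_eq_one_iff (h⁻¹ * γ)).1 (by rw [map_mul, map_inv, hhγ, inv_mul_cancel])
  obtain ⟨x', hx', hFx⟩ := hF (F x)
  have hd : D.t (x - x') ∈ Subgroup.closure (T : Set Γ) :=
    hker _ (by rw [LinearMap.mem_ker, map_sub, hFx, sub_self])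
  have : γ = h * (D.t (x - x') * D.t x') := by
    rw [← t_add, sub_add_cancel, hx, mul_inv_cancel_left]
  rw [this]
  exact mul_mem (hH hh) (mul_mem hd (hH hx'))

theorem map_closure_eq_top {a b : G} (hab : Subgroup.closure {a, b} = ⊤) {H : Subgroup Γ}
    (ha : a ∈ H.map D.π) (hb : b ∈ H.map D.π) : H.map D.π = ⊤ := by
  rw [eq_top_iff, ← hab, Subgroup.closure_le]
  rintro x (rfl | rfl) <;> assumption

theorem t_smul_mem {H : Subgroup Γ} {x : Fin n → ℤ} (hx : D.t x ∈ H) (m : ℤ) :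
    D.t (m • x) ∈ H := by
  rw [t_zsmul]; exact zpow_mem hx m

theorem t_add_mem {H : Subgroup Γ} {x y : Fin n → ℤ} (hx : D.t x ∈ H) (hy : D.t y ∈ H) :
    D.t (x + y) ∈ H := by
  rw [t_add]; exact mul_mem hx hy

theorem t_act_mem {H : Subgroup Γ} {γ : Γ} {x : Fin n → ℤ} (hγ : γ ∈ H) (hx : D.t x ∈ H) :
    D.t (D.act γ x) ∈ H := by
  rw [← mul_inv_cancel_right (D.t (D.act γ x)) γ, ← D.conj]
  exact mul_mem (mul_mem hγ hx) (inv_mem hγ)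

theorem minGenerators_le_of_pair (g : Fin 2 → Γ)
    (hπ : (Subgroup.closure (Set.range g)).map D.π = ⊤) {x₁ x₂ : Fin n → ℤ}
    (h₁ : D.t x₁ ∈ Subgroup.closure (Set.range g)) (h₂ : D.t x₂ ∈ Subgroup.closure (Set.range g))
    {f₁ f₂ : (Fin n → ℤ) →ₗ[ℤ] ℤ} (h11 : f₁ x₁ = 1) (h21 : f₂ x₁ = 0) (h22 : f₂ x₂ = 1) :
    minGenerators Γ ≤ n := by
  refine D.minGenerators_le_of_surjective g hπ (LinearMap.pi ![f₁, f₂]) fun z =>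
    ⟨(z 0 - z 1 * f₁ x₂) • x₁ + z 1 • x₂,
      D.t_add_mem (D.t_smul_mem h₁ _) (D.t_smul_mem h₂ _), ?_⟩
  ext i
  fin_cases i
  · change f₁ _ = z 0
    simp only [map_add, map_smul, smul_eq_mul, h11]; ring
  · change f₂ _ = z 1
    simp only [map_add, map_smul, smul_eq_mul, h21, h22]; ring

theorem minGenerators_le_of_triple (g : Fin 3 → Γ)
    (hπ : (Subgroup.closure (Set.range g)).map D.π = ⊤) {x₁ x₂ x₃ : Fin n → ℤ}
    (h₁ : D.t x₁ ∈ Subgroup.closure (Set.range g)) (h₂ : D.t x₂ ∈ Subgroup.closure (Set.range g))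
    (h₃ : D.t x₃ ∈ Subgroup.closure (Set.range g))
    {f₁ f₂ f₃ : (Fin n → ℤ) →ₗ[ℤ] ℤ} (h11 : f₁ x₁ = 1) (h21 : f₂ x₁ = 0) (h22 : f₂ x₂ = 1)
    (h31 : f₃ x₁ = 0) (h32 : f₃ x₂ = 0) (h33 : f₃ x₃ = 1) :
    minGenerators Γ ≤ n := by
  refine D.minGenerators_le_of_surjective g hπ (LinearMap.pi ![f₁, f₂, f₃]) fun z =>
    ⟨(z 0 - (z 1 - z 2 * f₂ x₃) * f₁ x₂ - z 2 * f₁ x₃) • x₁ + (z 1 - z 2 * f₂ x₃) • x₂ + z 2 • x₃,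
      D.t_add_mem (D.t_add_mem (D.t_smul_mem h₁ _) (D.t_smul_mem h₂ _)) (D.t_smul_mem h₃ _), ?_⟩
  ext i
  fin_cases i
  · change f₁ _ = z 0
    simp only [map_add, map_smul, smul_eq_mul, h11]; ring
  · change f₂ _ = z 1
    simp only [map_add, map_smul, smul_eq_mul, h21, h22]; ring
  · change f₃ _ = z 2
    simp only [map_add, map_smul, smul_eq_mul, h31, h32, h33]; ring

theorem mem_map_closure {s : ℕ} (g : Fin s → Γ) (i : Fin s) :
    D.π (g i) ∈ (Subgroup.closure (Set.range g)).map D.π :=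
  ⟨g i, Subgroup.subset_closure ⟨i, rfl⟩, rfl⟩

/-- The case of cyclic holonomy. -/
theorem minGenerators_le_of_cyclic (D : BieberbachData n Γ G) [Finite G] {a : G} (ha : Subgroup.closure {a} = ⊤) :
    minGenerators Γ ≤ n := by
  obtain ⟨α, rfl⟩ := D.π_surj a
  by_cases hα : D.π α = 1
  · have hG : ∀ x : G, x = 1 := fun x => by
      have : x ∈ Subgroup.closure {D.π α} := by rw [ha]; trivial
      rw [hα, Subgroup.closure_singleton_one] at this
      exact this
    refine D.minGenerators_le_of_surjective (s := 0) Fin.elim0 ?_ 0 fun z =>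
      ⟨0, by rw [t_zero]; exact one_mem _, Subsingleton.elim _ _⟩
    rw [eq_top_iff]
    intro x _
    rw [hG x]
    exact one_mem _
  · obtain ⟨α', w, f, c, j, hj, hc, -, -, hw, hf⟩ :=
      D.exists_primitive_pow α (orderOf_pos _) hα
    refine D.minGenerators_le_of_surjective (s := 1) ![α'] ?_ (LinearMap.pi ![f]) fun z =>
      ⟨z 0 • w, D.t_smul_mem ?_ _, ?_⟩
    · rw [eq_top_iff, ← ha, Subgroup.closure_le, Set.singleton_subset_iff, hc]
      exact zpow_mem (D.mem_map_closure ![α'] 0) c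
    · rw [← hw]
      exact pow_mem (Subgroup.subset_closure (Set.mem_range_self (f := ![α']) 0)) _
    · ext i
      fin_cases i
      change f _ = z 0
      rw [map_smul, hf, smul_eq_mul, mul_one]

/-- The case in which one of the two generators of the holonomy group has order at least `3`. -/
theorem minGenerators_le_of_sq_ne_one [Finite G] {α β : Γ}
    (hab : Subgroup.closure {D.π α, D.π β} = ⊤) (h2 : D.π α ^ 2 ≠ 1) :
    minGenerators Γ ≤ n := by
  have hpos : 0 < orderOf (D.π α) := orderOf_pos _
  have hα : D.π α ≠ 1 := fun h => h2 (by rw [h, one_pow])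
  obtain ⟨α', w, f₁, c, j, hj, hc, -, -, hw, hf₁⟩ := D.exists_primitive_pow α hpos hα
  set k := orderOf (D.π α)
  set a := D.act α' with ha
  have hak : a ^ k = 1 := by rw [ha, ← map_pow, hw, act_t]
  have haw : a w = w := D.act_fix_of_pow hw
  have ha2 : a * a - 1 ≠ 0 := fun h => h2 (by
    have h1 : D.act (α' ^ 2) = 1 := by rw [map_pow, pow_two]; exact sub_eq_zero.1 h
    have h3 := D.faithful _ h1
    rw [map_pow] at h3
    rw [hc, ← zpow_natCast, ← zpow_mul, mul_comm, zpow_mul, zpow_natCast, h3, one_zpow])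
  set φ : Module.End ℤ (Fin n → ℤ) := a * a - 1 with hφ
  have hφx : ∀ x, φ x = a (a x) - x := fun x => rfl
  have hφa : ∀ x, φ (a x) = a (φ x) := fun x => by rw [hφx, hφx, map_sub]
  have hpowk : ∀ x, (a ^ k) x = x := fun x => by rw [hak]; rfl
  have hinj : ∀ x, φ (φ x) = 0 → φ x = 0 := by
    intro x hx
    have hy : a (a (φ x)) = φ x := sub_eq_zero.1 hx
    have hit : ∀ m : ℕ, (a ^ (2 * m)) x = x + (m : ℤ) • φ x := by
      intro m
      induction m with
      | zero => simp
      | succ m ih =>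
        have hxx : a (a x) = x + φ x := by rw [hφx]; abel
        rw [mul_add, mul_one, add_comm (2 * m) 2, pow_add, Module.End.mul_apply, ih, pow_two,
          Module.End.mul_apply, map_add, map_add, hxx, map_smul, map_smul, hy]
        push_cast
        module
    have h1 := hit k
    rw [mul_comm, pow_mul, hak, one_pow, Module.End.one_apply, left_eq_add] at h1
    exact (smul_eq_zero.1 h1).resolve_left (by exact_mod_cast hpos.ne')
  have hmaps : ∀ x ∈ LinearMap.range φ, a x ∈ LinearMap.range φ := by
    rintro _ ⟨x, rfl⟩
    exact ⟨a x, hφa x⟩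
  have : Nontrivial (LinearMap.range φ) := by
    rw [Submodule.nontrivial_iff_ne_bot]
    exact fun h => ha2 (LinearMap.range_eq_bot.1 h)
  obtain ⟨⟨_, v, rfl⟩, f₂, f₃, h22, h32, h33⟩ :=
    exists_unimodular_orbit (a.restrict hmaps) hpos (by
      refine LinearMap.ext fun x => Subtype.ext ?_
      rw [Module.End.pow_restrict]
      exact hpowk x) (by
      rintro ⟨_, x, rfl⟩ hx
      refine Subtype.ext (hinj x ?_)
      have h1 : a (a (φ x)) = φ x := congrArg Subtype.val hx
      rw [hφx, h1, sub_self])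
  have hw0 : φ.rangeRestrict w = 0 := Subtype.ext (by
    change φ w = 0
    rw [hφx, haw, haw, sub_self])
  let g : Fin 3 → Γ := ![α', β, D.t v]
  have hv : D.t v ∈ Subgroup.closure (Set.range g) := Subgroup.subset_closure ⟨2, rfl⟩
  have hα' : α' ∈ Subgroup.closure (Set.range g) := Subgroup.subset_closure ⟨0, rfl⟩
  refine D.minGenerators_le_of_triple g (D.map_closure_eq_top hab ?_ (D.mem_map_closure g 1))
    (x₁ := w) (x₂ := v) (x₃ := a v) (hw ▸ pow_mem hα' k) hv (D.t_act_mem hα' hv)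
    (f₁ := f₁) (f₂ := f₂ ∘ₗ φ.rangeRestrict) (f₃ := f₃ ∘ₗ φ.rangeRestrict) hf₁ ?_ h22 ?_ h32 ?_
  · rw [hc]
    exact zpow_mem (D.mem_map_closure g 0) c
  · rw [LinearMap.comp_apply, hw0, map_zero]
  · rw [LinearMap.comp_apply, hw0, map_zero]
  · rw [LinearMap.comp_apply, ← h33]
    congr 1
    exact Subtype.ext (hφa v)

theorem smul_two_cancel {x y : Fin n → ℤ} (h : (2 : ℤ) • x = (2 : ℤ) • y) : x = y :=
  smul_right_injective _ (two_ne_zero) h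

theorem act_act {α : Γ} (h : D.π α ^ 2 = 1) (x : Fin n → ℤ) : D.act α (D.act α x) = x := by
  rw [← act_mul_apply, D.act_congr (δ := 1) (by rw [map_mul, ← pow_two, h, map_one]), map_one]
  rfl

theorem exists_sq {α : Γ} (h : D.π α ^ 2 = 1) : ∃ x, α ^ 2 = D.t x := by
  obtain ⟨x, hx⟩ := (D.π_eq_one_iff (α ^ 2)).1 (by rw [map_pow, h])
  exact ⟨x, hx.symm⟩

theorem orderOf_eq_two {α : Γ} (hα : D.π α ≠ 1) (h : D.π α ^ 2 = 1) : orderOf (D.π α) = 2 :=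
  orderOf_eq_prime h hα

theorem sq_ne_two_smul {α : Γ} (hα : D.π α ≠ 1) (h : D.π α ^ 2 = 1) {x : Fin n → ℤ}
    (hx : α ^ 2 = D.t x) (l : Fin n → ℤ) : x ≠ (2 : ℤ) • l :=
  D.not_dvd_of_pow_orderOf (α := α) (by rw [D.orderOf_eq_two hα h, hx])
    (by rw [D.orderOf_eq_two hα h]; norm_num) Nat.prime_two (by rw [D.orderOf_eq_two hα h]) l

theorem exists_primitive_sq {α : Γ} (hα : D.π α ≠ 1) (h : D.π α ^ 2 = 1) :
    ∃ (α' : Γ) (w : Fin n → ℤ) (f : (Fin n → ℤ) →ₗ[ℤ] ℤ) (c : ℤ), D.π α' = D.π α ∧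
      α ^ 2 = D.t (c • w) ∧ c ≠ 0 ∧ α' ^ 2 = D.t w ∧ f w = 1 := by
  have h2 := D.orderOf_eq_two hα h
  obtain ⟨α', w, f, c, j, hj, hc, hcw, hc0, hw, hf⟩ :=
    D.exists_primitive_pow α (by rw [h2]; norm_num) hα
  rw [h2] at hcw hw
  refine ⟨α', w, f, c, ?_, hcw, hc0, hw, hf⟩
  have hz : D.π α ^ (2 : ℤ) = 1 := by exact_mod_cast h
  rcases Int.even_or_odd' j with ⟨m, rfl | rfl⟩
  · rw [zpow_mul, hz, one_zpow] at hj
    rw [hj, one_zpow] at hc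
    exact absurd hc hα
  · rw [hj, zpow_add, zpow_mul, hz, one_zpow, one_mul, zpow_one]

theorem sq_mul_t {β : Γ} {y u : Fin n → ℤ} (hy : β ^ 2 = D.t y) (hu : D.act β u = u) :
    (β * D.t u) ^ 2 = D.t (y + (2 : ℤ) • u) := by
  rw [D.mul_t_pow hu, hy, t_add]; rfl

/-- The case in which a generating involution acts nontrivially on the lattice modulo `2`. -/
theorem minGenerators_le_of_involution_ne {α β : Γ}
    (hab : Subgroup.closure {D.π α, D.π β} = ⊤) (hα : D.π α ≠ 1) (h2 : D.π α ^ 2 = 1)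
    {v₀ : Fin n → ℤ} (hv₀ : ∀ l, v₀ + D.act α v₀ ≠ (2 : ℤ) • l) :
    minGenerators Γ ≤ n := by
  obtain ⟨α', w, f₁, -, hπ, -, -, hw, hf₁⟩ := D.exists_primitive_sq hα h2
  rw [← D.act_congr hπ] at hv₀
  rw [← hπ] at hab hα h2
  clear hπ α
  set a := D.act α' with ha
  have haa : ∀ x, a (a x) = x := D.act_act h2
  have haw : a w = w := D.act_fix_of_pow hw
  let φ : Module.End ℤ (Fin n → ℤ) := a - 1
  have hφx : ∀ x, φ x = a x - x := fun x => rfl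
  let b := Module.finBasis ℤ (LinearMap.range φ)
  choose e he using fun i => (b i).2
  obtain ⟨i, hi⟩ : ∃ i, ∀ l, e i + a (e i) ≠ (2 : ℤ) • l := by
    by_contra! hcon
    choose l hl using hcon
    have hdec : φ v₀ = φ (∑ i, b.repr (φ.rangeRestrict v₀) i • e i) := by
      have h := congrArg Subtype.val (b.sum_repr (φ.rangeRestrict v₀))
      rw [map_sum]
      simp only [map_smul, he]
      simp only [Submodule.coe_sum, Submodule.coe_smul] at h
      exact h.symm
    set s := ∑ i, b.repr (φ.rangeRestrict v₀) i • e i with hs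
    have hsl : s + a s = (2 : ℤ) • ∑ i, b.repr (φ.rangeRestrict v₀) i • l i := by
      rw [hs, map_sum, ← Finset.sum_add_distrib, Finset.smul_sum]
      refine Finset.sum_congr rfl fun i _ => ?_
      rw [map_smul, ← smul_add, hl, smul_comm]
    refine hv₀ (v₀ - s + ∑ i, b.repr (φ.rangeRestrict v₀) i • l i) ?_
    rw [smul_add, ← hsl]
    rw [hφx, hφx] at hdec
    have : a v₀ = v₀ + (a s - s) := by rw [← hdec]; abel
    rw [this]
    module
  set v := e i with hv
  set f₃ : (Fin n → ℤ) →ₗ[ℤ] ℤ := b.coord i ∘ₗ φ.rangeRestrict with hf₃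
  have h33 : f₃ v = 1 := by
    have : φ.rangeRestrict v = b i := Subtype.ext (he i)
    rw [hf₃, LinearMap.comp_apply, this]
    simp
  have h3fix : ∀ x, a x = x → f₃ x = 0 := fun x hx => by
    have : φ.rangeRestrict x = 0 := Subtype.ext (by
      change φ x = 0
      rw [hφx, hx, sub_self])
    rw [hf₃, LinearMap.comp_apply, this, map_zero]
  have hyfix : a (v + a v) = v + a v := by rw [map_add, haa, add_comm]
  have hwne : ∀ u, w ≠ u + a u := by
    rintro u rfl
    have h1 : (D.t (-u) * α') ^ 2 = 1 := by
      calc (D.t (-u) * α') ^ 2 = D.t (-u) * (α' * D.t (-u)) * α' := by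
            rw [pow_two]; simp only [mul_assoc]
        _ = D.t (-u) * D.t (a (-u)) * α' ^ 2 := by
            rw [D.conj, pow_two]; simp only [mul_assoc]; rfl
        _ = 1 := by
            rw [hw, ← t_add, ← t_add, ← D.t_zero, map_neg]
            congr 1
            abel
    have h3 := D.torsionFree _ 2 (by norm_num) h1
    apply hα
    rw [eq_inv_of_mul_eq_one_right h3, map_inv, π_t, inv_one]
  obtain ⟨u, c, p, q, f₂, hc, hu, h21, h22⟩ := exists_unimodular_adjust hf₁ (y := v + a v) (by
    intro l m hlm
    rcases Int.even_or_odd' m with ⟨r, rfl | rfl⟩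
    · exact hi (l + r • w) (by rw [hlm]; module)
    · have h2l : (2 : ℤ) • (l + r • w) = v + a v - w := by rw [hlm]; module
      have hlf : a (l + r • w) = l + r • w := smul_two_cancel (by
        rw [← map_smul, h2l, map_sub, hyfix, haw])
      refine hwne (v - (l + r • w)) ?_
      rw [map_sub, hlf]
      have : w = v + a v - (2 : ℤ) • (l + r • w) := by rw [h2l]; abel
      conv_lhs => rw [this]
      module)
  have hau : a u = u := smul_right_injective _ hc (by
    change c • a u = c • u
    rw [← map_smul, hu, map_add, map_smul, map_smul, hyfix, haw])
  let g : Fin 3 → Γ := ![α', β, D.t (v + u)]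
  have hvm : D.t (v + u) ∈ Subgroup.closure (Set.range g) := Subgroup.subset_closure ⟨2, rfl⟩
  have hα' : α' ∈ Subgroup.closure (Set.range g) := Subgroup.subset_closure ⟨0, rfl⟩
  have hsum : v + a v + (2 : ℤ) • u = (v + u) + a (v + u) := by rw [map_add, hau]; module
  refine D.minGenerators_le_of_triple g
    (D.map_closure_eq_top hab (D.mem_map_closure g 0) (D.mem_map_closure g 1))
    (hw ▸ pow_mem hα' 2) (hsum ▸ D.t_add_mem hvm (D.t_act_mem hα' hvm)) hvm hf₁ h21 h22
    (h3fix w haw) (h3fix _ ?_) (f₃ := f₃) ?_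
  · rw [map_add, hyfix, map_smul, hau]
  · rw [map_add, h33, h3fix u hau, add_zero]

/-- Commuting involutions `a`, `b`, where `a` acts trivially modulo `2` and the square of a lift
of `b` has odd component in the `-1` eigenlattice of `a`. -/
theorem minGenerators_le_of_odd_component {α β : Γ}
    (hab : Subgroup.closure {D.π α, D.π β} = ⊤) (hα : D.π α ≠ 1) (hα2 : D.π α ^ 2 = 1)
    (hcomm : D.π α * D.π β = D.π β * D.π α)
    (heven : ∀ x, ∃ u, x + D.act α x = (2 : ℤ) • u) {y : Fin n → ℤ} (hy : β ^ 2 = D.t y)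
    (hodd : ∀ q, y - D.act α y ≠ (4 : ℤ) • q) :
    minGenerators Γ ≤ n := by
  obtain ⟨α', w, f₁, -, hπ, -, -, hw, hf₁⟩ := D.exists_primitive_sq hα hα2
  rw [← D.act_congr hπ] at hodd heven
  rw [← hπ] at hab hα hα2 hcomm
  clear hπ α
  set a := D.act α' with ha
  set b := D.act β with hb
  have haa : ∀ x, a (a x) = x := D.act_act hα2
  have hab' : ∀ x, a (b x) = b (a x) := fun x => by
    rw [ha, hb, ← act_mul_apply, ← act_mul_apply,
      D.act_congr (γ := α' * β) (δ := β * α') (by rw [map_mul, map_mul, hcomm])]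
  have haw : a w = w := D.act_fix_of_pow hw
  have hby : b y = y := D.act_fix_of_pow hy
  obtain ⟨e, he⟩ := exists_half (φ := (1 - a : Module.End ℤ (Fin n → ℤ))) fun x => by
    obtain ⟨u, hu⟩ := heven x
    refine ⟨x - u, ?_⟩
    rw [smul_sub, ← hu]
    change x - a x = _
    module
  replace he : ∀ x, x - a x = (2 : ℤ) • e x := he
  have hey : e y ≠ 0 := fun h => hodd 0 (by rw [he, h]; simp)
  obtain ⟨c, w', f, hc, hw', hf⟩ := exists_eq_smul_primitive hey
  have hcodd : ¬ (2 : ℤ) ∣ c := by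
    rintro ⟨k, rfl⟩
    refine hodd (k • w') ?_
    rw [he, hw']; module
  obtain ⟨m, hm⟩ : ∃ m, c + 2 * m = 1 := ⟨(1 - c) / 2, by omega⟩
  have hew' : e w' = w' := by
    have h1 : a (e y) = -e y := smul_two_cancel (by
      rw [← map_smul, ← he, map_sub, haa, smul_neg, ← he]; abel)
    have h2 : a w' = -w' := smul_right_injective _ hc (by
      change c • a w' = c • -w'
      rw [← map_smul, ← hw', h1, smul_neg, ← hw'])
    exact smul_two_cancel (by rw [← he, h2]; module)
  have hbw' : b w' = w' := by
    have h1 : b (e y) = e y := smul_two_cancel (by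
      rw [← map_smul, ← he, map_sub, ← hab', hby])
    exact smul_right_injective _ hc (by
      change c • b w' = c • w'
      rw [← map_smul, ← hw', h1])
  have hew : e w = 0 := smul_two_cancel (by rw [← he, haw]; simp)
  have hu : D.act β (m • w') = m • w' := by rw [map_smul, ← hb, hbw']
  let g : Fin 2 → Γ := ![α', β * D.t (m • w')]
  refine D.minGenerators_le_of_pair g
    (D.map_closure_eq_top hab (D.mem_map_closure g 0) ?_) (x₁ := w) (x₂ := y + (2 : ℤ) • m • w')
    (hw ▸ pow_mem (Subgroup.subset_closure (Set.mem_range_self (f := g) 0)) 2)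
    (D.sq_mul_t hy hu ▸ pow_mem (Subgroup.subset_closure (Set.mem_range_self (f := g) 1)) 2)
    (f₁ := f₁) (f₂ := f ∘ₗ e) hf₁ ?_ ?_
  · rw [← D.π_mul_t β (m • w')]
    exact D.mem_map_closure g 1
  · rw [LinearMap.comp_apply, hew, map_zero]
  · rw [LinearMap.comp_apply, map_add, map_smul, map_smul, hew', hw', smul_smul, ← add_smul, hm,
      one_smul, hf]

/-- Involutions `a`, `b` having lifts whose squares are invariant and independent modulo `2`. -/
theorem minGenerators_le_of_invariant_squares {α β : Γ}
    (hab : Subgroup.closure {D.π α, D.π β} = ⊤) (hα : D.π α ≠ 1) (hβ : D.π β ≠ 1)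
    (hα2 : D.π α ^ 2 = 1) (hβ2 : D.π β ^ 2 = 1) {x y : Fin n → ℤ} (hx : α ^ 2 = D.t x)
    (hy : β ^ 2 = D.t y) (hbx : D.act β x = x) (hxy : ∀ l, x - y ≠ (2 : ℤ) • l) :
    minGenerators Γ ≤ n := by
  obtain ⟨α', w, f₁, c, hπ, hcw, hc, hw, hf₁⟩ := D.exists_primitive_sq hα hα2
  obtain rfl : x = c • w := D.t_inj (hx.symm.trans hcw)
  have hcodd : ¬ (2 : ℤ) ∣ c := by
    rintro ⟨k, rfl⟩
    exact D.sq_ne_two_smul hα hα2 hx (k • w) (by rw [smul_smul])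
  have hbw : D.act β w = w := smul_right_injective _ hc (by
    change c • D.act β w = c • w
    rw [← map_smul, hbx])
  have hby : D.act β y = y := D.act_fix_of_pow hy
  obtain ⟨u, d, p, q, f₂, hd, hu, h21, h22⟩ := exists_unimodular_adjust hf₁ (y := y) (by
    intro l m hlm
    by_cases hm : (2 : ℤ) ∣ m
    · obtain ⟨r, rfl⟩ := hm
      exact D.sq_ne_two_smul hβ hβ2 hy (l + r • w) (by rw [hlm]; module)
    · obtain ⟨r, hr⟩ : ∃ r, c - m = 2 * r := ⟨(c - m) / 2, by omega⟩
      refine hxy (r • w - l) ?_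
      rw [hlm, smul_sub, smul_smul, ← hr]; module)
  have hbu : D.act β u = u := smul_right_injective _ hd (by
    change d • D.act β u = d • u
    rw [← map_smul, hu, map_add, map_smul, map_smul, hby, hbw])
  let g : Fin 2 → Γ := ![α', β * D.t u]
  refine D.minGenerators_le_of_pair g
    (D.map_closure_eq_top hab ?_ ?_) (x₁ := w) (x₂ := y + (2 : ℤ) • u)
    (hw ▸ pow_mem (Subgroup.subset_closure (Set.mem_range_self (f := g) 0)) 2)
    (D.sq_mul_t hy hbu ▸ pow_mem (Subgroup.subset_closure (Set.mem_range_self (f := g) 1)) 2) hf₁ h21 h22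
  · rw [← hπ]
    exact D.mem_map_closure g 0
  · rw [← D.π_mul_t β u]
    exact D.mem_map_closure g 1

/-- A lift of `a` whose square has even component in the `-1` eigenlattice of `b` can be changed
so that its square is fixed by `b`. -/
theorem exists_lift_sq_fixed {α β : Γ} (hβ2 : D.π β ^ 2 = 1)
    (hcomm : D.π α * D.π β = D.π β * D.π α) {x q : Fin n → ℤ} (hx : α ^ 2 = D.t x)
    (hq : x - D.act β x = (4 : ℤ) • q) :
    ∃ (α' : Γ) (x' : Fin n → ℤ), D.π α' = D.π α ∧ α' ^ 2 = D.t x' ∧ D.act β x' = x' := by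
  have h4 : ∀ z z' : Fin n → ℤ, (4 : ℤ) • z = (4 : ℤ) • z' → z = z' := fun z z' h =>
    smul_right_injective _ (by norm_num : (4 : ℤ) ≠ 0) h
  have hax : D.act α x = x := D.act_fix_of_pow hx
  have hab : ∀ z, D.act α (D.act β z) = D.act β (D.act α z) := fun z => by
    rw [← act_mul_apply, ← act_mul_apply,
      D.act_congr (γ := α * β) (δ := β * α) (by rw [map_mul, map_mul, hcomm])]
  have haq : D.act α (-q) = -q := by
    rw [map_neg]
    congr 1
    exact h4 _ _ (by rw [← map_smul, ← hq, map_sub, hab, hax])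
  have hbq : D.act β q = -q := h4 _ _ (by
    rw [← map_smul, ← hq, map_sub, D.act_act hβ2, smul_neg, ← hq]; abel)
  refine ⟨α * D.t (-q), x + (2 : ℤ) • -q, D.π_mul_t _ _, D.sq_mul_t hx haq, ?_⟩
  have hbx : D.act β x = x - (4 : ℤ) • q := by rw [← hq]; abel
  rw [map_add, map_smul, map_neg, hbq, hbx]
  module

/-- The case in which the holonomy group is generated by two commuting involutions acting
trivially on the lattice modulo `2`. -/
theorem minGenerators_le_of_even_involutions {α β : Γ}
    (hab : Subgroup.closure {D.π α, D.π β} = ⊤) (hα : D.π α ≠ 1) (hβ : D.π β ≠ 1)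
    (hαβ : D.π α * D.π β ≠ 1) (hα2 : D.π α ^ 2 = 1) (hβ2 : D.π β ^ 2 = 1)
    (hαβ2 : (D.π α * D.π β) ^ 2 = 1)
    (hevenα : ∀ x, ∃ u, x + D.act α x = (2 : ℤ) • u)
    (hevenβ : ∀ x, ∃ u, x + D.act β x = (2 : ℤ) • u) :
    minGenerators Γ ≤ n := by
  have hcomm : D.π α * D.π β = D.π β * D.π α := by
    rw [pow_two] at hα2 hβ2 hαβ2
    rw [eq_inv_of_mul_eq_one_left hαβ2, mul_inv_rev, ← eq_inv_of_mul_eq_one_left hα2,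
      ← eq_inv_of_mul_eq_one_left hβ2]
  obtain ⟨x, hx⟩ := D.exists_sq hα2
  obtain ⟨y, hy⟩ := D.exists_sq hβ2
  by_cases hoddy : ∀ q, y - D.act α y ≠ (4 : ℤ) • q
  · exact D.minGenerators_le_of_odd_component hab hα hα2 hcomm hevenα hy hoddy
  by_cases hoddx : ∀ q, x - D.act β x ≠ (4 : ℤ) • q
  · exact D.minGenerators_le_of_odd_component (by rwa [Set.pair_comm]) hβ hβ2 hcomm.symm hevenβ
      hx hoddx
  push Not at hoddx hoddy
  obtain ⟨q, hq⟩ := hoddx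
  obtain ⟨r, hr⟩ := hoddy
  obtain ⟨α₁, x₁, hπα, hx₁, hbx⟩ := D.exists_lift_sq_fixed hβ2 hcomm hx hq
  obtain ⟨β₁, y₁, hπβ, hy₁, hay⟩ := D.exists_lift_sq_fixed hα2 hcomm.symm hy hr
  rw [← D.act_congr hπα] at hay hevenα
  rw [← D.act_congr hπβ] at hbx hevenβ
  rw [← hπα, ← hπβ] at hab hcomm hαβ hαβ2
  rw [← hπα] at hα hα2
  rw [← hπβ] at hβ hβ2
  by_cases hxy : ∀ l, x₁ - y₁ ≠ (2 : ℤ) • l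
  · exact D.minGenerators_le_of_invariant_squares hab hα hβ hα2 hβ2 hx₁ hy₁ hbx hxy
  push Not at hxy
  obtain ⟨l, hl⟩ := hxy
  have hax : D.act α₁ x₁ = x₁ := D.act_fix_of_pow hx₁
  obtain ⟨c, hc⟩ := (D.π_eq_one_iff (α₁ * β₁ * (β₁ * α₁)⁻¹)).1 (by
    rw [map_mul, map_inv, map_mul, map_mul, hcomm, mul_inv_cancel])
  have hc₁ : α₁ * β₁ = D.t c * (β₁ * α₁) := by rw [hc, inv_mul_cancel_right]
  have hc₂ : β₁ * α₁ = D.t (-c) * (α₁ * β₁) := by rw [hc₁, t_neg, inv_mul_cancel_left]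
  have hz : (α₁ * β₁) ^ 2 = D.t (c + x₁ + y₁) :=
    calc (α₁ * β₁) ^ 2 = D.t c * (β₁ * α₁) * (α₁ * β₁) := by rw [pow_two, ← hc₁]
      _ = D.t c * (β₁ * α₁ ^ 2) * β₁ := by simp only [pow_two, mul_assoc]
      _ = D.t c * D.t x₁ * β₁ ^ 2 := by rw [hx₁, D.conj, hbx]; simp only [pow_two, mul_assoc]
      _ = D.t (c + x₁ + y₁) := by rw [hy₁, t_add, t_add]
  have hac : D.act α₁ c = -c := by
    have h1 : D.t x₁ * β₁ = D.t (-c + D.act α₁ (-c) + x₁) * β₁ :=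
      calc D.t x₁ * β₁ = β₁ * α₁ * α₁ := by
            rw [mul_assoc, ← pow_two, hx₁, D.conj, hbx]
        _ = D.t (-c) * (α₁ * (β₁ * α₁)) := by
            conv_lhs => rw [hc₂]
            simp only [mul_assoc]
        _ = D.t (-c) * (α₁ * D.t (-c)) * (α₁ * β₁) := by
            conv_lhs => rw [hc₂]
            simp only [mul_assoc]
        _ = D.t (-c) * D.t (D.act α₁ (-c)) * α₁ ^ 2 * β₁ := by
            rw [D.conj]; simp only [pow_two, mul_assoc]
        _ = _ := by rw [hx₁, ← t_add, ← t_add]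
    have h2 := D.t_inj (mul_right_cancel h1)
    rw [right_eq_add, map_neg] at h2
    rw [eq_neg_iff_add_eq_zero, ← neg_eq_zero, ← h2]
    abel
  have hπz : D.π (α₁ * β₁) = D.π α₁ * D.π β₁ := map_mul _ _ _
  refine D.minGenerators_le_of_odd_component (α := α₁) (β := α₁ * β₁) ?_ hα hα2 ?_ hevenα hz ?_
  · rw [eq_top_iff, ← hab, Subgroup.closure_le]
    have h1 : D.π α₁ ∈ Subgroup.closure {D.π α₁, D.π (α₁ * β₁)} :=
      Subgroup.subset_closure (Set.mem_insert _ _)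
    have h2 : D.π (α₁ * β₁) ∈ Subgroup.closure {D.π α₁, D.π (α₁ * β₁)} :=
      Subgroup.subset_closure (Set.mem_insert_of_mem _ rfl)
    rintro g (rfl | rfl)
    · exact h1
    · have := mul_mem (inv_mem h1) h2
      rwa [hπz, inv_mul_cancel_left, ← hπz] at this
  · rw [hπz, mul_assoc, ← hcomm]
  · intro s hs
    refine D.sq_ne_two_smul (by rwa [hπz]) (by rwa [hπz]) hz (s + l + y₁) ?_
    have h2c : c = (2 : ℤ) • s := smul_two_cancel (by
      rw [smul_smul]
      change _ = (4 : ℤ) • s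
      rw [← hs, map_add, map_add, hac, hax, hay]; module)
    have hx' : x₁ = (2 : ℤ) • l + y₁ := by rw [← hl]; abel
    rw [h2c, hx']; module

/-- A Bieberbach group of dimension `n` with two-generated holonomy has at most `n` generators. -/
theorem minGenerators_le (D : BieberbachData n Γ G) [Finite G] {a b : G} (hab : Subgroup.closure {a, b} = ⊤) :
    minGenerators Γ ≤ n := by
  obtain ⟨α, rfl⟩ := D.π_surj a
  obtain ⟨β, rfl⟩ := D.π_surj b
  have hba : Subgroup.closure {D.π β, D.π α} = ⊤ := by rwa [Set.pair_comm]
  have habb : Subgroup.closure {D.π (α * β), D.π β} = ⊤ := by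
    rw [eq_top_iff, ← hab, Subgroup.closure_le]
    have h1 : D.π (α * β) ∈ Subgroup.closure {D.π (α * β), D.π β} :=
      Subgroup.subset_closure (Set.mem_insert _ _)
    have h2 : D.π β ∈ Subgroup.closure {D.π (α * β), D.π β} :=
      Subgroup.subset_closure (Set.mem_insert_of_mem _ rfl)
    rintro g (rfl | rfl)
    · have := mul_mem h1 (inv_mem h2)
      rwa [map_mul, mul_inv_cancel_right, ← map_mul] at this
    · exact h2
  have hcyc : ∀ {x y : G}, Subgroup.closure {x, y} = ⊤ → x = 1 → Subgroup.closure {y} = ⊤ := by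
    rintro x y h rfl
    rwa [Subgroup.closure_insert_one] at h
  by_cases hα2 : D.π α ^ 2 = 1
  swap; · exact D.minGenerators_le_of_sq_ne_one hab hα2
  by_cases hβ2 : D.π β ^ 2 = 1
  swap; · exact D.minGenerators_le_of_sq_ne_one hba hβ2
  by_cases hαβ2 : D.π (α * β) ^ 2 = 1
  swap; · exact D.minGenerators_le_of_sq_ne_one habb hαβ2
  by_cases hα : D.π α = 1
  · exact D.minGenerators_le_of_cyclic (hcyc hab hα)
  by_cases hβ : D.π β = 1
  · exact D.minGenerators_le_of_cyclic (hcyc hba hβ)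
  by_cases hαβ : D.π (α * β) = 1
  · exact D.minGenerators_le_of_cyclic (hcyc habb hαβ)
  by_cases hevenα : ∀ x, ∃ u, x + D.act α x = (2 : ℤ) • u
  swap
  · push Not at hevenα
    obtain ⟨v, hv⟩ := hevenα
    exact D.minGenerators_le_of_involution_ne hab hα hα2 hv
  by_cases hevenβ : ∀ x, ∃ u, x + D.act β x = (2 : ℤ) • u
  swap
  · push Not at hevenβ
    obtain ⟨v, hv⟩ := hevenβ
    exact D.minGenerators_le_of_involution_ne hba hβ hβ2 hv
  rw [map_mul] at hαβ hαβ2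
  exact D.minGenerators_le_of_even_involutions hab hα hβ hαβ hα2 hβ2 hαβ2 hevenα hevenβ

end BieberbachData

/-- The lattice action attached to an extension of a finite group by `ℤⁿ`. -/
theorem exists_conjugation_action {n : ℕ} {Γ : Type*} [Group Γ]
    (ι : Multiplicative (Fin n → ℤ) →* Γ) (hι : Function.Injective ι) (hn : ι.range.Normal) :
    ∃ act : Γ →* Module.End ℤ (Fin n → ℤ),
      ∀ γ x, γ * ι (.ofAdd x) = ι (.ofAdd (act γ x)) * γ := by
  choose s hs using fun (γ : Γ) (x : Fin n → ℤ) => hn.conj_mem (ι (.ofAdd x)) ⟨_, rfl⟩ γ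
  have hinj : ∀ x y : Fin n → ℤ, ι (.ofAdd x) = ι (.ofAdd y) → x = y := fun x y h => hι h
  have hs' : ∀ γ x, ι (.ofAdd ((s γ x).toAdd)) = γ * ι (.ofAdd x) * γ⁻¹ := hs
  have hadd : ∀ γ x y, (s γ (x + y)).toAdd = (s γ x).toAdd + (s γ y).toAdd := fun γ x y =>
    hinj _ _ (by
      rw [hs', ofAdd_add, map_mul, ofAdd_add, map_mul, hs', hs']; group)
  let A : Γ → Module.End ℤ (Fin n → ℤ) := fun γ =>
    (AddMonoidHom.mk' (fun x => (s γ x).toAdd) (hadd γ)).toIntLinearMap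
  have hA : ∀ γ x, ι (.ofAdd (A γ x)) = γ * ι (.ofAdd x) * γ⁻¹ := hs'
  refine ⟨⟨⟨A, ?_⟩, ?_⟩, fun γ x => ?_⟩
  · exact LinearMap.ext fun x => hinj _ _ (by rw [hA]; simp)
  · intro γ δ
    refine LinearMap.ext fun x => hinj _ _ ?_
    rw [hA, Module.End.mul_apply, hA, hA]; group
  · change _ = ι (.ofAdd (A γ x)) * γ
    rw [hA, inv_mul_cancel_right]

/-- Let `Γ` be an `n`-dimensional Bieberbach group (a torsion-free crystallographic group)
whose holonomy group `G` can be generated by `2` elements. Then `d(Γ) ≤ n`.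

The crystallographic structure is encoded by a short exact sequence
`0 → ℤⁿ →ι Γ →π G → 1` (with `G` finite, `ι` injective, `π` surjective and
`ker π = range ι`), such that the induced conjugation representation `ρ : G → GL_n(ℤ)` is
faithful; faithfulness is equivalent to the requirement that every element of `Γ` that
centralizes the translation lattice `ι(ℤⁿ)` already lies in `ι(ℤⁿ)`. -/
theorem minGenerators_le_of_bieberbach_two_generated_holonomy
    (n : ℕ) (Γ G : Type*) [Group Γ] [Group G] [Finite G]
    (ι : Multiplicative (Fin n → ℤ) →* Γ) (hι : Function.Injective ι)
    (π : Γ →* G) (hπ : Function.Surjective π)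
    (hexact : ∀ γ : Γ, π γ = 1 ↔ γ ∈ ι.range)
    (hfaithful : ∀ γ : Γ, (∀ x, γ * ι x * γ⁻¹ = ι x) → γ ∈ ι.range)
    (htf : ∀ γ : Γ, γ ≠ 1 → ¬ IsOfFinOrder γ)
    (hG : ∃ a b : G, Subgroup.closure {a, b} = ⊤) :
    minGenerators Γ ≤ n := by
  have hker : π.ker = ι.range := Subgroup.ext fun γ => hexact γ
  obtain ⟨act, hact⟩ := exists_conjugation_action ι hι (hker ▸ π.normal_ker)
  obtain ⟨a, b, hab⟩ := hG
  let D : BieberbachData n Γ G :=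
    { t := fun x => ι (.ofAdd x)
      π := π
      act := act
      t_add := fun x y => by rw [ofAdd_add, map_mul]
      t_inj := fun x y h => hι h
      conj := hact
      π_surj := hπ
      π_eq_one_iff := fun γ => (hexact γ).trans ⟨fun ⟨x, hx⟩ => ⟨x.toAdd, hx⟩, fun ⟨x, hx⟩ => ⟨_, hx⟩⟩
      faithful := fun γ h => (hexact γ).2 (hfaithful γ fun x => by
        have h1 := hact γ x.toAdd
        rw [h] at h1
        exact mul_inv_eq_of_eq_mul h1)
      torsionFree := fun γ k hk h => by
        by_contra hne
        exact htf γ hne (isOfFinOrder_iff_pow_eq_one.2 ⟨k, hk, h⟩) }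
  exact D.minGenerators_le hab
end
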